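/- Let d ≥ 1 and let A be a subset of ℙ^d, the set of d-tuples of primes. Suppose A has positive relative upper density in ℙ^d, i.e. limsup_{N→∞} |A ∩ [1,N]^d| / |ℙ ∩ [1,N]|^d > 0. Then A contains infinitely many nondegenerate corners: there are infinitely many pairs (x,t) ∈ ℤ^d × ℤ with t ≠ 0 such that x ∈ A and x + t·e_i ∈ A for every 1 ≤ i ≤ d. -/

import Mathlib

/-- The number of primes in `[1,N]`. -/
def primeCount (N : ℕ) : ℕ := ((Finset.Icc 1 N).filter Nat.Prime).card

/-- The relative upper density of a set `A` of `d`-tuples of primes. -/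
noncomputable def relUpperDensity (d : ℕ) (A : Set (Fin d → ℤ)) : ℝ :=
  Filter.limsup (fun N : ℕ =>
    ((A ∩ {x | ∀ i, 1 ≤ x i ∧ x i ≤ (N : ℤ)}).ncard : ℝ) / (primeCount N : ℝ) ^ d)
    Filter.atTop

namespace RelCorners
open MeasureTheory Set

section CondProb
variable {Ω : Type*} {m m0 : MeasurableSpace Ω}

/-- The conditional probability of the event `E` given `m`. -/
noncomputable def condProb (m : MeasurableSpace Ω) {m0 : MeasurableSpace Ω}
    (N : Measure Ω) (E : Set Ω) : Ω → ℝ := N[E.indicator (fun _ => (1 : ℝ)) | m]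

variable {N : Measure Ω} {E B : Set Ω}

lemma condProb_nonneg (E : Set Ω) : 0 ≤ᵐ[N] condProb m N E :=
  condExp_nonneg (Filter.Eventually.of_forall fun x => indicator_nonneg (fun _ _ => zero_le_one) x)

lemma integrable_condProb : Integrable (condProb m N E) N := integrable_condExp

lemma stronglyMeasurable_condProb : StronglyMeasurable[m] (condProb m N E) :=
  stronglyMeasurable_condExp

variable [IsProbabilityMeasure N]

lemma integrable_indicator_one (hE : MeasurableSet E) :
    Integrable (E.indicator (fun _ => (1 : ℝ))) N :=
  (integrable_const 1).indicator hE

lemma setIntegral_condProb_self (hm : m ≤ m0) (hE : MeasurableSet E) (hB : MeasurableSet[m] B) :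
    ∫ x in B, condProb m N E x ∂N = N.real (E ∩ B) := by
  rw [condProb, setIntegral_condExp hm (integrable_indicator_one hE) hB,
    integral_indicator hE]
  simp [Measure.restrict_restrict hE]

lemma condProb_le_one (hm : m ≤ m0) (hE : MeasurableSet E) : condProb m N E ≤ᵐ[N] fun _ => 1 := by
  have h := condExp_mono (m := m) (integrable_indicator_one (N := N) hE) (integrable_const (1 : ℝ))
    (Filter.Eventually.of_forall fun x => indicator_le_self' (fun _ _ => zero_le_one) x)
  rwa [condExp_const hm] at h

lemma integral_mul_condProb (hm : m ≤ m0) (hE : MeasurableSet E) {g : Ω → ℝ}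
    (hg : StronglyMeasurable[m] g) (hgb : ∀ᵐ x ∂N, ‖g x‖ ≤ 1) :
    ∫ x, g x * condProb m N E x ∂N = ∫ x in E, g x ∂N := by
  have h := condExp_stronglyMeasurable_mul_of_bound hm hg
    (integrable_indicator_one (N := N) hE) 1 hgb
  have h2 := integral_condExp (μ := N) (f := g * E.indicator (fun _ => (1 : ℝ))) hm
  rw [integral_congr_ae h] at h2
  rw [← integral_indicator hE]
  refine Eq.trans h2 (integral_congr_ae (Filter.Eventually.of_forall fun x => ?_))
  by_cases hx : x ∈ E <;> simp [hx]

lemma norm_condProb_le (hm : m ≤ m0) (hE : MeasurableSet E) :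
    ∀ᵐ x ∂N, ‖condProb m N E x‖ ≤ 1 := by
  filter_upwards [condProb_nonneg (m := m) (N := N) E, condProb_le_one hm hE] with x h0 h1
  rw [Real.norm_of_nonneg h0]; exact h1

lemma setIntegral_condProb_comm (hm : m ≤ m0) (hE : MeasurableSet E) (hB : MeasurableSet B) :
    ∫ x in B, condProb m N E x ∂N = ∫ x in E, condProb m N B x ∂N := by
  rw [← integral_mul_condProb hm hE stronglyMeasurable_condProb (norm_condProb_le hm hB),
    ← integral_mul_condProb hm hB stronglyMeasurable_condProb (norm_condProb_le hm hE)]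
  simp [mul_comm]

lemma condProb_eq_of_le {D m₁ m₂ : MeasurableSpace Ω} (h₂ : m₂ ≤ m0) (h1 : m₁ ≤ D) (h2 : D ≤ m₂)
    (h : condProb m₂ N E =ᵐ[N] condProb m₁ N E) : condProb D N E =ᵐ[N] condProb m₁ N E := by
  have a : N[condProb m₂ N E | D] =ᵐ[N] condProb D N E := condExp_condExp_of_le h2 h₂
  have b : N[condProb m₂ N E | D] =ᵐ[N] N[condProb m₁ N E | D] := condExp_congr_ae h
  rw [condExp_of_stronglyMeasurable (h2.trans h₂) (f := condProb m₁ N E)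
    (stronglyMeasurable_condProb.mono h1) integrable_condProb] at b
  exact a.symm.trans b

end CondProb

section Systems
variable {Ω ι : Type*} {𝒜 : Finset ι → Set (Set Ω)} {𝓕 𝓖 : Set (Finset ι)}

/-- The `σ`-algebra generated by the families `𝒜 e`, `e ∈ 𝓕`. -/
@[reducible]
def sig (𝒜 : Finset ι → Set (Set Ω)) (𝓕 : Set (Finset ι)) : MeasurableSpace Ω :=
  MeasurableSpace.generateFrom (⋃ e ∈ 𝓕, 𝒜 e)

lemma sig_mono (h : 𝓕 ⊆ 𝓖) : sig 𝒜 𝓕 ≤ sig 𝒜 𝓖 :=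
  MeasurableSpace.generateFrom_mono (biUnion_subset_biUnion_left h)

lemma measurableSet_sig {e : Finset ι} (he : e ∈ 𝓕) {A : Set Ω} (hA : A ∈ 𝒜 e) :
    MeasurableSet[sig 𝒜 𝓕] A :=
  MeasurableSpace.measurableSet_generateFrom (mem_biUnion he hA)

variable [m0 : MeasurableSpace Ω]

/-- A monotone family of set algebras of measurable sets, indexed by the finsets of `ι`. -/
structure IsSetSystem (𝒜 : Finset ι → Set (Set Ω)) : Prop where
  alg : ∀ e, IsSetAlgebra (𝒜 e)
  mono : Monotone 𝒜
  meas : ∀ e, ∀ A ∈ 𝒜 e, MeasurableSet A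

lemma IsSetSystem.sig_le (h𝒜 : IsSetSystem 𝒜) : sig 𝒜 𝓕 ≤ m0 :=
  MeasurableSpace.generateFrom_le fun t ht => by
    simp only [mem_iUnion] at ht
    obtain ⟨e, -, he⟩ := ht
    exact h𝒜.meas e t he

/-- Relative independence: the sets of `𝒜 e` are independent of the other families of at most the
same rank, relative to the families strictly below `e`. -/
def RelIndep [Fintype ι] (N : Measure Ω) (𝒜 : Finset ι → Set (Set Ω)) : Prop :=
  ∀ e : Finset ι, e ≠ Finset.univ → ∀ A ∈ 𝒜 e,
    condProb (sig 𝒜 {e' | e' ≠ e ∧ e'.card ≤ e.card}) N A =ᵐ[N] condProb (sig 𝒜 {e' | e' ⊂ e}) N A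

variable [Fintype ι] {N : Measure Ω} [IsProbabilityMeasure N]

lemma RelIndep.measureReal_inter_eq (hN : RelIndep N 𝒜) (h𝒜 : IsSetSystem 𝒜)
    {𝓕 : Set (Finset ι)} {e' : Finset ι}
    (he' : e' ≠ Finset.univ) (hne : e' ∉ 𝓕) (hcard : ∀ e ∈ 𝓕, e.card ≤ e'.card)
    (hsub : ∀ e, e ⊂ e' → e ∈ 𝓕) {i : ι} (hi : i ∉ e') {E B : Set Ω}
    (hE : MeasurableSet[sig 𝒜 {e | e ∈ insert e' 𝓕 ∧ i ∉ e}] E)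
    (hB : MeasurableSet[sig 𝒜 𝓕] B) :
    N.real (E ∩ B) = ∫ x in B, condProb (sig 𝒜 {e | e ∈ 𝓕 ∧ i ∉ e}) N E x ∂N := by
  set 𝓓 : Set (Finset ι) := {e | e ∈ 𝓕 ∧ i ∉ e}
  have hDle : (sig 𝒜 𝓓) ≤ m0 := h𝒜.sig_le
  have h𝓓 : 𝓓 ⊆ 𝓕 := fun e he => he.1
  have hDiD : sig 𝒜 𝓓 ≤ sig 𝒜 𝓕 := sig_mono h𝓓
  have hB0 : MeasurableSet B := h𝒜.sig_le B hB
  have hEle : sig 𝒜 {e | e ∈ insert e' 𝓕 ∧ i ∉ e} ≤ m0 := h𝒜.sig_le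
  rw [setIntegral_condProb_comm hDle (hEle E hE) hB0]
  let P : Set (Set Ω) := {S | ∃ A ∈ 𝒜 e', ∃ C, MeasurableSet[(sig 𝒜 𝓓)] C ∧ S = A ∩ C}
  have hgen : sig 𝒜 {e | e ∈ insert e' 𝓕 ∧ i ∉ e} = MeasurableSpace.generateFrom P := by
    apply le_antisymm
    · refine MeasurableSpace.generateFrom_le fun t ht => ?_
      simp only [mem_iUnion] at ht
      obtain ⟨e, ⟨he, hie⟩, ht⟩ := ht
      apply MeasurableSpace.measurableSet_generateFrom
      rcases he with rfl | he
      · exact ⟨t, ht, univ, MeasurableSet.univ, (inter_univ t).symm⟩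
      · exact ⟨univ, (h𝒜.alg e').univ_mem, t,
            measurableSet_sig (show e ∈ 𝓓 from ⟨he, hie⟩) ht, (univ_inter t).symm⟩
    · refine MeasurableSpace.generateFrom_le ?_
      rintro _ ⟨A, hA, C, hC, rfl⟩
      refine MeasurableSet.inter ?_ ?_
      · exact measurableSet_sig (𝓕 := {e | e ∈ insert e' 𝓕 ∧ i ∉ e}) ⟨mem_insert _ _, hi⟩ hA
      · exact sig_mono (𝓖 := {e | e ∈ insert e' 𝓕 ∧ i ∉ e})
          (fun e (he : e ∈ 𝓕 ∧ i ∉ e) => ⟨mem_insert_of_mem _ he.1, he.2⟩) C hC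
  have hpi : IsPiSystem P := by
    rintro _ ⟨A, hA, C, hC, rfl⟩ _ ⟨A', hA', C', hC', rfl⟩ -
    exact ⟨A ∩ A', (h𝒜.alg e').inter_mem hA hA', C ∩ C', hC.inter hC', by
      rw [inter_inter_inter_comm]⟩
  have hcp : Integrable (condProb (sig 𝒜 𝓓) N B) N := integrable_condProb
  have huniv : ∫ x, condProb (sig 𝒜 𝓓) N B x ∂N = N.real B := by
    have := setIntegral_condProb_self (N := N) hDle hB0 MeasurableSet.univ
    simpa using this
  have hA_eq : ∀ 𝓗 : Set (Finset ι), 𝓓 ⊆ 𝓗 → 𝓗 ⊆ 𝓕 → ∀ A ∈ 𝒜 e',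
      condProb (sig 𝒜 𝓗) N A =ᵐ[N] condProb (sig 𝒜 {e | e ⊂ e'}) N A := by
    intro 𝓗 h1 h2 A hA
    refine condProb_eq_of_le h𝒜.sig_le (sig_mono fun e he => h1 ?_)
      (sig_mono fun e he => ?_) (hN e' he' A hA)
    · exact ⟨hsub e he, fun h => hi (he.1 h)⟩
    · exact ⟨fun h => hne (h ▸ h2 he), hcard e (h2 he)⟩
  refine MeasurableSpace.induction_on_inter (C := fun E _ =>
    N.real (E ∩ B) = ∫ x in E, condProb (sig 𝒜 𝓓) N B x ∂N) hgen hpi ?_ ?_ ?_ ?_ E hE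
  · simp
  · rintro _ ⟨A, hA, C, hC, rfl⟩
    have hA0 := h𝒜.meas _ A hA
    have e1 := setIntegral_condProb_self (N := N) (h𝒜.sig_le) hA0 ((hDiD C hC).inter hB)
    rw [inter_assoc, ← e1]
    have e2 : ∫ x in C ∩ B, condProb (sig 𝒜 𝓕) N A x ∂N =
        ∫ x in C ∩ B, condProb (sig 𝒜 𝓓) N A x ∂N :=
      integral_congr_ae (ae_restrict_of_ae
        ((hA_eq _ h𝓓 le_rfl A hA).trans (hA_eq _ le_rfl h𝓓 A hA).symm))
    rw [e2]
    have e3 := integral_mul_condProb (N := N) hDle hB0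
      (g := C.indicator (condProb (sig 𝒜 𝓓) N A)) (stronglyMeasurable_condProb.indicator hC) (by
        filter_upwards [norm_condProb_le (N := N) hDle hA0] with x hx
        by_cases h : x ∈ C <;>
            simp only [h, indicator_of_mem, indicator_of_notMem, not_false_eq_true]
        · exact hx
        · simp)
    have e4 := integral_mul_condProb (N := N) hDle hA0
      (g := C.indicator (condProb (sig 𝒜 𝓓) N B)) (stronglyMeasurable_condProb.indicator hC) (by
        filter_upwards [norm_condProb_le (N := N) hDle hB0] with x hx
        by_cases h : x ∈ C <;>
            simp only [h, indicator_of_mem, indicator_of_notMem, not_false_eq_true]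
        · exact hx
        · simp)
    rw [setIntegral_indicator (hDle C hC)] at e3 e4
    rw [inter_comm C B, ← e3, ← e4]
    refine integral_congr_ae (Filter.Eventually.of_forall fun x => ?_)
    by_cases h : x ∈ C <;> simp [h, mul_comm]
  · intro t ht h
    have ht0 := hEle t ht
    have := integral_add_compl ht0 hcp
    have h3 := measureReal_inter_add_sdiff (μ := N) (s := B) ht0
    rw [inter_comm B t] at h3
    have h4 : tᶜ ∩ B = B \ t := by rw [inter_comm]; rfl
    rw [h4]; linarith
  · intro f hd hf h
    have h1 := hasSum_integral_iUnion (μ := N) (f := condProb (sig 𝒜 𝓓) N B)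
      (fun i => hEle _ (hf i)) hd
      hcp.integrableOn
    have h2 := hasSum_integral_iUnion (μ := N) (f := B.indicator fun _ => (1:ℝ))
      (fun i => hEle _ (hf i)) hd (integrable_indicator_one hB0).integrableOn
    have e : ∀ S, ∫ x in S, B.indicator (fun _ => (1:ℝ)) x ∂N = N.real (S ∩ B) := by
      intro S
      rw [setIntegral_indicator hB0]; simp
    simp only [e] at h2
    simp only [h] at h2
    exact h2.unique h1

end Systems
end RelCorners

namespace RelCorners
open MeasureTheory Set

section Atoms
variable {Ω : Type*} (𝒢 : Finset (Set Ω))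

open Classical in
/-- The atom of the finite family `𝒢` with signature `τ`. -/
def atom (τ : Finset (Set Ω)) : Set Ω := {ω | 𝒢.filter (fun G => ω ∈ G) = τ}

lemma atom_mem {𝒜 : Set (Set Ω)} (h𝒜 : IsSetAlgebra 𝒜) (h : ↑𝒢 ⊆ 𝒜) (τ : Finset (Set Ω)) :
    atom 𝒢 τ ∈ 𝒜 := by
  classical
  by_cases hτ : τ ⊆ 𝒢
  · have : atom 𝒢 τ = ⋂ G ∈ 𝒢, if G ∈ τ then G else Gᶜ := by
      ext ω
      simp only [atom, mem_ofPred_eq, mem_iInter, Finset.ext_iff, Finset.mem_filter]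
      constructor
      · intro hω G hG
        have := hω G
        split_ifs with hG' <;> simp_all
      · intro hω G
        constructor
        · rintro ⟨hG, hGω⟩
          have := hω G hG
          by_contra hG'
          rw [if_neg hG'] at this
          exact this hGω
        · intro hG
          have := hω G (hτ hG)
          rw [if_pos hG] at this
          exact ⟨hτ hG, this⟩
    rw [this]
    refine h𝒜.biInter_mem 𝒢 fun G hG => ?_
    split_ifs
    · exact h hG
    · exact h𝒜.compl_mem (h hG)
  · have : atom 𝒢 τ = ∅ := by
      ext ω
      simp only [atom, mem_ofPred_eq, mem_empty_iff_false, iff_false]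
      rintro rfl
      exact hτ (Finset.filter_subset _ _)
    rw [this]; exact h𝒜.empty_mem

lemma exists_inter_atom_eq {m : MeasurableSpace Ω} {E : Set Ω}
    (hE : MeasurableSet[m ⊔ MeasurableSpace.generateFrom ↑𝒢] E) (τ : Finset (Set Ω)) :
    ∃ S, MeasurableSet[m] S ∧ E ∩ atom 𝒢 τ = S ∩ atom 𝒢 τ := by
  classical
  rw [← @MeasurableSpace.generateFrom_measurableSet Ω m,
    MeasurableSpace.generateFrom_sup_generateFrom] at hE
  induction E, hE using MeasurableSpace.generateFrom_induction with
  | hC t ht _ =>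
    rcases ht with ht | ht
    · exact ⟨t, ht, rfl⟩
    · by_cases h : t ∈ τ
      · refine ⟨univ, MeasurableSet.univ, ?_⟩
        ext ω
        simp only [atom, mem_inter_iff, mem_ofPred_eq, mem_univ, true_and, and_iff_right_iff_imp]
        rintro rfl
        exact (Finset.mem_filter.1 h).2
      · refine ⟨∅, MeasurableSet.empty, ?_⟩
        ext ω
        simp only [atom, mem_inter_iff, mem_ofPred_eq, mem_empty_iff_false, false_and, iff_false,
          not_and]
        rintro hω rfl
        exact h (Finset.mem_filter.2 ⟨ht, hω⟩)
  | empty => exact ⟨∅, MeasurableSet.empty, rfl⟩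
  | compl t _ ih =>
    obtain ⟨S, hS, h⟩ := ih
    refine ⟨Sᶜ, hS.compl, ?_⟩
    ext ω
    have := congrArg (ω ∈ ·) h
    simp only [mem_inter_iff, eq_iff_iff, mem_compl_iff] at this ⊢
    tauto
  | iUnion f _ ih =>
    choose S hS h using ih
    refine ⟨⋃ n, S n, MeasurableSet.iUnion hS, ?_⟩
    rw [iUnion_inter, iUnion_inter, iUnion_congr h]

end Atoms

lemma measureReal_diff_le_of_approx {Ω : Type*} {m m0 : MeasurableSpace Ω} {N : Measure Ω}
    [IsProbabilityMeasure N] (hm : m ≤ m0) {E E' S c : Set Ω}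
    (hE : MeasurableSet E) (hc : MeasurableSet c) (hS : MeasurableSet[m] S)
    (hES : E' ∩ c = S ∩ c) {η : ℝ} (hη : 0 < η) :
    N.real ((E ∩ c) \ {x | condProb m N (c \ E) x < η * condProb m N c x}) ≤
      (1 + 1 / η) * N.real (symmDiff E' E ∩ c) := by
  set B := {x | condProb m N (c \ E) x < η * condProb m N c x}
  have hB : MeasurableSet[m] B := by
    have h1 : StronglyMeasurable[m] (condProb m N (c \ E)) := stronglyMeasurable_condProb
    have h2 : StronglyMeasurable[m] (condProb m N c) := stronglyMeasurable_condProb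
    exact h1.measurableSet_lt (stronglyMeasurable_const.mul h2)
  have hSB : MeasurableSet[m] (S \ B) := MeasurableSet.diff hS hB
  have e1 := setIntegral_condProb_self (N := N) hm hc hSB
  have e2 := setIntegral_condProb_self (N := N) hm (hc.diff hE) hSB
  have h1 : η * N.real (c ∩ (S \ B)) ≤ N.real ((c \ E) ∩ (S \ B)) := by
    rw [← e1, ← e2, ← integral_const_mul]
    refine setIntegral_mono_on (integrable_condProb.const_mul η).integrableOn
      integrable_condProb.integrableOn (hm _ hSB) fun x hx => ?_
    exact not_lt.1 hx.2
  have h2 : N.real ((c \ E) ∩ (S \ B)) ≤ N.real (symmDiff E' E ∩ c) := by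
    refine measureReal_mono ?_
    rintro x ⟨⟨hxc, hxE⟩, hxS, -⟩
    have : x ∈ E' ∩ c := hES ▸ ⟨hxS, hxc⟩
    exact ⟨Or.inl ⟨this.1, hxE⟩, hxc⟩
  have h3 : N.real ((E ∩ c) \ B) ≤ N.real (symmDiff E' E ∩ c) + N.real (c ∩ (S \ B)) := by
    refine (measureReal_mono ?_).trans (measureReal_union_le _ _)
    rintro x ⟨⟨hxE, hxc⟩, hxB⟩
    by_cases hx : x ∈ E'
    · have : x ∈ S ∩ c := hES ▸ ⟨hx, hxc⟩
      exact Or.inr ⟨hxc, this.1, hxB⟩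
    · exact Or.inl ⟨Or.inr ⟨hxE, hx⟩, hxc⟩
  have h4 : N.real (c ∩ (S \ B)) ≤ 1 / η * N.real (symmDiff E' E ∩ c) := by
    rw [one_div, ← div_eq_inv_mul, le_div_iff₀ hη]; linarith
  linarith

section Removal
variable {Ω ι : Type*} {m0 : MeasurableSpace Ω} {𝒜 : Finset ι → Set (Set Ω)}
  {N : Measure Ω} [IsProbabilityMeasure N]

lemma IsSetSystem.exists_approx (h𝒜 : IsSetSystem 𝒜) {𝓕 : Set (Finset ι)} {e' : Finset ι} {i : ι}
    (hi : i ∉ e') {E : Set Ω} (hE : MeasurableSet[sig 𝒜 {e | e ∈ insert e' 𝓕 ∧ i ∉ e}] E)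
    {ε : ℝ} (hε : 0 < ε) :
    ∃ 𝒢 : Finset (Set Ω), ↑𝒢 ⊆ 𝒜 e' ∧ ∃ E', MeasurableSet[sig 𝒜 {e | e ∈ 𝓕 ∧ i ∉ e} ⊔
      MeasurableSpace.generateFrom ↑𝒢] E' ∧ N.real (symmDiff E' E) < ε := by
  classical
  have hle : sig 𝒜 {e | e ∈ insert e' 𝓕 ∧ i ∉ e} ≤ m0 := h𝒜.sig_le
  let C : Set (Set Ω) := {S | ∃ 𝒢 : Finset (Set Ω), ↑𝒢 ⊆ 𝒜 e' ∧
    MeasurableSet[sig 𝒜 {e | e ∈ 𝓕 ∧ i ∉ e} ⊔ MeasurableSpace.generateFrom ↑𝒢] S}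
  have hC : IsSetAlgebra C := by
    refine ⟨⟨∅, by simp, MeasurableSpace.measurableSet_empty _⟩, ?_, ?_⟩
    · rintro s ⟨𝒢, h, hs⟩
      exact ⟨𝒢, h, hs.compl⟩
    · rintro s t ⟨𝒢, h, hs⟩ ⟨𝒢', h', hs'⟩
      refine ⟨𝒢 ∪ 𝒢', by simp [h, h'], MeasurableSet.union ?_ ?_⟩
      · exact sup_le_sup_left (MeasurableSpace.generateFrom_mono (by simp)) _ s hs
      · exact sup_le_sup_left (MeasurableSpace.generateFrom_mono (by simp)) _ t hs'
  have hgen : sig 𝒜 {e | e ∈ insert e' 𝓕 ∧ i ∉ e} = MeasurableSpace.generateFrom C := by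
    apply le_antisymm
    · refine MeasurableSpace.generateFrom_le fun t ht => ?_
      simp only [mem_iUnion] at ht
      obtain ⟨e, ⟨he, hie⟩, ht⟩ := ht
      apply MeasurableSpace.measurableSet_generateFrom
      rcases he with rfl | he
      · refine ⟨{t}, by simpa using ht, ?_⟩
        exact le_sup_right (a := sig 𝒜 {e | e ∈ 𝓕 ∧ i ∉ e}) t
          (MeasurableSpace.measurableSet_generateFrom (by simp))
      · refine ⟨∅, by simp, ?_⟩
        exact le_sup_left (a := sig 𝒜 {e | e ∈ 𝓕 ∧ i ∉ e}) t
          (measurableSet_sig (𝓕 := {e | e ∈ 𝓕 ∧ i ∉ e}) ⟨he, hie⟩ ht)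
    · refine MeasurableSpace.generateFrom_le ?_
      rintro t ⟨𝒢, h, ht⟩
      refine sup_le (sig_mono (𝓖 := {e | e ∈ insert e' 𝓕 ∧ i ∉ e})
        fun e (he : e ∈ 𝓕 ∧ i ∉ e) => ⟨mem_insert_of_mem _ he.1, he.2⟩)
        (MeasurableSpace.generateFrom_le fun G hG => ?_) t ht
      exact measurableSet_sig (𝓕 := {e | e ∈ insert e' 𝓕 ∧ i ∉ e}) ⟨mem_insert _ _, hi⟩ (h hG)
  obtain ⟨t, ⟨𝒢, h, ht⟩, htε⟩ :=
    @exists_measure_symmDiff_lt_of_generateFrom_isSetRing Ω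
      (sig 𝒜 {e | e ∈ insert e' 𝓕 ∧ i ∉ e}) (N.trim hle) _ C hC.isSetRing
      ⟨{univ}, countable_singleton _, by simpa using hC.univ_mem, by simp⟩ hgen E hE
      (ENNReal.ofReal ε) (by simpa using hε)
  refine ⟨𝒢, h, t, ht, ?_⟩
  have htm : MeasurableSet[sig 𝒜 {e | e ∈ insert e' 𝓕 ∧ i ∉ e}] t := by
    rw [hgen]; exact MeasurableSpace.measurableSet_generateFrom ⟨𝒢, h, ht⟩
  have hsd : MeasurableSet[sig 𝒜 {e | e ∈ insert e' 𝓕 ∧ i ∉ e}] (symmDiff t E) := htm.symmDiff hE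
  rw [trim_measurableSet_eq hle hsd] at htε
  exact (ENNReal.lt_ofReal_iff_toReal_lt (measure_ne_top _ _)).1 htε

variable [Fintype ι] [DecidableEq ι]

/-- The removal property for families of events `E i` measurable with respect to the members of `𝓕`
avoiding `i`. -/
def RemovalProp (N : Measure Ω) (𝒜 : Finset ι → Set (Set Ω)) (𝓕 : Set (Finset ι)) : Prop :=
  ∀ E : ι → Set Ω, (∀ i, MeasurableSet[sig 𝒜 {e | e ∈ 𝓕 ∧ i ∉ e}] (E i)) →
    N.real (⋂ i, E i) = 0 → ∀ ε > 0, ∃ F : ι → Set Ω,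
      (∀ i, F i ∈ 𝒜 (Finset.univ.erase i)) ∧ ⋂ i, F i = ∅ ∧ ∀ i, N.real (E i \ F i) ≤ ε

lemma removalProp_empty (h𝒜 : IsSetSystem 𝒜) : RemovalProp N 𝒜 ∅ := by
  intro E hE hN ε hε
  have h : ∀ i, E i = ∅ ∨ E i = univ := by
    intro i
    have := hE i
    have e : {e : Finset ι | e ∈ (∅ : Set (Finset ι)) ∧ i ∉ e} = ∅ := by simp
    have e' : sig 𝒜 ∅ = ⊥ := by simp [sig]
    rw [e, e'] at this
    exact MeasurableSpace.measurableSet_bot_iff.1 this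
  refine ⟨E, fun i => ?_, ?_, fun i => by simpa using hε.le⟩
  · rcases h i with h | h <;> rw [h]
    · exact (h𝒜.alg _).empty_mem
    · exact (h𝒜.alg _).univ_mem
  · by_contra hne
    have : ∀ i, E i = univ := fun i => (h i).resolve_left fun h0 =>
      hne (subset_empty_iff.1 ((iInter_subset E i).trans h0.subset))
    simp [this] at hN

lemma RelIndep.measureReal_iInter_eq_zero (hN : RelIndep N 𝒜) (h𝒜 : IsSetSystem 𝒜)
    {𝓕 : Set (Finset ι)} {e' : Finset ι}
    (he' : e' ≠ Finset.univ) (hne : e' ∉ 𝓕) (hcard : ∀ e ∈ 𝓕, e.card ≤ e'.card)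
    (hsub : ∀ e, e ⊂ e' → e ∈ 𝓕) {E E' : ι → Set Ω} {c : Set Ω} (hc : c ∈ 𝒜 e')
    (hE : ∀ i, MeasurableSet[sig 𝒜 {e | e ∈ insert e' 𝓕 ∧ i ∉ e}] (E i))
    (h0 : N.real (⋂ i, E i) = 0) {η : ℝ} (hη : 0 < η) (hη1 : η * Fintype.card ι < 1)
    (hE'1 : ∀ i ∈ e', E' i = E i)
    (hE'2 : ∀ i ∉ e', E' i = {x | condProb (sig 𝒜 {e | e ∈ 𝓕 ∧ i ∉ e}) N (c \ E i) x <
      η * condProb (sig 𝒜 {e | e ∈ 𝓕 ∧ i ∉ e}) N c x})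
    (hE' : ∀ i, MeasurableSet[sig 𝒜 {e | e ∈ 𝓕 ∧ i ∉ e}] (E' i)) :
    N.real (⋂ i, E' i) = 0 := by
  classical
  set T := ⋂ i, E' i
  obtain ⟨i₀, hi₀⟩ : ∃ i, i ∉ e' := by
    by_contra! h
    exact he' (Finset.eq_univ_iff_forall.2 h)
  have hT : MeasurableSet[sig 𝒜 𝓕] T :=
    MeasurableSet.iInter fun i => sig_mono (𝓖 := 𝓕)
      (fun e (he : e ∈ 𝓕 ∧ i ∉ e) => he.1) _ (hE' i)
  have hT0 : MeasurableSet T := h𝒜.sig_le T hT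
  have hc0 : MeasurableSet c := h𝒜.meas _ _ hc
  have hcm : ∀ i ∉ e', MeasurableSet[sig 𝒜 {e | e ∈ insert e' 𝓕 ∧ i ∉ e}] c := fun i hi =>
    measurableSet_sig (𝓕 := {e | e ∈ insert e' 𝓕 ∧ i ∉ e}) ⟨mem_insert _ _, hi⟩ hc
  have hp : ∀ i ∉ e', N.real (c ∩ T) =
      ∫ x in T, condProb (sig 𝒜 {e | e ∈ 𝓕 ∧ i ∉ e}) N c x ∂N := fun i hi =>
    hN.measureReal_inter_eq h𝒜 he' hne hcard hsub hi (hcm i hi) hT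
  have hq : ∀ i ∉ e', N.real ((c \ E i) ∩ T) =
      ∫ x in T, condProb (sig 𝒜 {e | e ∈ 𝓕 ∧ i ∉ e}) N (c \ E i) x ∂N := fun i hi =>
    hN.measureReal_inter_eq h𝒜 he' hne hcard hsub hi
      (MeasurableSet.diff (hcm i hi) (hE i)) hT
  have hqp : ∀ i ∉ e', N.real ((c \ E i) ∩ T) ≤ η * N.real (c ∩ T) := by
    intro i hi
    rw [hp i hi, hq i hi, ← integral_const_mul]
    refine setIntegral_mono_on integrable_condProb.integrableOn
      (integrable_condProb.const_mul η).integrableOn hT0 fun x hx => ?_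
    have : x ∈ E' i := mem_iInter.1 hx i
    rw [hE'2 i hi] at this
    exact le_of_lt this
  have hcT : N.real (c ∩ T) = 0 := by
    have h1 : N.real (c ∩ T) ≤ N.real (⋂ i, E i) +
        N.real (⋃ i ∈ Finset.univ.filter (· ∉ e'), (c \ E i) ∩ T) := by
      refine (measureReal_mono ?_).trans (measureReal_union_le _ _)
      rintro x ⟨hxc, hxT⟩
      by_cases h : ∀ i, x ∈ E i
      · exact Or.inl (mem_iInter.2 h)
      · push Not at h
        obtain ⟨i, hi⟩ := h
        have hie : i ∉ e' := fun hie => hi (hE'1 i hie ▸ mem_iInter.1 hxT i)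
        exact Or.inr (mem_biUnion (x := i) (by simpa using hie) ⟨⟨hxc, hi⟩, hxT⟩)
    have h2 := measureReal_biUnion_finset_le (μ := N) (Finset.univ.filter (· ∉ e'))
      (fun i => (c \ E i) ∩ T)
    have h3 : ∑ i ∈ Finset.univ.filter (· ∉ e'), N.real ((c \ E i) ∩ T) ≤
        Fintype.card ι * (η * N.real (c ∩ T)) := by
      refine (Finset.sum_le_card_nsmul _ _ (η * N.real (c ∩ T)) fun i hi => ?_).trans ?_
      · exact hqp i (by simpa using hi)
      · rw [nsmul_eq_mul]
        refine mul_le_mul_of_nonneg_right ?_ (by positivity)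
        exact_mod_cast Finset.card_le_univ _
    have h4 : 0 ≤ N.real (c ∩ T) := measureReal_nonneg
    nlinarith
  rw [hp i₀ hi₀, setIntegral_eq_zero_iff_of_nonneg_ae
    (ae_restrict_of_ae (condProb_nonneg c)) integrable_condProb.integrableOn] at hcT
  have hq0 : ∀ᵐ x ∂(N.restrict T),
      0 ≤ condProb (sig 𝒜 {e | e ∈ 𝓕 ∧ i₀ ∉ e}) N (c \ E i₀) x :=
    ae_restrict_of_ae (condProb_nonneg _)
  have hF : ∀ᵐ x ∂(N.restrict T), False := by
    filter_upwards [hcT, hq0, ae_restrict_mem hT0] with x h1 h2 h3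
    have : x ∈ E' i₀ := mem_iInter.1 h3 i₀
    rw [hE'2 i₀ hi₀] at this
    have h4 : condProb (sig 𝒜 {e | e ∈ 𝓕 ∧ i₀ ∉ e}) N (c \ E i₀) x <
      η * condProb (sig 𝒜 {e | e ∈ 𝓕 ∧ i₀ ∉ e}) N c x := this
    rw [h1] at h4
    simp at h4
    linarith
  rw [Filter.eventually_false_iff_eq_bot, ae_eq_bot, Measure.restrict_eq_zero] at hF
  simp [measureReal_def, hF]

lemma RelIndep.removalProp_insert (hN : RelIndep N 𝒜) (h𝒜 : IsSetSystem 𝒜)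
    {𝓕 : Set (Finset ι)} {e' : Finset ι}
    (he' : e' ≠ Finset.univ) (hne : e' ∉ 𝓕) (hcard : ∀ e ∈ 𝓕, e.card ≤ e'.card)
    (hsub : ∀ e, e ⊂ e' → e ∈ 𝓕) (hQ : RemovalProp N 𝒜 𝓕) : RemovalProp N 𝒜 (insert e' 𝓕) := by
  classical
  intro E hE hE0 ε hε
  have hle : ∀ i, sig 𝒜 {e | e ∈ 𝓕 ∧ i ∉ e} ≤ m0 := fun i => h𝒜.sig_le
  have hEm : ∀ i, MeasurableSet (E i) := fun i => h𝒜.sig_le _ (hE i)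
  obtain ⟨i₀, hi₀⟩ : ∃ i, i ∉ e' := by
    by_contra! h
    exact he' (Finset.eq_univ_iff_forall.2 h)
  have hcardpos : (0 : ℝ) < Fintype.card ι := by
    exact_mod_cast Fintype.card_pos_iff.2 ⟨i₀⟩
  set η : ℝ := 1 / (2 * Fintype.card ι) with hηdef
  have hη : 0 < η := by positivity
  have hη1 : η * Fintype.card ι < 1 := by
    rw [hηdef]; field_simp; norm_num
  set ε₂ : ℝ := ε / 2 / (1 + 1 / η) with hε₂
  have hε₂0 : 0 < ε₂ := by positivity
  have happ : ∀ i, ∃ 𝒢 : Finset (Set Ω), ↑𝒢 ⊆ 𝒜 e' ∧ (i ∉ e' → ∃ E',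
      MeasurableSet[sig 𝒜 {e | e ∈ 𝓕 ∧ i ∉ e} ⊔ MeasurableSpace.generateFrom ↑𝒢] E' ∧
        N.real (symmDiff E' (E i)) < ε₂) := by
    intro i
    by_cases hi : i ∈ e'
    · exact ⟨∅, by simp, fun h => absurd hi h⟩
    · obtain ⟨𝒢, h1, h2⟩ := h𝒜.exists_approx (N := N) hi (hE i) hε₂0
      exact ⟨𝒢, h1, fun _ => h2⟩
  choose 𝒢' h𝒢' happ using happ
  set 𝒢 : Finset (Set Ω) := Finset.univ.biUnion 𝒢' with h𝒢def
  have h𝒢 : ↑𝒢 ⊆ 𝒜 e' := by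
    intro G hG
    simp only [h𝒢def, Finset.coe_biUnion, mem_iUnion] at hG
    obtain ⟨i, -, hG⟩ := hG
    exact h𝒢' i hG
  choose! A hA hAε using happ
  have hA' : ∀ i ∉ e', ∀ τ, ∃ S, MeasurableSet[sig 𝒜 {e | e ∈ 𝓕 ∧ i ∉ e}] S ∧
      A i ∩ atom 𝒢 τ = S ∩ atom 𝒢 τ := by
    intro i hi τ
    refine exists_inter_atom_eq 𝒢 (m := sig 𝒜 {e | e ∈ 𝓕 ∧ i ∉ e}) ?_ τ
    refine sup_le_sup_left (MeasurableSpace.generateFrom_mono ?_) _ _ (hA i hi)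
    exact_mod_cast Finset.subset_biUnion_of_mem 𝒢' (Finset.mem_univ i)
  have hcmem : ∀ τ, atom 𝒢 τ ∈ 𝒜 e' := fun τ => atom_mem 𝒢 (h𝒜.alg e') h𝒢 τ
  have hcm : ∀ τ, MeasurableSet (atom 𝒢 τ) := fun τ => h𝒜.meas _ _ (hcmem τ)
  set E' : Finset (Set Ω) → ι → Set Ω := fun τ i => if i ∈ e' then E i else
    {x | condProb (sig 𝒜 {e | e ∈ 𝓕 ∧ i ∉ e}) N (atom 𝒢 τ \ E i) x <
      η * condProb (sig 𝒜 {e | e ∈ 𝓕 ∧ i ∉ e}) N (atom 𝒢 τ) x} with hE'def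
  have hE'1 : ∀ τ, ∀ i ∈ e', E' τ i = E i := fun τ i hi => by simp [hE'def, hi]
  have hE'2 : ∀ τ, ∀ i ∉ e', E' τ i =
    {x | condProb (sig 𝒜 {e | e ∈ 𝓕 ∧ i ∉ e}) N (atom 𝒢 τ \ E i) x <
      η * condProb (sig 𝒜 {e | e ∈ 𝓕 ∧ i ∉ e}) N (atom 𝒢 τ) x} := fun τ i hi => by
    simp [hE'def, hi]
  have hE' : ∀ τ i, MeasurableSet[sig 𝒜 {e | e ∈ 𝓕 ∧ i ∉ e}] (E' τ i) := by
    intro τ i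
    by_cases hi : i ∈ e'
    · rw [hE'1 τ i hi]
      refine sig_mono (𝓖 := {e | e ∈ 𝓕 ∧ i ∉ e}) ?_ _ (hE i)
      rintro e ⟨rfl | h1, h2⟩
      · exact absurd hi h2
      · exact ⟨h1, h2⟩
    · rw [hE'2 τ i hi]
      exact stronglyMeasurable_condProb.measurableSet_lt
        (stronglyMeasurable_const.mul stronglyMeasurable_condProb)
  set K : ℝ := (𝒢.powerset.card : ℝ)
  have hK : 0 < K := by
    simp only [K]; exact_mod_cast Finset.card_pos.2 ⟨∅, by simp⟩
  have hIH := fun τ => hQ (E' τ) (hE' τ) (hN.measureReal_iInter_eq_zero h𝒜 he' hne hcard hsub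
    (hcmem τ) hE hE0 hη hη1 (hE'1 τ) (hE'2 τ) (hE' τ)) (ε / 2 / K) (by positivity)
  choose F hF1 hF2 hF3 using hIH
  have hcov : ∀ x, ∃ τ ∈ 𝒢.powerset, x ∈ atom 𝒢 τ := fun x =>
    ⟨𝒢.filter (fun G => x ∈ G), by simp, rfl⟩
  have hdisj : ∀ x τ τ', x ∈ atom 𝒢 τ → x ∈ atom 𝒢 τ' → τ = τ' := fun x τ τ' h h' => h.symm.trans h'
  refine ⟨fun i => if i ∈ e' then ⋂ τ ∈ 𝒢.powerset, F τ i
    else ⋃ τ ∈ 𝒢.powerset, atom 𝒢 τ ∩ F τ i, fun i => ?_, ?_, fun i => ?_⟩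
  · dsimp only
    split_ifs with hi
    · exact (h𝒜.alg _).biInter_mem _ fun τ _ => hF1 τ i
    · refine (h𝒜.alg _).biUnion_mem _ fun τ _ => (h𝒜.alg _).inter_mem ?_ (hF1 τ i)
      refine h𝒜.mono ?_ (hcmem τ)
      intro j hj
      exact Finset.mem_erase.2 ⟨fun h => hi (h ▸ hj), Finset.mem_univ j⟩
  · refine eq_empty_of_forall_notMem fun x hx => ?_
    obtain ⟨τ, hτ, hxτ⟩ := hcov x
    have : x ∈ ⋂ i, F τ i := by
      refine mem_iInter.2 fun i => ?_
      have h := mem_iInter.1 hx i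
      split_ifs at h with hi
      · exact mem_iInter₂.1 h τ hτ
      · obtain ⟨τ', -, h1, h2⟩ := mem_iUnion₂.1 h
        rwa [hdisj x τ τ' hxτ h1]
    rw [hF2 τ] at this
    exact this
  · dsimp only
    have hsum : ∑ τ ∈ 𝒢.powerset, N.real (E' τ i \ F τ i) ≤ ε / 2 := by
      refine (Finset.sum_le_card_nsmul _ _ _ fun τ _ => hF3 τ i).trans ?_
      rw [nsmul_eq_mul]; simp only [K] at hK ⊢; field_simp; rfl
    split_ifs with hi
    · have h1 : E i \ (⋂ τ ∈ 𝒢.powerset, F τ i) ⊆ ⋃ τ ∈ 𝒢.powerset, (E' τ i \ F τ i) := by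
        rintro x ⟨hx, hxF⟩
        simp only [mem_iInter, not_forall] at hxF
        obtain ⟨τ, hτ, hxF⟩ := hxF
        exact mem_biUnion hτ ⟨by rwa [hE'1 τ i hi], hxF⟩
      have := (measureReal_mono (μ := N) h1 (measure_ne_top _ _)).trans
        (measureReal_biUnion_finset_le _ _)
      linarith
    · have h1 : E i \ (⋃ τ ∈ 𝒢.powerset, atom 𝒢 τ ∩ F τ i) ⊆
          (⋃ τ ∈ 𝒢.powerset, (E' τ i \ F τ i)) ∪
            ⋃ τ ∈ 𝒢.powerset, ((E i ∩ atom 𝒢 τ) \ E' τ i) := by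
        rintro x ⟨hx, hxF⟩
        obtain ⟨τ, hτ, hxτ⟩ := hcov x
        by_cases hxE : x ∈ E' τ i
        · refine Or.inl (mem_biUnion hτ ⟨hxE, fun h => hxF ?_⟩)
          exact mem_biUnion (x := τ) hτ ⟨hxτ, h⟩
        · exact Or.inr (mem_biUnion (x := τ) hτ ⟨⟨hx, hxτ⟩, hxE⟩)
      have h2 := (measureReal_mono (μ := N) h1 (measure_ne_top _ _)).trans
        (measureReal_union_le _ _)
      have h3 := measureReal_biUnion_finset_le (μ := N) 𝒢.powerset (fun τ => E' τ i \ F τ i)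
      have h4 := measureReal_biUnion_finset_le (μ := N) 𝒢.powerset
        (fun τ => (E i ∩ atom 𝒢 τ) \ E' τ i)
      have h5 : ∑ τ ∈ 𝒢.powerset, N.real ((E i ∩ atom 𝒢 τ) \ E' τ i) ≤ ε / 2 := by
        have h6 : ∀ τ ∈ 𝒢.powerset, N.real ((E i ∩ atom 𝒢 τ) \ E' τ i) ≤
            (1 + 1 / η) * N.real (symmDiff (A i) (E i) ∩ atom 𝒢 τ) := by
          intro τ _
          obtain ⟨S, hS, hS'⟩ := hA' i hi τ
          rw [hE'2 τ i hi]
          exact measureReal_diff_le_of_approx (hle i) (hEm i) (hcm τ) hS hS' hη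
        have hle2 : sig 𝒜 {e | e ∈ 𝓕 ∧ i ∉ e} ⊔ MeasurableSpace.generateFrom ↑(𝒢' i) ≤ m0 :=
          sup_le (hle i) (MeasurableSpace.generateFrom_le fun G hG => h𝒜.meas _ _ (h𝒢' i hG))
        have hAm : MeasurableSet (A i) := hle2 _ (hA i hi)
        have h7 : ∑ τ ∈ 𝒢.powerset, N.real (symmDiff (A i) (E i) ∩ atom 𝒢 τ) ≤
            N.real (symmDiff (A i) (E i)) := by
          rw [← measureReal_biUnion_finset]
          · exact measureReal_mono (iUnion₂_subset fun τ _ => inter_subset_left)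
          · intro τ _ τ' _ hne
            refine disjoint_left.2 fun x hx hx' => hne (hdisj x _ _ hx.2 hx'.2)
          · intro τ _
            exact (hAm.symmDiff (hEm i)).inter (hcm τ)
        refine (Finset.sum_le_sum h6).trans ?_
        rw [← Finset.mul_sum]
        calc (1 + 1 / η) * _ ≤ (1 + 1 / η) * ε₂ := by
              refine mul_le_mul_of_nonneg_left (h7.trans (hAε i hi).le) (by positivity)
          _ = ε / 2 := by rw [hε₂]; field_simp
      linarith

/-- The removal theorem for relatively independent systems of set algebras. -/
theorem RelIndep.exists_removal (hN : RelIndep N 𝒜) (h𝒜 : IsSetSystem 𝒜) {A : ι → Set Ω}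
    (hA : ∀ i, A i ∈ 𝒜 (Finset.univ.erase i)) (h0 : N.real (⋂ i, A i) = 0) {ε : ℝ} (hε : 0 < ε) :
    ∃ F : ι → Set Ω, (∀ i, F i ∈ 𝒜 (Finset.univ.erase i)) ∧ ⋂ i, F i = ∅ ∧
      ∀ i, N.real (A i \ F i) ≤ ε := by
  have key : ∀ 𝓕 : Finset (Finset ι), Finset.univ ∉ 𝓕 →
      (∀ e ∈ 𝓕, ∀ e', e' ⊂ e → e' ∈ 𝓕) → RemovalProp N 𝒜 ↑𝓕 := by
    intro 𝓕
    refine Finset.induction_on_max_value Finset.card 𝓕 ?_ ?_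
    · intro _ _; simpa using removalProp_empty h𝒜
    · intro e' 𝓕 hne hmax ih hu hd
      have hlow : ∀ e ∈ 𝓕, ∀ e'', e'' ⊂ e → e'' ∈ 𝓕 := by
        intro e he e'' hlt
        refine Finset.mem_of_mem_insert_of_ne (hd e (Finset.mem_insert_of_mem he) e'' hlt) ?_
        rintro rfl
        exact absurd (hmax e he) (not_le.2 (Finset.card_lt_card hlt))
      rw [Finset.coe_insert]
      refine hN.removalProp_insert h𝒜 ?_ (by simpa using hne) (by simpa using hmax) ?_
        (ih (fun h => hu (Finset.mem_insert_of_mem h)) hlow)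
      · rintro rfl; exact hu (Finset.mem_insert_self _ _)
      · intro e he
        exact Finset.mem_of_mem_insert_of_ne (hd e' (Finset.mem_insert_self _ _) e he) he.ne
  refine key (Finset.univ.erase Finset.univ) (by simp) ?_ A (fun i => ?_) h0 ε hε
  · intro e he e' hlt
    refine Finset.mem_erase.2 ⟨?_, Finset.mem_univ _⟩
    rintro rfl
    exact hlt.2 (Finset.subset_univ e)
  · refine measurableSet_sig (e := Finset.univ.erase i) ?_ (hA i)
    refine ⟨?_, Finset.notMem_erase i _⟩
    simp only [Finset.coe_erase, mem_sdiff, Finset.coe_univ, mem_univ, true_and, mem_singleton_iff]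
    intro h
    exact absurd (Finset.mem_univ i) (h ▸ Finset.notMem_erase i Finset.univ)

end Removal
end RelCorners

namespace RelCorners
open MeasureTheory Set Filter Topology
open scoped ENNReal

section Internal
variable {X : ℕ → Type*}

/-- The internal subset of the ultraproduct determined by a sequence of sets. -/
def intl (A : ∀ n, Set (X n)) : Set (∀ n, X n) := {ω | ∀ᶠ n in hyperfilter ℕ, ω n ∈ A n}

lemma mem_intl {A : ∀ n, Set (X n)} {ω : ∀ n, X n} :
    ω ∈ intl A ↔ ∀ᶠ n in hyperfilter ℕ, ω n ∈ A n := Iff.rfl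

lemma intl_inter (A B : ∀ n, Set (X n)) : intl (fun n => A n ∩ B n) = intl A ∩ intl B := by
  ext ω; exact eventually_and

lemma intl_compl (A : ∀ n, Set (X n)) : intl (fun n => (A n)ᶜ) = (intl A)ᶜ := by
  ext ω; exact Ultrafilter.eventually_not

lemma intl_union (A B : ∀ n, Set (X n)) : intl (fun n => A n ∪ B n) = intl A ∪ intl B := by
  ext ω; exact Ultrafilter.eventually_or

lemma intl_sdiff (A B : ∀ n, Set (X n)) : intl (fun n => A n \ B n) = intl A \ intl B := by
  simp only [sdiff_eq, intl_inter, intl_compl]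

@[simp] lemma intl_univ : intl (fun n => (univ : Set (X n))) = univ := by
  ext ω; simp [intl]

@[simp] lemma intl_empty : intl (fun n => (∅ : Set (X n))) = ∅ := by
  ext ω; simp [intl, (hyperfilter ℕ).neBot.ne]

lemma intl_iInter {κ : Type*} [Finite κ] (A : κ → ∀ n, Set (X n)) :
    intl (fun n => ⋂ k, A k n) = ⋂ k, intl (A k) := by
  ext ω; simp [mem_intl, eventually_all]

variable (X) in
/-- The algebra of all internal sets. -/
def internalSets : Set (Set (∀ n, X n)) := range intl

lemma isSetAlgebra_internalSets : IsSetAlgebra (internalSets X) where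
  empty_mem := ⟨_, intl_empty⟩
  compl_mem := by rintro _ ⟨A, rfl⟩; exact ⟨_, intl_compl A⟩
  union_mem := by rintro _ _ ⟨A, rfl⟩ ⟨B, rfl⟩; exact ⟨_, intl_union A B⟩

variable [∀ n, Nonempty (X n)]

lemma intl_eq_empty_iff {A : ∀ n, Set (X n)} :
    intl A = ∅ ↔ ∀ᶠ n in hyperfilter ℕ, A n = ∅ := by
  classical
  constructor
  · intro h
    by_contra hA
    rw [← Ultrafilter.eventually_not] at hA
    have : (fun n => if hn : (A n).Nonempty then hn.some
      else Classical.arbitrary (X n)) ∈ intl A := by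
      rw [mem_intl]
      filter_upwards [hA] with n hn
      have hn : (A n).Nonempty := nonempty_iff_ne_empty.2 hn
      rw [dif_pos hn]; exact hn.some_mem
    rw [h] at this
    exact this
  · intro h
    refine eq_empty_of_forall_notMem fun ω hω => ?_
    obtain ⟨n, h1, h2⟩ := (h.and hω).exists
    rw [h1] at h2; exact h2

lemma intl_subset_iff {A B : ∀ n, Set (X n)} :
    intl A ⊆ intl B ↔ ∀ᶠ n in hyperfilter ℕ, A n ⊆ B n := by
  rw [← sdiff_eq_empty, ← intl_sdiff, intl_eq_empty_iff]
  simp only [sdiff_eq_empty]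

lemma intl_eq_iff {A B : ∀ n, Set (X n)} :
    intl A = intl B ↔ ∀ᶠ n in hyperfilter ℕ, A n = B n := by
  simp only [Subset.antisymm_iff, intl_subset_iff, eventually_and]

/-- Countable saturation of the ultraproduct. -/
lemma exists_intl_eq_empty {A : ℕ → ∀ n, Set (X n)} (hA : Antitone fun k => intl (A k))
    (h : ⋂ k, intl (A k) = ∅) : ∃ k, intl (A k) = ∅ := by
  classical
  by_contra! hne
  let B : ℕ → ∀ n, Set (X n) := fun k n => ⋂ j ∈ Finset.range (k + 1), A j n
  have hB : ∀ k, ∀ᶠ n in hyperfilter ℕ, A k n ⊆ B k n := by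
    intro k
    have : ∀ j ∈ Finset.range (k + 1), ∀ᶠ n in hyperfilter ℕ, A k n ⊆ A j n := fun j hj =>
      intl_subset_iff.1 (hA (Nat.lt_succ_iff.1 (Finset.mem_range.1 hj)))
    filter_upwards [(eventually_all_finset _).2 this] with n hn
    exact subset_iInter₂ hn
  have hBne : ∀ k, ∀ᶠ n in hyperfilter ℕ, (B k n).Nonempty := by
    intro k
    have h1 : ¬ ∀ᶠ n in hyperfilter ℕ, A k n = ∅ := fun h =>
      (hne k).ne_empty (intl_eq_empty_iff.2 h)
    rw [← Ultrafilter.eventually_not] at h1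
    filter_upwards [h1, hB k] with n h2 h3
    exact (nonempty_iff_ne_empty.2 h2).mono h3
  have hanti : ∀ n, Antitone fun k => B k n := by
    intro n k l hkl x hx
    refine mem_iInter₂.2 fun j hj => mem_iInter₂.1 hx j ?_
    simp only [Finset.mem_range] at hj ⊢; omega
  let K : ℕ → ℕ := fun n => Nat.findGreatest (fun k => (B k n).Nonempty) n
  let ω : ∀ n, X n := fun n =>
    if hn : (B (K n) n).Nonempty then hn.some else Classical.arbitrary (X n)
  have hω : ω ∈ ⋂ k, intl (A k) := by
    refine mem_iInter.2 fun k => ?_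
    rw [mem_intl]
    filter_upwards [hBne k, Nat.hyperfilter_le_atTop (eventually_ge_atTop k)] with n hn hkn
    have hK : k ≤ K n := Nat.le_findGreatest hkn hn
    have hKn : (B (K n) n).Nonempty := Nat.findGreatest_spec (P := fun k => (B k n).Nonempty) hkn hn
    have : ω n ∈ B (K n) n := by
      simp only [ω, dif_pos hKn]; exact hKn.some_mem
    exact mem_iInter₂.1 (hanti n hK this) k (by simp)
  rw [h] at hω
  exact hω

end Internal

section Loeb
variable {X : ℕ → Type*} [∀ n, Fintype (X n)]

/-- The mass of `A n` with respect to the weight `m n`. -/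
noncomputable def massOn (m : ∀ n, X n → ℝ) (A : ∀ n, Set (X n)) (n : ℕ) : ℝ :=
  ∑ x, (A n).indicator (m n) x

lemma massOn_nonneg {m : ∀ n, X n → ℝ} (hm : ∀ n x, 0 ≤ m n x) (A : ∀ n, Set (X n)) (n : ℕ) :
    0 ≤ massOn m A n :=
  Finset.sum_nonneg fun x _ => indicator_nonneg (fun x _ => hm n x) x

lemma massOn_union {m : ∀ n, X n → ℝ} {A B : ∀ n, Set (X n)} {n : ℕ} (h : Disjoint (A n) (B n)) :
    massOn m (fun n => A n ∪ B n) n = massOn m A n + massOn m B n := by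
  simp only [massOn, ← Finset.sum_add_distrib]
  exact Finset.sum_congr rfl fun x _ => congrFun (indicator_union_of_disjoint h (m n)) x

lemma massOn_mono {m : ∀ n, X n → ℝ} (hm : ∀ n x, 0 ≤ m n x) {A B : ∀ n, Set (X n)} {n : ℕ}
    (h : A n ⊆ B n) : massOn m A n ≤ massOn m B n := by
  exact Finset.sum_le_sum fun x _ => indicator_le_indicator_of_subset h (hm n) x

/-- The limit of the masses of a sequence of sets along the ultrafilter. -/
noncomputable def massLim (m : ∀ n, X n → ℝ) (A : ∀ n, Set (X n)) : ℝ≥0∞ :=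
  ((hyperfilter ℕ).map fun n => ENNReal.ofReal (massOn m A n)).lim

lemma tendsto_massLim (m : ∀ n, X n → ℝ) (A : ∀ n, Set (X n)) :
    Tendsto (fun n => ENNReal.ofReal (massOn m A n)) (hyperfilter ℕ) (𝓝 (massLim m A)) :=
  Ultrafilter.le_nhds_lim _

lemma massLim_congr {m : ∀ n, X n → ℝ} {A B : ∀ n, Set (X n)}
    (h : ∀ᶠ n in hyperfilter ℕ, A n = B n) : massLim m A = massLim m B := by
  refine tendsto_nhds_unique (tendsto_massLim m A) ((tendsto_massLim m B).congr' ?_)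
  filter_upwards [h] with n hn
  simp [massOn, hn]

lemma massLim_empty (m : ∀ n, X n → ℝ) : massLim m (fun n => (∅ : Set (X n))) = 0 := by
  refine tendsto_nhds_unique (tendsto_massLim m _) ?_
  simp [massOn]

variable [∀ n, Nonempty (X n)]

open Classical in
/-- The limiting mass, as a function of internal sets. -/
noncomputable def loebFun (m : ∀ n, X n → ℝ) (S : Set (∀ n, X n)) : ℝ≥0∞ :=
  if h : S ∈ internalSets X then massLim m h.choose else 0

lemma loebFun_intl (m : ∀ n, X n → ℝ) (A : ∀ n, Set (X n)) :
    loebFun m (intl A) = massLim m A := by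
  have h : intl A ∈ internalSets X := ⟨A, rfl⟩
  rw [loebFun, dif_pos h]
  exact massLim_congr (intl_eq_iff.1 h.choose_spec)

/-- The additive content given by limiting masses. -/
noncomputable def loebContent (m : ∀ n, X n → ℝ) (hm : ∀ n x, 0 ≤ m n x) :
    AddContent ℝ≥0∞ (internalSets X) :=
  IsSetRing.addContent_of_union (loebFun m) isSetAlgebra_internalSets.isSetRing
    (by rw [← intl_empty, loebFun_intl, massLim_empty]) (by
      rintro _ _ ⟨A, rfl⟩ ⟨B, rfl⟩ h
      rw [← intl_union, loebFun_intl, loebFun_intl, loebFun_intl]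
      refine tendsto_nhds_unique (tendsto_massLim m _)
        (((tendsto_massLim m A).add (tendsto_massLim m B)).congr' ?_)
      rw [disjoint_iff_inter_eq_empty, ← intl_inter, intl_eq_empty_iff] at h
      filter_upwards [h] with n hn
      rw [massOn_union (disjoint_iff_inter_eq_empty.2 hn),
        ENNReal.ofReal_add (massOn_nonneg hm _ _) (massOn_nonneg hm _ _)])

lemma loebContent_intl (m : ∀ n, X n → ℝ) (hm : ∀ n x, 0 ≤ m n x) (A : ∀ n, Set (X n)) :
    loebContent m hm (intl A) = massLim m A := loebFun_intl m A

/-- The `σ`-algebra generated by the internal sets. -/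
@[reducible]
def loebSpace (X : ℕ → Type*) : MeasurableSpace (∀ n, X n) :=
  MeasurableSpace.generateFrom (internalSets X)

/-- Existence of the Loeb measure of a sequence of weights of total mass tending to one. -/
theorem exists_loebMeasure (m : ∀ n, X n → ℝ) (hm : ∀ n x, 0 ≤ m n x)
    (h1 : Tendsto (fun n => ∑ x, m n x) (hyperfilter ℕ) (𝓝 1)) :
    ∃ N : @Measure (∀ n, X n) (loebSpace X), IsProbabilityMeasure N ∧
      ∀ A : ∀ n, Set (X n), Tendsto (massOn m A) (hyperfilter ℕ) (𝓝 (N.real (intl A))) := by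
  let _ := loebSpace X
  have huniv : massLim m (fun n => (univ : Set (X n))) = 1 := by
    refine tendsto_nhds_unique (tendsto_massLim m _) ?_
    simpa [massOn] using (ENNReal.tendsto_ofReal h1)
  have hle : ∀ A : ∀ n, Set (X n), massLim m A ≤ 1 := by
    intro A
    rw [← huniv]
    refine le_of_tendsto_of_tendsto' (tendsto_massLim m A) (tendsto_massLim m _) fun n => ?_
    exact ENNReal.ofReal_le_ofReal (massOn_mono hm (subset_univ _))
  have hring := (isSetAlgebra_internalSets (X := X)).isSetRing
  have hsub : (loebContent m hm).IsSigmaSubadditive := by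
    refine isSigmaSubadditive_of_addContent_iUnion_eq_tsum hring fun f hf hU hd =>
      addContent_iUnion_eq_sum_of_tendsto_zero hring _ ?_ ?_ hf hU hd
    · rintro _ ⟨A, rfl⟩
      rw [loebContent_intl]
      exact ((hle A).trans_lt ENNReal.one_lt_top).ne
    · intro s hs hanti hemp
      choose A hA using hs
      obtain rfl : (fun k => intl (A k)) = s := funext hA
      obtain ⟨k, hk⟩ := exists_intl_eq_empty hanti hemp
      refine tendsto_const_nhds.congr' ?_
      filter_upwards [eventually_ge_atTop k] with l hl
      have : intl (A l) = ∅ := subset_empty_iff.1 (hk ▸ hanti hl)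
      rw [this, addContent_empty]
  let N : Measure (∀ n, X n) := (loebContent m hm).measure hring.isSetSemiring le_rfl hsub
  have hN : ∀ A : ∀ n, Set (X n), N (intl A) = massLim m A := fun A => by
    rw [← loebContent_intl m hm]
    exact AddContent.measure_eq _ hring.isSetSemiring rfl hsub ⟨A, rfl⟩
  refine ⟨N, ⟨by rw [← intl_univ, hN, huniv]⟩, fun A => ?_⟩
  have h2 := (ENNReal.tendsto_toReal ((hle A).trans_lt ENNReal.one_lt_top).ne).comp
    (tendsto_massLim m A)
  rw [measureReal_def, hN]
  refine h2.congr fun n => ?_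
  exact ENNReal.toReal_ofReal (massOn_nonneg hm A n)

end Loeb
end RelCorners

namespace RelCorners
open Function Finset

section Expectation
variable {κ α : Type*} [Fintype κ] [DecidableEq κ] [Fintype α]

/-- Weights of a product probability space. -/
structure IsWeight (w : κ → α → ℝ) : Prop where
  nonneg : ∀ k a, 0 ≤ w k a
  sum_eq_one : ∀ k, ∑ a, w k a = 1

/-- The expectation on the product of the probability spaces `(α, w k)`. -/
noncomputable def ev (w : κ → α → ℝ) (f : (κ → α) → ℝ) : ℝ := ∑ x, (∏ k, w k (x k)) * f x

/-- The average of `f` over the `k`-th coordinate. -/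
noncomputable def avg (w : κ → α → ℝ) (k : κ) (f : (κ → α) → ℝ) (x : κ → α) : ℝ :=
  ∑ a, w k a * f (update x k a)

omit [Fintype κ] [Fintype α] in
variable (κ α) in
/-- `f` does not depend on the coordinate `k`. -/
def Free {β : Type*} (k : κ) (f : (κ → α) → β) : Prop := ∀ x a, f (update x k a) = f x

variable {w : κ → α → ℝ} {f g : (κ → α) → ℝ} {k : κ}

lemma ev_add (f g : (κ → α) → ℝ) : ev w (fun x => f x + g x) = ev w f + ev w g := by
  simp [ev, mul_add, sum_add_distrib]

lemma ev_sub (f g : (κ → α) → ℝ) : ev w (fun x => f x - g x) = ev w f - ev w g := by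
  simp [ev, mul_sub]

lemma ev_const_mul (c : ℝ) (f : (κ → α) → ℝ) : ev w (fun x => c * f x) = c * ev w f := by
  simp only [ev, mul_sum]; exact sum_congr rfl fun x _ => by ring

lemma ev_mul_const (c : ℝ) (f : (κ → α) → ℝ) : ev w (fun x => f x * c) = ev w f * c := by
  simp only [mul_comm _ c, ev_const_mul]

lemma ev_sum {β : Type*} (s : Finset β) (f : β → (κ → α) → ℝ) :
    ev w (fun x => ∑ b ∈ s, f b x) = ∑ b ∈ s, ev w (f b) := by
  simp only [ev, mul_sum]; exact sum_comm

namespace IsWeight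
variable (hw : IsWeight w)
include hw

omit [DecidableEq κ] in
lemma prod_nonneg (x : κ → α) : 0 ≤ ∏ k, w k (x k) := Finset.prod_nonneg fun k _ => hw.nonneg k _

lemma ev_mono (h : ∀ x, f x ≤ g x) : ev w f ≤ ev w g :=
  sum_le_sum fun x _ => mul_le_mul_of_nonneg_left (h x) (hw.prod_nonneg x)

lemma ev_nonneg (h : ∀ x, 0 ≤ f x) : 0 ≤ ev w f :=
  sum_nonneg fun x _ => mul_nonneg (hw.prod_nonneg x) (h x)

lemma sum_prod_eq_one : ∑ x : κ → α, ∏ k, w k (x k) = 1 := by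
  rw [← Fintype.prod_sum]; simp [hw.sum_eq_one]

lemma ev_const (c : ℝ) : ev w (fun _ => c) = c := by
  simp only [ev, ← sum_mul, hw.sum_prod_eq_one, one_mul]

lemma abs_ev_le (f : (κ → α) → ℝ) : |ev w f| ≤ ev w (fun x => |f x|) := by
  refine (abs_sum_le_sum_abs _ _).trans (sum_le_sum fun x _ => ?_)
  rw [abs_mul, abs_of_nonneg (hw.prod_nonneg x)]

lemma abs_ev_le_of_le (h : ∀ x, |f x| ≤ g x) : |ev w f| ≤ ev w g :=
  (hw.abs_ev_le f).trans (hw.ev_mono h)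

/-- Weighted Cauchy-Schwarz. -/
lemma sq_ev_mul_le (hg : ∀ x, 0 ≤ g x) :
    (ev w fun x => g x * f x) ^ 2 ≤ ev w g * ev w fun x => g x * f x ^ 2 := by
  refine (sum_sq_le_sum_mul_sum_of_sq_le_mul univ (f := fun x => (∏ k, w k (x k)) * g x)
    (g := fun x => (∏ k, w k (x k)) * (g x * f x ^ 2))
      (r := fun x => (∏ k, w k (x k)) * (g x * f x))
    (fun x _ => mul_nonneg (hw.prod_nonneg x) (hg x))
    (fun x _ => mul_nonneg (hw.prod_nonneg x) (mul_nonneg (hg x) (sq_nonneg _)))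
    fun x _ => le_of_eq (by ring))

lemma ev_avg (k : κ) (f : (κ → α) → ℝ) : ev w (avg w k f) = ev w f := by
  have h1 : ev w f = ∑ p : (κ → α) × α, (∏ l, w l (p.1 l)) * w k p.2 * f p.1 := by
    rw [Fintype.sum_prod_type]
    refine sum_congr rfl fun x _ => ?_
    simp only [mul_right_comm _ (w k _), ← mul_sum, hw.sum_eq_one, mul_one]
  have h2 : ev w (avg w k f) =
      ∑ p : (κ → α) × α, (∏ l, w l (p.1 l)) * w k p.2 * f (update p.1 k p.2) := by
    rw [Fintype.sum_prod_type]
    refine sum_congr rfl fun x _ => ?_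
    simp only [avg, mul_sum, mul_assoc]
  rw [h1, h2]
  let e : (κ → α) × α → (κ → α) × α := fun p => (update p.1 k p.2, p.1 k)
  have he : Involutive e := fun p => by simp [e]
  refine Fintype.sum_equiv he.toPerm _ _ fun p => ?_
  have : (∏ l, w l (p.1 l)) * w k p.2 = (∏ l, w l (update p.1 k p.2 l)) * w k (p.1 k) := by
    rw [← mul_prod_erase univ _ (mem_univ k),
      ← mul_prod_erase univ (fun l => w l (update p.1 k p.2 l))
      (mem_univ k), update_self]
    have : ∏ l ∈ univ.erase k, w l (update p.1 k p.2 l) = ∏ l ∈ univ.erase k, w l (p.1 l) :=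
      prod_congr rfl fun l hl => by rw [update_of_ne (ne_of_mem_erase hl)]
    rw [this]; ring
  simp only [Involutive.coe_toPerm, e, this]

end IsWeight

omit [Fintype κ] in
lemma free_avg (f : (κ → α) → ℝ) : Free κ α k (avg w k f) := fun x a => by
  simp [avg]

omit [Fintype κ] in
lemma avg_mul_of_free (hf : Free κ α k f) (g : (κ → α) → ℝ) (x : κ → α) :
    avg w k (fun x => f x * g x) x = f x * avg w k g x := by
  simp only [avg, hf x, mul_sum]; exact sum_congr rfl fun a _ => by ring

omit [Fintype κ] [Fintype α] in
lemma Free.mul (hf : Free κ α k f) (hg : Free κ α k g) : Free κ α k (fun x => f x * g x) :=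
  fun x a => by simp only [hf x a, hg x a]

omit [Fintype κ] [Fintype α] in
lemma Free.prod {β : Type*} {s : Finset β} {f : β → (κ → α) → ℝ} (h : ∀ b ∈ s, Free κ α k (f b)) :
    Free κ α k (fun x => ∏ b ∈ s, f b x) :=
  fun x a => prod_congr rfl fun b hb => h b hb x a

omit [Fintype κ] [Fintype α] in
lemma Free.comp {β γ : Type*} {f : (κ → α) → β} (hf : Free κ α k f) (φ : β → γ) :
    Free κ α k (fun x => φ (f x)) :=
  fun x a => by simp only [hf x a]

lemma IsWeight.ev_mul_avg (hw : IsWeight w) (hf : Free κ α k f) (g : (κ → α) → ℝ) :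
    ev w (fun x => f x * avg w k g x) = ev w (fun x => f x * g x) := by
  rw [← hw.ev_avg k fun x => f x * g x]
  exact congrArg (ev w) (funext fun x => (avg_mul_of_free hf g x).symm)

/-- Averaging twice over one coordinate amounts to averaging over two independent copies of it. -/
lemma IsWeight.ev_mul_avg_sq (hw : IsWeight w) {k' : κ} (hk : k ≠ k') (hwk : w k = w k')
    (hf : Free κ α k f) (hf' : Free κ α k' f) (hg' : Free κ α k' g) :
    ev w (fun x => f x * avg w k g x ^ 2) =
      ev w (fun x => f x * (g x * g (update x k (x k')))) := by
  have h1 : ev w (fun x => f x * avg w k g x ^ 2) = ev w (fun x => f x * g x * avg w k g x) := by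
    have := hw.ev_mul_avg (hf.mul (free_avg (w := w) g)) g
    simp only [mul_assoc] at this
    simp only [sq, this, mul_assoc, mul_comm (g _)]
  rw [h1, ← hw.ev_avg k' fun x => f x * (g x * g (update x k (x k')))]
  congr 1
  ext x
  simp only [avg, mul_sum]
  refine sum_congr rfl fun a _ => ?_
  have : g (update (update x k' a) k (update x k' a k')) = g (update x k a) := by
    rw [update_self, update_comm hk.symm, hg']
  rw [this, hf' x a, hg' x a, hwk]; ring

/-- The Cauchy-Schwarz step: the factor `b` is replaced by its majorant and the coordinate `k` is
doubled. -/
lemma IsWeight.sq_ev_mul_le_doubling (hw : IsWeight w) {k' : κ} (hk : k ≠ k') (hwk : w k = w k')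
    {b : (κ → α) → ℝ} (hb : Free κ α k b) (hbf : ∀ x, |b x| ≤ f x)
    (hf : Free κ α k f) (hf' : Free κ α k' f) (hg' : Free κ α k' g) :
    (ev w fun x => b x * g x) ^ 2 ≤
      ev w f * ev w (fun x => f x * (g x * g (update x k (x k')))) := by
  rw [← hw.ev_mul_avg_sq hk hwk hf hf' hg', ← hw.ev_mul_avg hb]
  have h0 : ∀ x, 0 ≤ f x := fun x => (abs_nonneg _).trans (hbf x)
  have h1 : |ev w fun x => b x * avg w k g x| ≤ ev w fun x => f x * |avg w k g x| :=
    hw.abs_ev_le_of_le fun x => by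
      rw [abs_mul]; exact mul_le_mul_of_nonneg_right (hbf x) (abs_nonneg _)
  calc _ = |ev w fun x => b x * avg w k g x| ^ 2 := (sq_abs _).symm
    _ ≤ (ev w fun x => f x * |avg w k g x|) ^ 2 := pow_le_pow_left₀ (abs_nonneg _) h1 2
    _ ≤ _ := by
      refine (hw.sq_ev_mul_le h0).trans_eq ?_
      simp only [sq_abs]

/-- An average is dominated by its value at some choice of the coordinates in `D`. -/
lemma IsWeight.exists_abs_ev_le [Nonempty α] (hw : IsWeight w) (f : (κ → α) → ℝ) (D : Finset κ) :
    ∃ c : κ → α, |ev w f| ≤ |ev w fun x => f (D.piecewise c x)| := by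
  induction D using Finset.induction with
  | empty => exact ⟨fun _ => Classical.arbitrary α, by simp⟩
  | insert k D hk ih =>
    obtain ⟨c, hc⟩ := ih
    obtain ⟨a, -, ha⟩ := Finset.exists_max_image univ
      (fun a => |ev w fun x => f (D.piecewise c (update x k a))|)
        ⟨Classical.arbitrary α, mem_univ _⟩
    refine ⟨update c k a, hc.trans ?_⟩
    have e : ∀ x, (insert k D).piecewise (update c k a) x = D.piecewise c (update x k a) := by
      intro x; ext l
      by_cases hl : l = k
      · subst hl; simp [hk]
      · by_cases hD : l ∈ D <;> simp [hl, hD]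
    rw [funext fun x => congrArg f (e x),
      ← hw.ev_avg k fun x => f (D.piecewise c x)]
    unfold avg
    rw [ev_sum]
    refine (abs_sum_le_sum_abs _ _).trans ?_
    calc _ ≤ ∑ b, w k b * |ev w fun x => f (D.piecewise c (update x k a))| := by
          refine sum_le_sum fun b _ => ?_
          rw [ev_const_mul, abs_mul, abs_of_nonneg (hw.nonneg _ _)]
          exact mul_le_mul_of_nonneg_left (ha b (mem_univ b)) (hw.nonneg _ _)
      _ = _ := by rw [← sum_mul, hw.sum_eq_one, one_mul]

/-- A bounded factor not depending on the coordinates in `D` can be replaced by the indicator of a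
set not depending on these coordinates, at the cost of a factor two. -/
lemma IsWeight.exists_set_abs_ev_le (hw : IsWeight w) (D : Finset κ) (g : (κ → α) → ℝ)
    {h : (κ → α) → ℝ} (hh : ∀ x, |h x| ≤ 1) (hD : ∀ k ∈ D, Free κ α k h) :
    ∃ B : Set (κ → α), (∀ k ∈ D, Free κ α k (· ∈ B)) ∧
      |ev w fun x => g x * h x| ≤ 2 * |ev w fun x => g x * B.indicator 1 x| := by
  obtain ⟨G, hG, hGe⟩ : ∃ G : (κ → α) → ℝ, (∀ k ∈ D, Free κ α k G) ∧
      ∀ h : (κ → α) → ℝ, (∀ k ∈ D, Free κ α k h) →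
        ev w (fun x => g x * h x) = ev w fun x => G x * h x := by
    clear hD hh
    induction D using Finset.induction with
    | empty => exact ⟨g, by simp, fun _ _ => rfl⟩
    | insert k D hk ih =>
      obtain ⟨G, hG, hGe⟩ := ih
      refine ⟨avg w k G, fun l hl => ?_, fun h hh => ?_⟩
      · rcases eq_or_ne l k with rfl | hlk
        · exact free_avg G
        · intro x a
          have hl : l ∈ D := (mem_insert.1 hl).resolve_left hlk
          simp only [avg]
          refine sum_congr rfl fun b _ => ?_
          rw [update_comm hlk, hG l hl]
      · rw [hGe h fun l hl => hh l (mem_insert_of_mem hl)]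
        have := hw.ev_mul_avg (hh k (mem_insert_self _ _)) G
        simp only [mul_comm (avg w k G _), this, mul_comm (G _)]
  let B : Set (κ → α) := {x | 0 ≤ G x}
  have hB : ∀ k ∈ D, Free κ α k (· ∈ B) := fun k hk x a => by
    simp only [B, Set.mem_ofPred_eq, hG k hk x a]
  have hBi : ∀ (B : Set (κ → α)), (∀ k ∈ D, Free κ α k (· ∈ B)) →
      ∀ k ∈ D, Free κ α k (B.indicator (1 : (κ → α) → ℝ)) := fun B hB k hk x a => by
    classical
    have := hB k hk x a
    simp only [Set.indicator_apply, this, Pi.one_apply]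
  have hBc : ∀ k ∈ D, Free κ α k (· ∈ Bᶜ) := fun k hk x a => by
    simp only [Set.mem_compl_iff, hB k hk x a]
  have key : |ev w fun x => g x * h x| ≤ |ev w fun x => g x * B.indicator 1 x| +
      |ev w fun x => g x * Bᶜ.indicator 1 x| := by
    rw [hGe h hD, hGe _ (hBi B hB), hGe _ (hBi _ hBc)]
    have h1 : |ev w fun x => G x * h x| ≤ ev w fun x => |G x| := hw.abs_ev_le_of_le fun x => by
      rw [abs_mul]; exact mul_le_of_le_one_right (abs_nonneg _) (hh x)
    have h2 : (ev w fun x => |G x|) = (ev w fun x => G x * B.indicator 1 x) -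
        ev w fun x => G x * Bᶜ.indicator 1 x := by
      rw [← ev_sub]
      congr 1; ext x
      by_cases hx : 0 ≤ G x
      · have : x ∈ B := hx
        simp [this, abs_of_nonneg hx]
      · have : x ∉ B := hx
        simp [this, abs_of_neg (not_le.1 hx)]
    rw [h2] at h1
    exact h1.trans ((le_abs_self _).trans (abs_sub _ _))
  rcases le_total |ev w fun x => g x * Bᶜ.indicator 1 x| |ev w fun x => g x * B.indicator 1 x|
    with hle | hle
  · exact ⟨B, hB, by linarith⟩
  · exact ⟨Bᶜ, hBc, by linarith⟩

end Expectation
end RelCorners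

namespace RelCorners
open Function Finset Filter Topology

section Mix
variable {ι α : Type*} [DecidableEq ι]

/-- The point whose coordinates are taken from the second copy on `T` and from the first copy
elsewhere. -/
def mix (z : ι ⊕ ι → α) (T : Finset ι) (i : ι) : α := if i ∈ T then z (.inr i) else z (.inl i)

lemma mix_update_inl (z : ι ⊕ ι → α) {T : Finset ι} {j : ι} (hj : j ∉ T) (a : α) :
    mix (update z (.inl j) a) T = update (mix z T) j a := by
  ext i
  rcases eq_or_ne i j with rfl | hij
  · simp [mix, hj]
  · simp [mix, hij]

lemma mix_update_inr (z : ι ⊕ ι → α) {T : Finset ι} {j : ι} (hj : j ∉ T) (a : α) :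
    mix (update z (.inr j) a) T = mix z T := by
  ext i
  by_cases hi : i ∈ T
  · simp [mix, hi, ne_of_mem_of_not_mem hi hj]
  · simp [mix, hi]

lemma mix_insert (z : ι ⊕ ι → α) {T : Finset ι} {j : ι} :
    mix z (insert j T) = update (mix z T) j (z (.inr j)) := by
  ext i
  rcases eq_or_ne i j with rfl | hij
  · simp [mix]
  · simp [mix, hij]

lemma mix_double (z : ι ⊕ ι → α) {T : Finset ι} {j : ι} (hj : j ∉ T) :
    mix (update z (.inl j) (z (.inr j))) T = mix z (insert j T) := by
  rw [mix_update_inl z hj, mix_insert]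

lemma prod_powerset_insert_mix {S : Finset ι} {j : ι} (hj : j ∉ S) (F : (ι → α) → ℝ)
    (z : ι ⊕ ι → α) :
    ∏ T ∈ (insert j S).powerset, F (mix z T) = (∏ T ∈ S.powerset, F (mix z T)) *
      ∏ T ∈ S.powerset, F (mix (update z (.inl j) (z (.inr j))) T) := by
  rw [prod_powerset_insert hj]
  congr 1
  exact prod_congr rfl fun T hT => by rw [mix_double z fun h => hj (mem_powerset.1 hT h)]

variable [Fintype ι] [Fintype α] {w : ι → α → ℝ}

/-- The expectation over two independent copies of the coordinates. -/
noncomputable abbrev ev₂ (w : ι → α → ℝ) (f : (ι ⊕ ι → α) → ℝ) : ℝ := ev (Sum.elim w w) f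

omit [Fintype ι] [DecidableEq ι] in
lemma IsWeight.double (hw : IsWeight w) : IsWeight (Sum.elim w w) :=
  ⟨fun k a => by cases k <;> exact hw.nonneg _ _, fun k => by cases k <;> exact hw.sum_eq_one _⟩

lemma IsWeight.ev_mix (hw : IsWeight w) (f : (ι → α) → ℝ) :
    ev₂ w (fun z => f (mix z ∅)) = ev w f := by
  rw [ev₂, ev, ← (Equiv.sumArrowEquivProdArrow ι ι α).symm.sum_comp, Fintype.sum_prod_type]
  refine sum_congr rfl fun x _ => ?_
  have h : ∀ y, mix ((Equiv.sumArrowEquivProdArrow ι ι α).symm (x, y)) ∅ = x := fun y => by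
    ext i; simp [mix]
  simp only [h, Fintype.prod_sum_type, Sum.elim_inl, Sum.elim_inr,
    Equiv.sumArrowEquivProdArrow_symm_apply_inl, Equiv.sumArrowEquivProdArrow_symm_apply_inr]
  rw [← sum_mul, ← mul_sum, hw.sum_prod_eq_one, mul_one]

/-- Averages over one coordinate, squared, as averages over a doubled coordinate. -/
lemma IsWeight.ev_mul_avg_sq_eq (hw : IsWeight w) {i : ι} {f : (ι → α) → ℝ} (hf : Free ι α i f)
    (g : (ι → α) → ℝ) :
    ev w (fun x => f x * avg w i g x ^ 2) =
      ev₂ w (fun z => f (mix z ∅) * (g (mix z ∅) * g (mix z {i}))) := by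
  rw [← hw.ev_mix]
  have h := hw.double.ev_mul_avg_sq (k := .inl i) (k' := .inr i) (f := fun z => f (mix z ∅))
    (g := fun z => g (mix z ∅)) (by simp) rfl
    (fun z a => by simp only [mix_update_inl z (notMem_empty i) a]; rw [hf])
    (fun z a => by simp only [mix_update_inr z (notMem_empty i) a])
    (fun z a => by simp only [mix_update_inr z (notMem_empty i) a])
  simp only [mix_double _ (notMem_empty i), insert_empty_eq] at h
  refine Eq.trans ?_ h
  refine congrArg _ (funext fun z => ?_)
  simp only [avg, Sum.elim_inl, mix_update_inl z (notMem_empty i)]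

/-- The integrands in the iterated Cauchy-Schwarz inequality. -/
noncomputable def gowersIntegrand (i : ι) (h : (ι → α) → ℝ) (b β : ι → α → (ι → α) → ℝ)
    (S : Finset ι) (z : ι ⊕ ι → α) : ℝ :=
  (∏ T ∈ S.powerset, (h (mix z T) * ∏ j ∈ univ.erase i \ S, b j (z (.inr i)) (mix z T))) *
    ∏ j ∈ S, ∏ T ∈ (S.erase j).powerset, β j (z (.inr i)) (mix z T)

lemma IsWeight.sq_ev_gowersIntegrand_le (hw : IsWeight w) {i : ι} {h : (ι → α) → ℝ}
    {b β : ι → α → (ι → α) → ℝ} (hb : ∀ j ≠ i, ∀ y, Free ι α j (b j y))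
    (hβ : ∀ j ≠ i, ∀ y, Free ι α j (β j y)) (hbβ : ∀ j ≠ i, ∀ y x, |b j y x| ≤ β j y x)
    {S : Finset ι} {j : ι} (hji : j ≠ i) (hj : j ∉ S) :
    ev₂ w (gowersIntegrand i h b β S) ^ 2 ≤
      ev₂ w (fun z => ∏ T ∈ S.powerset, β j (z (.inr i)) (mix z T)) *
        ev₂ w (gowersIntegrand i h b β (insert j S)) := by
  have hjT : ∀ T ∈ S.powerset, j ∉ T := fun T hT h => hj (mem_powerset.1 hT h)
  have hiz : ∀ (z : ι ⊕ ι → α) a, update z (.inr j) a (.inr i) = z (.inr i) := fun z a => by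
    rw [update_of_ne]; simpa using hji.symm
  have hiz' : ∀ (z : ι ⊕ ι → α) a, update z (.inl j) a (.inr i) = z (.inr i) := fun z a => by
    rw [update_of_ne]; simp
  set g : (ι ⊕ ι → α) → ℝ := fun z =>
    (∏ T ∈ S.powerset, (h (mix z T) *
      ∏ l ∈ univ.erase i \ insert j S, b l (z (.inr i)) (mix z T))) *
    ∏ l ∈ S, ∏ T ∈ (S.erase l).powerset, β l (z (.inr i)) (mix z T) with hg
  have h1 := hw.double.sq_ev_mul_le_doubling (k := .inl j) (k' := .inr j)
    (b := fun z => ∏ T ∈ S.powerset, b j (z (.inr i)) (mix z T))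
    (f := fun z => ∏ T ∈ S.powerset, β j (z (.inr i)) (mix z T)) (g := g) (by simp) rfl
    (fun z a => prod_congr rfl fun T hT => by
      rw [mix_update_inl z (hjT T hT), hiz', hb j hji])
    (fun z => by
      rw [abs_prod]
      exact prod_le_prod (fun _ _ => abs_nonneg _) fun _ _ => hbβ j hji _ _)
    (fun z a => prod_congr rfl fun T hT => by
      rw [mix_update_inl z (hjT T hT), hiz', hβ j hji])
    (fun z a => prod_congr rfl fun T hT => by
      rw [mix_update_inr z (hjT T hT), hiz])
    (fun z a => by
      simp only [hg, hiz]
      congr 1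
      · exact prod_congr rfl fun T hT => by rw [mix_update_inr z (hjT T hT)]
      · refine prod_congr rfl fun l _ => prod_congr rfl fun T hT => ?_
        rw [mix_update_inr z (hjT T (powerset_mono.2 (erase_subset _ _) hT))])
  have hcomp : univ.erase i \ S = insert j (univ.erase i \ insert j S) := by
    ext l
    rcases eq_or_ne l j with rfl | hl
    · simp [hj, hji]
    · simp [hl]
  convert h1 using 3
  · ext z
    rw [gowersIntegrand, hcomp]
    simp only [prod_insert (show j ∉ univ.erase i \ insert j S by simp), hg, prod_mul_distrib]
    ring
  · ext z
    rw [gowersIntegrand, prod_insert hj, erase_insert hj]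
    have h2 : ∏ l ∈ S, ∏ T ∈ ((insert j S).erase l).powerset, β l (z (.inr i)) (mix z T) =
        ∏ l ∈ S, ((∏ T ∈ (S.erase l).powerset, β l (z (.inr i)) (mix z T)) *
          ∏ T ∈ (S.erase l).powerset,
            β l (z (.inr i)) (mix (update z (.inl j) (z (.inr j))) T)) := by
      refine prod_congr rfl fun l hl => ?_
      rw [erase_insert_of_ne (ne_of_mem_of_not_mem hl hj).symm]
      exact prod_powerset_insert_mix (fun h => hj (mem_of_mem_erase h)) (β l (z (.inr i))) z
    rw [h2, prod_powerset_insert_mix hj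
      (fun x => h x * ∏ l ∈ univ.erase i \ insert j S, b l (z (.inr i)) x) z]
    simp only [hg, hiz', prod_mul_distrib]
    ring

end Mix

section Sequences
variable {ι : Type*} [Fintype ι] [DecidableEq ι] {α : ℕ → Type*} [∀ n, Fintype (α n)]

/-- The linear forms condition for a sequence of weighted `ι`-partite hypergraphs. -/
structure IsPseudorandom (l : Filter ℕ) (w : ∀ n, ι → α n → ℝ) (ν : ∀ n, ι → (ι → α n) → ℝ) :
    Prop where
  weight : ∀ n, IsWeight (w n)
  nonneg : ∀ n i x, 0 ≤ ν n i x
  free : ∀ n i, Free ι (α n) i (ν n i)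
  tendsto : ∀ 𝒮 : Finset (ι × Finset ι), (∀ p ∈ 𝒮, p.1 ∉ p.2) →
    Tendsto (fun n => ev₂ (w n) fun z => ∏ p ∈ 𝒮, ν n p.1 (mix z p.2)) l (𝓝 1)

namespace IsPseudorandom
variable {l : Filter ℕ} {w : ∀ n, ι → α n → ℝ} {ν : ∀ n, ι → (ι → α n) → ℝ}
  (hν : IsPseudorandom l w ν)
include hν

lemma tendsto_prod_add (𝒮 : Finset (ι × Finset ι)) (h𝒮 : ∀ p ∈ 𝒮, p.1 ∉ p.2)
    (a : ι × Finset ι → ℝ) :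
    Tendsto (fun n => ev₂ (w n) fun z => ∏ p ∈ 𝒮, (ν n p.1 (mix z p.2) + a p)) l
      (𝓝 (∏ p ∈ 𝒮, (1 + a p))) := by
  simp only [prod_add, ev₂, ev_sum, prod_const_one, one_mul, ev_mul_const]
  refine tendsto_finsetSum _ fun t ht => ?_
  simpa using (hν.tendsto t fun p hp => h𝒮 p (mem_powerset.1 ht hp)).mul_const
    (∏ p ∈ 𝒮 \ t, a p)

/-- The generalised von Neumann inequality. -/
lemma tendsto_sub_one_mul_prod (i : ι) (b : ∀ n, ι → α n → (ι → α n) → ℝ)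
    (hb : ∀ n, ∀ j ≠ i, ∀ y, Free ι (α n) j (b n j y))
    (hbν : ∀ n, ∀ j ≠ i, ∀ y x, |b n j y x| ≤ (1 + ν n j x) * (1 + ν n j (update x i y))) :
    Tendsto (fun n => ev₂ (w n) fun z =>
      (ν n i (mix z ∅) - 1) * ∏ j ∈ univ.erase i, b n j (z (.inr i)) (mix z ∅)) l (𝓝 0) := by
  set β : ∀ n, ι → α n → (ι → α n) → ℝ := fun n j y x => (1 + ν n j x) * (1 + ν n j (update x i y))
    with hβdef
  have hβ : ∀ n, ∀ j ≠ i, ∀ y, Free ι (α n) j (β n j y) := fun n j hj y x a => by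
    simp only [hβdef, hν.free n j x a, update_comm hj, hν.free n j (update x i y) a]
  have hβprod : ∀ n (z : ι ⊕ ι → α n) (S : Finset ι) (j : ι), i ∉ S →
      ∏ T ∈ S.powerset, β n j (z (.inr i)) (mix z T) =
        ∏ T ∈ (insert i S).powerset, (ν n j (mix z T) + 1) := fun n z S j hS => by
    simp only [hβdef, ← mix_insert]
    rw [prod_powerset_insert hS, prod_mul_distrib]
    simp only [add_comm]
  suffices H : ∀ D : Finset ι, D ⊆ univ.erase i → Tendsto (fun n => ev₂ (w n)
      (gowersIntegrand i (fun x => ν n i x - 1) (b n) (β n) (univ.erase i \ D))) l (𝓝 0) by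
    have h := H _ subset_rfl
    unfold gowersIntegrand at h
    simpa using h
  intro D
  induction D using Finset.induction with
  | empty =>
    intro _
    have := hν.tendsto_prod_add (univ.filter fun p : ι × Finset ι => p.1 ∉ p.2)
      (fun p hp => (mem_filter.1 hp).2) (fun p => if p.1 = i then -1 else 1)
    rw [prod_eq_zero (i := (i, ∅)) (by simp) (by simp)] at this
    refine this.congr fun n => congrArg _ (funext fun z => ?_)
    have hprod : ∀ F : ι × Finset ι → ℝ,
      ∏ p ∈ univ.filter (fun p : ι × Finset ι => p.1 ∉ p.2), F p =
        ∏ j, ∏ T ∈ (univ.erase j).powerset, F (j, T) := fun F =>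
      prod_finset_product' _ _ _ (f := fun j T => F (j, T)) (fun p => by
        simp [subset_erase])
    rw [hprod, gowersIntegrand, ← mul_prod_erase univ _ (mem_univ i)]
    simp only [sdiff_empty, Finset.sdiff_self, prod_empty, mul_one, if_true, sub_eq_add_neg]
    congr 1
    refine prod_congr rfl fun j hj => ?_
    simp only [hβprod n z _ j (show i ∉ (univ.erase i).erase j by simp),
      ne_of_mem_erase hj, if_false]
    have : insert i ((univ.erase i).erase j) = univ.erase j := by
      ext a
      rcases eq_or_ne a i with rfl | h
      · simp [(ne_of_mem_erase hj).symm]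
      · simp [h]
    rw [this]
  | insert j D hj ih =>
    intro hD
    have hji : j ≠ i := ne_of_mem_erase (hD (mem_insert_self _ _))
    have h1 := ih ((subset_insert _ _).trans hD)
    set S := univ.erase i \ insert j D with hS
    have hjS : j ∉ S := by simp [hS]
    have hSi : i ∉ S := by simp [hS]
    have hSj : univ.erase i \ D = insert j S := by
      ext a
      rcases eq_or_ne a j with rfl | ha
      · simp [hS, hj, hji]
      · simp [hS, ha]
    rw [hSj] at h1
    have h2 := hν.tendsto_prod_add ((insert i S).powerset.map ⟨fun T => (j, T), fun a b h => by
      simpa using h⟩) (fun p hp => by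
        obtain ⟨T, hT, rfl⟩ := mem_map.1 hp
        exact fun h => (mem_insert.1 (mem_powerset.1 hT h)).elim hji hjS) (fun _ => 1)
    simp only [prod_map] at h2
    have h3 := h2.mul h1
    rw [mul_zero] at h3
    have h4 : Tendsto (fun n => ev₂ (w n)
      (gowersIntegrand i (fun x => ν n i x - 1) (b n) (β n) S) ^ 2) l (𝓝 0) := by
      refine squeeze_zero (fun n => sq_nonneg _) (fun n => ?_) h3
      refine ((hν.weight n).sq_ev_gowersIntegrand_le (hb n) (hβ n) (hbν n) hji hjS).trans_eq ?_
      simp only [hβprod n _ S j hSi]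
      rfl
    have h5 := h4.sqrt
    simp only [Real.sqrt_sq_eq_abs, Real.sqrt_zero] at h5
    exact (tendsto_zero_iff_abs_tendsto_zero _).2 h5

end IsPseudorandom
end Sequences
end RelCorners

namespace RelCorners
open Function Finset Filter Topology

section Averages
variable {ι α : Type*} [Fintype ι] [DecidableEq ι] [Fintype α] {w : ι → α → ℝ}

omit [Fintype ι] in
lemma IsWeight.abs_avg_le (hw : IsWeight w) {i : ι} {f g : (ι → α) → ℝ} (h : ∀ x, |f x| ≤ g x)
    (x : ι → α) : |avg w i f x| ≤ avg w i g x := by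
  refine (abs_sum_le_sum_abs _ _).trans (sum_le_sum fun a _ => ?_)
  rw [abs_mul, abs_of_nonneg (hw.nonneg i a)]
  exact mul_le_mul_of_nonneg_left (h _) (hw.nonneg i a)

omit [Fintype ι] [DecidableEq ι] in
lemma IsWeight.nonempty (hw : IsWeight w) (i : ι) : Nonempty α := by
  by_contra h
  rw [not_nonempty_iff] at h
  simpa using hw.sum_eq_one i

/-- Truncation to `[-1, 1]`. -/
noncomputable def clamp (t : ℝ) : ℝ := max (-1) (min t 1)

lemma abs_clamp_le (t : ℝ) : |clamp t| ≤ 1 :=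
  abs_le.2 ⟨le_max_left _ _, max_le (by norm_num) (min_le_right _ _)⟩

lemma abs_sub_clamp_le {t s : ℝ} (h : |t| ≤ s) : |t - clamp t| ≤ |s - 1| := by
  obtain ⟨h1, h2⟩ := abs_le.1 h
  unfold clamp
  rcases le_total t 1 with h3 | h3
  · rw [min_eq_left h3]
    rcases le_total (-1) t with h4 | h4
    · rw [max_eq_right h4]; simp
    · rw [max_eq_left h4, abs_of_nonpos (by linarith)]
      exact le_trans (by linarith) (le_abs_self _)
  · rw [min_eq_right h3, max_eq_right (by norm_num), abs_of_nonneg (by linarith)]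
    exact le_trans (by linarith) (le_abs_self _)

end Averages

section Sequences
variable {ι : Type*} [Fintype ι] [DecidableEq ι] {α : ℕ → Type*} [∀ n, Fintype (α n)]

namespace IsPseudorandom
variable {l : Filter ℕ} {w : ∀ n, ι → α n → ℝ} {ν : ∀ n, ι → (ι → α n) → ℝ}
  (hν : IsPseudorandom l w ν)
include hν

lemma tendsto_ev_prod (J : Finset ι) :
    Tendsto (fun n => ev (w n) fun x => ∏ j ∈ J, ν n j x) l (𝓝 1) := by
  refine (hν.tendsto (J ×ˢ {∅}) fun p hp => ?_).congr fun n => ?_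
  · simp [mem_singleton.1 (mem_product.1 hp).2]
  · rw [← (hν.weight n).ev_mix]
    simp only [prod_product, prod_singleton]

lemma tendsto_ev (i : ι) : Tendsto (fun n => ev (w n) (ν n i)) l (𝓝 1) := by
  simpa using hν.tendsto_ev_prod {i}

/-- The averages of products of weights over one coordinate are close to one in mean square. -/
lemma tendsto_sq_avg_sub_one {i : ι} {J : Finset ι} (hi : i ∉ J) :
    Tendsto (fun n => ev (w n) fun x =>
      (1 + ν n i x) * (avg (w n) i (fun x => ∏ j ∈ J, ν n j x) x - 1) ^ 2) l (𝓝 0) := by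
  have hfree : ∀ n, Free ι (α n) i (fun x => 1 + ν n i x) := fun n x a => by
    simp only [hν.free n i x a]
  have h1 : Tendsto (fun n => ev (w n) fun x => 1 + ν n i x) l (𝓝 (1 + 1)) := by
    simp only [ev_add, (hν.weight _).ev_const]
    exact (hν.tendsto_ev i).const_add 1
  have h2 : Tendsto (fun n => ev (w n) fun x => (1 + ν n i x) * ∏ j ∈ J, ν n j x) l
      (𝓝 (1 + 1)) := by
    have : ∀ n x, (1 + ν n i x) * ∏ j ∈ J, ν n j x =
        (∏ j ∈ J, ν n j x) + ∏ j ∈ insert i J, ν n j x := fun n x => by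
      rw [prod_insert hi]; ring
    simp only [this, ev_add]
    exact (hν.tendsto_ev_prod J).add (hν.tendsto_ev_prod _)
  have h3 : Tendsto (fun n => ev (w n) fun x =>
      (1 + ν n i x) * avg (w n) i (fun x => ∏ j ∈ J, ν n j x) x ^ 2) l (𝓝 (1 + 1)) := by
    have hne : (i, (∅ : Finset ι)) ∉ J ×ˢ ({∅, {i}} : Finset (Finset ι)) := fun h =>
      hi (mem_product.1 h).1
    have := hν.tendsto_prod_add (insert (i, ∅) (J ×ˢ {∅, {i}})) (fun p hp => by
      rcases mem_insert.1 hp with rfl | hp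
      · simp
      · obtain ⟨hp1, hp2⟩ := mem_product.1 hp
        rcases mem_insert.1 hp2 with h | h
        · simp [h]
        · rw [mem_singleton.1 h, mem_singleton]
          exact ne_of_mem_of_not_mem hp1 hi) (fun p => if p.1 = i then 1 else 0)
    have hz : ∀ p ∈ J ×ˢ ({∅, {i}} : Finset (Finset ι)), p.1 ≠ i := fun p hp =>
      ne_of_mem_of_not_mem (mem_product.1 hp).1 hi
    rw [prod_insert hne, prod_congr rfl fun p hp => by rw [if_neg (hz p hp), add_zero],
      prod_const_one, mul_one, if_pos rfl] at this
    refine this.congr fun n => ?_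
    rw [(hν.weight n).ev_mul_avg_sq_eq (hfree n)]
    refine congrArg _ (funext fun z => ?_)
    rw [prod_insert hne, prod_congr rfl fun p hp => by rw [if_neg (hz p hp), add_zero],
      prod_product, ← prod_mul_distrib]
    simp only [if_true, add_comm]
    congr 1
    exact prod_congr rfl fun j _ => prod_pair (singleton_ne_empty i).symm
  have h4 := (h3.sub (h2.const_mul 2)).add h1
  norm_num at h4
  refine h4.congr fun n => ?_
  rw [← (hν.weight n).ev_mul_avg (hfree n) (fun x => ∏ j ∈ J, ν n j x),
    ← ev_const_mul, ← ev_sub, ← ev_add]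
  exact congrArg _ (funext fun x => by ring)

/-- A bounded weighted function not depending on `x i` does not correlate with the fluctuations of
the other weights. -/
lemma tendsto_mul_prod_sub_one (i : ι) {g : ∀ n, (ι → α n) → ℝ} (hg : ∀ n, Free ι (α n) i (g n))
    (hg1 : ∀ n x, |g n x| ≤ 1) :
    Tendsto (fun n => ev (w n) fun x =>
      g n x * (∏ j, ν n j x) - g n x * ν n i x) l (𝓝 0) := by
  have h := (hν.tendsto_ev i).mul (hν.tendsto_sq_avg_sub_one (i := i) (notMem_erase i univ))
  rw [mul_zero] at h
  have h' := (squeeze_zero (f := fun n => (ev (w n) fun x =>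
      g n x * (∏ j, ν n j x) - g n x * ν n i x) ^ 2) (fun n => sq_nonneg _) (fun n => ?_) h).sqrt
  · simp only [Real.sqrt_sq_eq_abs, Real.sqrt_zero] at h'
    exact (tendsto_zero_iff_abs_tendsto_zero _).2 h'
  have hw := hν.weight n
  have e : (ev (w n) fun x => g n x * (∏ j, ν n j x) - g n x * ν n i x) = ev (w n) fun x =>
      ν n i x * (g n x * (avg (w n) i (fun x => ∏ j ∈ univ.erase i, ν n j x) x - 1)) := by
    have h1 := hw.ev_mul_avg ((hg n).mul (hν.free n i)) (fun x => ∏ j ∈ univ.erase i, ν n j x)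
    rw [ev_sub]
    have h2 : (ev (w n) fun x => g n x * ∏ j, ν n j x) =
        ev (w n) fun x => g n x * ν n i x * ∏ j ∈ univ.erase i, ν n j x :=
      congrArg _ (funext fun x => by
        rw [mul_assoc, mul_prod_erase univ (fun j => ν n j x) (mem_univ i)])
    rw [h2, ← h1, ← ev_sub]
    exact congrArg _ (funext fun x => by ring)
  rw [e]
  refine (hw.sq_ev_mul_le (hν.nonneg n i)).trans ?_
  refine mul_le_mul_of_nonneg_left (hw.ev_mono fun x => ?_) (hw.ev_nonneg (hν.nonneg n i))
  have h0 := hν.nonneg n i x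
  have h1 : g n x ^ 2 ≤ 1 := (sq_le_one_iff_abs_le_one _).2 (hg1 n x)
  rw [mul_pow]
  calc _ ≤ ν n i x * (1 * (avg (w n) i (fun x => ∏ j ∈ univ.erase i, ν n j x) x - 1) ^ 2) := by
        gcongr
    _ ≤ _ := by
      rw [one_mul]
      gcongr
      linarith

/-- The weights do not correlate with products of bounded functions of fewer coordinates. -/
lemma tendsto_prod_mul_sub {f : ∀ n, (ι → α n) → ℝ}
    (hf : ∀ i, ∃ h : ∀ n, ι → (ι → α n) → ℝ, (∀ n, ∀ j ≠ i, Free ι (α n) j (h n j)) ∧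
      (∀ n j x, |h n j x| ≤ 1) ∧ ∀ n x, f n x = ∏ j ∈ univ.erase i, h n j x) (J : Finset ι) :
    Tendsto (fun n => ev (w n) (fun x => f n x * ∏ j ∈ J, ν n j x) - ev (w n) (f n)) l (𝓝 0) := by
  induction J using Finset.induction with
  | empty => simpa using tendsto_const_nhds
  | insert i J hi ih =>
    obtain ⟨h, hfree, h1, hfh⟩ := hf i
    have key := hν.tendsto_sub_one_mul_prod i
      (fun n j _ x => h n j x * if j ∈ J then ν n j x else 1)
      (fun n j hj y x a => by simp only [hfree n j hj x a, hν.free n j x a])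
      (fun n j hj y x => by
        have h2 := hν.nonneg n j x
        have h3 := hν.nonneg n j (update x i y)
        rw [abs_mul]
        have h4 : |if j ∈ J then ν n j x else 1| ≤ 1 + ν n j x := by
          split_ifs
          · rw [abs_of_nonneg h2]; linarith
          · rw [abs_one]; linarith
        calc _ ≤ 1 * (1 + ν n j x) := mul_le_mul (h1 n j x) h4 (abs_nonneg _) zero_le_one
          _ ≤ _ := by rw [one_mul]; exact le_mul_of_one_le_right (by linarith) (by linarith))
    refine (key.add ih).congr' (Eventually.of_forall fun n => ?_) |>.trans (by simp)
    have e : (ev₂ (w n) fun z => (ν n i (mix z ∅) - 1) * ∏ j ∈ univ.erase i,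
        (h n j (mix z ∅) * if j ∈ J then ν n j (mix z ∅) else 1)) =
        ev (w n) fun x => f n x * (∏ j ∈ insert i J, ν n j x) - f n x * ∏ j ∈ J, ν n j x := by
      rw [← (hν.weight n).ev_mix]
      refine congrArg _ (funext fun z => ?_)
      rw [prod_mul_distrib, ← hfh, prod_ite_mem, prod_insert hi,
        inter_eq_right.2 fun j hj => mem_erase.2 ⟨ne_of_mem_of_not_mem hj hi, mem_univ j⟩]
      ring
    rw [e, ev_sub]; ring

/-- Densification: the weights `ν j`, `j ≠ i₀`, can be removed from a multilinear average. -/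
lemma densification (i₀ : ι) (J : Finset ι) (hJ : i₀ ∉ J) {ε : ℝ} (hε : 0 < ε) :
    ∃ η > 0, ∀ f : ∀ n, (ι → α n) → ℝ, (∀ n, Free ι (α n) i₀ (f n)) → (∀ n x, |f n x| ≤ 1) →
      (∀ h : ∀ n, ι → (ι → α n) → ℝ, (∀ n, ∀ j ≠ i₀, Free ι (α n) j (h n j)) →
        (∀ n, ∀ j ≠ i₀, Free ι (α n) i₀ (h n j)) → (∀ n j x, |h n j x| ≤ 1) →
        ∀ᶠ n in l, |ev (w n) fun x => f n x * ν n i₀ x * ∏ j ∈ univ.erase i₀, h n j x| ≤ η) →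
      ∀ a : ∀ n, ι → (ι → α n) → ℝ, (∀ n, ∀ j ≠ i₀, Free ι (α n) j (a n j)) →
        (∀ n j x, |a n j x| ≤ 1) →
        ∀ᶠ n in l, |ev (w n) fun x => f n x * ν n i₀ x *
          (∏ j ∈ univ.erase i₀, a n j x) * ∏ j ∈ J, ν n j x| ≤ ε := by
  induction J using Finset.induction generalizing ε with
  | empty =>
    refine ⟨ε, hε, fun f hf _ H a ha ha1 => ?_⟩
    have hc : ∀ n, ∃ c : ι → α n, |ev (w n) fun x => f n x * ν n i₀ x *
        (∏ j ∈ univ.erase i₀, a n j x)| ≤ |ev (w n) fun x => f n x * ν n i₀ x *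
          (∏ j ∈ univ.erase i₀, a n j (update x i₀ (c i₀)))| := fun n => by
      have := (hν.weight n).nonempty i₀
      obtain ⟨c, hc⟩ := (hν.weight n).exists_abs_ev_le (fun x => f n x * ν n i₀ x *
        (∏ j ∈ univ.erase i₀, a n j x)) {i₀}
      refine ⟨c, ?_⟩
      simpa only [piecewise_singleton, hf n _ _, hν.free n i₀ _ _] using hc
    choose c hc using hc
    filter_upwards [H (fun n j x => a n j (update x i₀ (c n i₀)))
      (fun n j hj x b => by simp only [update_comm hj, ha n j hj _ b])
      (fun n j hj x b => by simp only [update_idem]) (fun n j x => ha1 n j _)] with n hn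
    simpa using (hc n).trans hn
  | insert i J hi ih =>
    have hii : i ≠ i₀ := fun h => hJ (h ▸ mem_insert_self _ _)
    have hJ' : i₀ ∉ J := fun h => hJ (mem_insert_of_mem h)
    obtain ⟨η, hη, ih⟩ := ih hJ' (ε := ε ^ 2 / 8) (by positivity)
    refine ⟨η, hη, fun f hf hf1 H a ha ha1 => ?_⟩
    set φ : ∀ n, ι → (ι → α n) → ℝ := fun n j x =>
      if j = i₀ then f n x * ν n i₀ x else a n j x * if j ∈ J then ν n j x else 1 with hφ
    set g : ∀ n, (ι → α n) → ℝ := fun n x => ∏ j ∈ univ.erase i, φ n j x with hg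
    set G : ∀ n, (ι → α n) → ℝ := fun n => avg (w n) i (g n) with hG
    set K : ∀ n, (ι → α n) → ℝ := fun n =>
      avg (w n) i (fun x => ∏ j ∈ insert i₀ J, ν n j x) with hK
    have hφfree : ∀ n j, Free ι (α n) j (φ n j) := fun n j x b => by
      by_cases hj : j = i₀
      · subst hj; simp only [hφ, if_true, hf n x b, hν.free n j x b]
      · simp only [hφ, hj, if_false, ha n j hj x b, hν.free n j x b]
    have hφle : ∀ n j x, |φ n j x| ≤ if j ∈ insert i₀ J then ν n j x else 1 := fun n j x => by
      by_cases hj : j = i₀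
      · subst hj
        simp only [hφ, if_true, mem_insert, true_or, abs_mul, abs_of_nonneg (hν.nonneg n j x)]
        exact mul_le_of_le_one_left (hν.nonneg n j x) (hf1 n x)
      · simp only [hφ, mem_insert, hj, if_false, false_or, abs_mul]
        split_ifs
        · rw [abs_of_nonneg (hν.nonneg n j x)]
          exact mul_le_of_le_one_left (hν.nonneg n j x) (ha1 n j x)
        · simpa using ha1 n j x
    have hφle' : ∀ n j x, |φ n j x| ≤ 1 + ν n j x := fun n j x => by
      refine (hφle n j x).trans ?_
      have := hν.nonneg n j x
      split_ifs <;> linarith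
    have hsub : insert i₀ J ⊆ univ.erase i := by
      intro j hj
      rcases mem_insert.1 hj with rfl | hj
      · exact mem_erase.2 ⟨hii.symm, mem_univ _⟩
      · exact mem_erase.2 ⟨ne_of_mem_of_not_mem hj hi, mem_univ _⟩
    have hgle : ∀ n x, |g n x| ≤ ∏ j ∈ insert i₀ J, ν n j x := fun n x => by
      simp only [hg, abs_prod]
      refine (prod_le_prod (fun _ _ => abs_nonneg _) fun j _ => hφle n j x).trans_eq ?_
      rw [prod_ite_mem, inter_eq_right.2 hsub]
    have hGK : ∀ n x, |G n x| ≤ K n x := fun n x => (hν.weight n).abs_avg_le (hgle n) x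
    have hgprod : ∀ n x (c : ℝ), f n x * ν n i₀ x *
        (∏ j ∈ univ.erase i₀, update (fun j => a n j x) i c j) * ∏ j ∈ J, ν n j x = c * g n x := by
      intro n x c
      have hmem : i ∈ univ.erase i₀ := mem_erase.2 ⟨hii, mem_univ _⟩
      have hmem' : i₀ ∈ univ.erase i := mem_erase.2 ⟨hii.symm, mem_univ _⟩
      have hJ2 : J ⊆ (univ.erase i).erase i₀ := fun j hj => mem_erase.2
        ⟨ne_of_mem_of_not_mem hj hJ', hsub (mem_insert_of_mem hj)⟩
      have e1 : ∏ j ∈ (univ.erase i₀).erase i, update (fun j => a n j x) i c j =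
          ∏ j ∈ (univ.erase i₀).erase i, a n j x :=
        prod_congr rfl fun j hj => update_of_ne (ne_of_mem_erase hj) _ _
      have e2 : ∏ j ∈ (univ.erase i).erase i₀, φ n j x =
          (∏ j ∈ (univ.erase i).erase i₀, a n j x) * ∏ j ∈ J, ν n j x := by
        have : ∀ j ∈ (univ.erase i).erase i₀,
            φ n j x = a n j x * if j ∈ J then ν n j x else 1 := fun j hj => by
          simp only [hφ, ne_of_mem_erase hj, if_false]
        rw [prod_congr rfl this, prod_mul_distrib, prod_ite_mem, inter_eq_right.2 hJ2]
      rw [← mul_prod_erase _ _ hmem, e1, update_self]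
      simp only [hg]
      rw [← mul_prod_erase _ _ hmem', e2, erase_right_comm]
      simp only [hφ, if_true]
      ring
    have hgoal : ∀ n x, f n x * ν n i₀ x * (∏ j ∈ univ.erase i₀, a n j x) *
        ∏ j ∈ insert i J, ν n j x = ν n i x * a n i x * g n x := fun n x => by
      have := hgprod n x (a n i x)
      rw [update_eq_self] at this
      rw [prod_insert hi, mul_assoc (ν n i x), ← this]; ring
    -- the weight `ν i` can be replaced by `1` against `G ^ 2`
    have T1 : Tendsto (fun n => ev (w n) fun x => (ν n i x - 1) * G n x ^ 2) l (𝓝 0) := by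
      refine (hν.tendsto_sub_one_mul_prod i (fun n j y x => φ n j x * φ n j (update x i y))
        (fun n j hj y x b => by
          simp only [hφfree n j x b, update_comm hj, hφfree n j (update x i y) b])
        (fun n j hj y x => by
          rw [abs_mul]
          exact mul_le_mul (hφle' n j x) (hφle' n j _) (abs_nonneg _)
            (by have := hν.nonneg n j x; linarith))).congr fun n => ?_
      rw [(hν.weight n).ev_mul_avg_sq_eq (fun x b => by rw [hν.free n i x b])]
      refine congrArg _ (funext fun z => ?_)
      rw [prod_mul_distrib, ← insert_empty_eq, mix_insert]
    have T2 : Tendsto (fun n => ev (w n) fun x => (K n x - 1) ^ 2) l (𝓝 0) := by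
      refine squeeze_zero (fun n => (hν.weight n).ev_nonneg fun x => sq_nonneg _)
        (fun n => (hν.weight n).ev_mono fun x => ?_)
        (hν.tendsto_sq_avg_sub_one (i := i) (J := insert i₀ J) fun h => by
          simpa using hsub h)
      exact le_mul_of_one_le_left (sq_nonneg _) (by have := hν.nonneg n i x; linarith)
    have T3 := ih f hf hf1 H (fun n => update (a n) i fun x => clamp (G n x))
      (fun n j hj x b => by
        rcases eq_or_ne j i with rfl | hji
        · simp only [update_self]; rw [hG]; simp only [free_avg (g n) x b]
        · simp only [update_of_ne hji, ha n j hj x b])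
      (fun n j x => by
        rcases eq_or_ne j i with rfl | hji
        · simp only [update_self]; exact abs_clamp_le _
        · simp only [update_of_ne hji]; exact ha1 n j x)
    have hδ : 0 < ε ^ 2 / 16 := by positivity
    set δ := ε ^ 2 / 16 with hδdef
    have T2' := (T2.const_mul (1 + 1 / δ)).eventually_le_const (u := δ) (by simpa using hδ)
    filter_upwards [T1.eventually_le_const (u := δ) hδ, T2', T3,
      (hν.tendsto_ev i).eventually_le_const (u := 2) (by norm_num)] with n h1 h2 h3 h4
    have hw := hν.weight n
    simp only [hgoal]
    have e3 : (ev (w n) fun x => f n x * ν n i₀ x * (∏ j ∈ univ.erase i₀,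
        update (a n) i (fun x => clamp (G n x)) j x) * ∏ j ∈ J, ν n j x) =
        ev (w n) fun x => clamp (G n x) * G n x := by
      rw [hw.ev_mul_avg ((free_avg (g n)).comp clamp)]
      refine congrArg _ (funext fun x => ?_)
      rw [← hgprod]
      congr 3
      refine funext fun j => ?_
      rcases eq_or_ne j i with rfl | hji
      · simp only [update_self]
        rfl
      · simp only [update_of_ne hji]
    rw [e3] at h3
    have h5 : (ev (w n) fun x => G n x * (G n x - clamp (G n x))) ≤ δ + δ := by
      calc _ ≤ ev (w n) fun x => δ + (1 + 1 / δ) * (K n x - 1) ^ 2 := by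
            refine hw.ev_mono fun x => ?_
            have a1 := abs_sub_clamp_le (hGK n x)
            have a2 : G n x * (G n x - clamp (G n x)) ≤ K n x * |K n x - 1| := by
              refine (le_abs_self _).trans ?_
              rw [abs_mul]
              exact mul_le_mul (hGK n x) a1 (abs_nonneg _) ((abs_nonneg _).trans (hGK n x))
            have a3 : K n x * |K n x - 1| ≤ |K n x - 1| + |K n x - 1| ^ 2 := by
              have : K n x - 1 ≤ |K n x - 1| := le_abs_self _
              nlinarith [abs_nonneg (K n x - 1)]
            have a4 : |K n x - 1| ≤ δ + 1 / δ * |K n x - 1| ^ 2 := by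
              have : 0 ≤ 1 / δ * (|K n x - 1| - δ) ^ 2 := by positivity
              have e : 1 / δ * (|K n x - 1| - δ) ^ 2 =
                1 / δ * |K n x - 1| ^ 2 - 2 * |K n x - 1| + δ := by field_simp; ring
              nlinarith [abs_nonneg (K n x - 1)]
            rw [sq_abs] at a3 a4
            linarith
        _ = δ + (1 + 1 / δ) * ev (w n) fun x => (K n x - 1) ^ 2 := by
            rw [ev_add, hw.ev_const, ev_const_mul]
        _ ≤ _ := by gcongr
    have h6 : (ev (w n) fun x => ν n i x * G n x ^ 2) ≤ δ + (ε ^ 2 / 8 + (δ + δ)) := by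
      have : (ev (w n) fun x => ν n i x * G n x ^ 2) =
          (ev (w n) fun x => (ν n i x - 1) * G n x ^ 2) +
          ((ev (w n) fun x => clamp (G n x) * G n x) +
            ev (w n) fun x => G n x * (G n x - clamp (G n x))) := by
        rw [← ev_add, ← ev_add]
        exact congrArg _ (funext fun x => by ring)
      rw [this]
      exact add_le_add h1 (add_le_add ((le_abs_self _).trans h3) h5)
    have h7 : (ev (w n) fun x => ν n i x * a n i x * g n x) =
        ev (w n) fun x => ν n i x * (a n i x * G n x) := by
      rw [← hw.ev_mul_avg ((hν.free n i).mul (ha n i hii))]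
      exact congrArg _ (funext fun x => by ring)
    rw [h7]
    refine abs_le_of_sq_le_sq ?_ hε.le
    calc _ ≤ ev (w n) (ν n i) * ev (w n) fun x => ν n i x * (a n i x * G n x) ^ 2 :=
          hw.sq_ev_mul_le (hν.nonneg n i)
      _ ≤ 2 * (δ + (ε ^ 2 / 8 + (δ + δ))) := by
          refine mul_le_mul h4 ((hw.ev_mono fun x => ?_).trans h6) (hw.ev_nonneg fun x =>
            mul_nonneg (hν.nonneg n i x) (sq_nonneg _)) (by norm_num)
          refine mul_le_mul_of_nonneg_left ?_ (hν.nonneg n i x)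
          rw [mul_pow]
          exact mul_le_of_le_one_left (sq_nonneg _)
            ((sq_le_one_iff_abs_le_one _).2 (ha1 n i x))
      _ ≤ ε ^ 2 := by rw [hδdef]; linarith [sq_nonneg ε]

end IsPseudorandom
end Sequences
end RelCorners

namespace RelCorners
open MeasureTheory Set

section Criterion
variable {Ω : Type*} {m m₁ m0 : MeasurableSpace Ω} {N : Measure Ω} [IsProbabilityMeasure N]

lemma abs_sub_sum_indicator_le {K : ℕ} (hK : 0 < K) {p : ℝ} (h0 : 0 ≤ p) (h1 : p ≤ 1) :
    |p - (∑ l ∈ Finset.range K, if (l + 1 : ℝ) ≤ K * p then (1 : ℝ) else 0) / K| ≤ 1 / K := by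
  have hK' : (0 : ℝ) < K := by exact_mod_cast hK
  have hp : 0 ≤ K * p := by positivity
  have hfilter : (Finset.range K).filter (fun l : ℕ => (l + 1 : ℝ) ≤ K * p) =
      Finset.range ⌊K * p⌋₊ := by
    ext l
    have h2 : (l + 1 : ℝ) ≤ K * p ↔ l < ⌊K * p⌋₊ := by
      rw [← Nat.succ_le_iff, Nat.le_floor_iff hp]; push_cast; rfl
    have h3 : ⌊K * p⌋₊ ≤ K := Nat.floor_le_of_le (mul_le_of_le_one_right hK'.le h1)
    simp only [Finset.mem_filter, Finset.mem_range, h2]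
    omega
  rw [Finset.sum_ite, Finset.sum_const_zero, add_zero, hfilter, Finset.sum_const, nsmul_one,
    Finset.card_range]
  have h2 := Nat.floor_le hp
  have h3 := Nat.lt_floor_add_one (K * p)
  have e : p - (⌊K * p⌋₊ : ℝ) / K = (K * p - ⌊K * p⌋₊) / K := by field_simp
  rw [e, abs_of_nonneg (by apply div_nonneg <;> linarith)]
  gcongr
  linarith

/-- A measurable function with values in `[0, 1]` is approximated by averages of indicators of sets
from a generating algebra. -/
lemma exists_average_approx (hm : m ≤ m0) {R : Set (Set Ω)} (hR : IsSetAlgebra R)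
    (hgen : m = MeasurableSpace.generateFrom R) {p : Ω → ℝ} (hp : StronglyMeasurable[m] p)
    (hpi : Integrable p N) (h0 : 0 ≤ᵐ[N] p) (h1 : p ≤ᵐ[N] fun _ => 1) {ε : ℝ} (hε : 0 < ε) :
    ∃ K : ℕ, 0 < K ∧ ∃ P : ℕ → Set Ω, (∀ l, P l ∈ R) ∧ ∀ S, MeasurableSet S →
      |∫ x in S, p x ∂N - (∑ l ∈ Finset.range K, N.real (P l ∩ S)) / K| ≤ ε := by
  obtain ⟨K, hK⟩ := exists_nat_gt (2 / ε)
  have hK0 : (0 : ℝ) < K := lt_trans (by positivity) hK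
  have hK1 : 0 < K := by exact_mod_cast hK0
  have hlev : ∀ l : ℕ, MeasurableSet[m] {x | (l + 1 : ℝ) ≤ K * p x} := fun l =>
    measurableSet_le (measurable_const) (hp.measurable.const_mul _)
  have happ : ∀ l : ℕ, ∃ P ∈ R, N.real (symmDiff P {x | (l + 1 : ℝ) ≤ K * p x}) ≤ ε / 2 := by
    intro l
    obtain ⟨t, ht, htε⟩ := @exists_measure_symmDiff_lt_of_generateFrom_isSetRing Ω m (N.trim hm) _
      R hR.isSetRing ⟨{univ}, countable_singleton _, by simpa using hR.univ_mem, by simp⟩ hgen _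
      (hlev l) (ENNReal.ofReal (ε / 2)) (by simpa using hε)
    have htm : MeasurableSet[m] t := by
      rw [hgen]; exact MeasurableSpace.measurableSet_generateFrom ht
    refine ⟨t, ht, ?_⟩
    rw [trim_measurableSet_eq hm (htm.symmDiff (hlev l))] at htε
    exact ENNReal.toReal_le_of_le_ofReal (by positivity) htε.le
  choose P hPR hP using happ
  have hPm : ∀ l, MeasurableSet (P l) := fun l => hm _ (by
    rw [hgen]; exact MeasurableSpace.measurableSet_generateFrom (hPR l))
  refine ⟨K, hK1, P, hPR, fun S hS => ?_⟩
  set L : ℕ → Set Ω := fun l => {x | (l + 1 : ℝ) ≤ K * p x} with hL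
  have hLm : ∀ l, MeasurableSet (L l) := fun l => hm _ (hlev l)
  have e1 : ∫ x in S, (∑ l ∈ Finset.range K, (L l).indicator (fun _ => (1 : ℝ)) x) / K ∂N =
      (∑ l ∈ Finset.range K, N.real (L l ∩ S)) / K := by
    rw [integral_div, integral_finsetSum _ fun l _ =>
      (integrable_indicator_one (hLm l)).integrableOn]
    congr 1
    refine Finset.sum_congr rfl fun l _ => ?_
    rw [integral_indicator (hLm l)]
    simp [Measure.restrict_restrict (hLm l)]
  have hcp : Integrable (fun x =>
      (∑ l ∈ Finset.range K, (L l).indicator (fun _ => (1 : ℝ)) x) / K) N :=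
    (integrable_finsetSum _ fun l _ => integrable_indicator_one (hLm l)).div_const _
  have h2 : |∫ x in S, p x ∂N - (∑ l ∈ Finset.range K, N.real (L l ∩ S)) / K| ≤ 1 / K := by
    rw [← e1, ← integral_sub hpi.integrableOn hcp.integrableOn, ← Real.norm_eq_abs]
    refine (norm_integral_le_of_norm_le (integrable_const (1 / (K : ℝ))) ?_).trans ?_
    · filter_upwards [ae_restrict_of_ae h0, ae_restrict_of_ae h1] with x hx0 hx1
      have := abs_sub_sum_indicator_le hK1 hx0 hx1
      simpa only [Real.norm_eq_abs, indicator_apply, hL, mem_ofPred_eq] using this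
    · rw [integral_const, smul_eq_mul, measureReal_restrict_apply_univ]
      exact mul_le_of_le_one_left (by positivity) measureReal_le_one
  have h3 : |(∑ l ∈ Finset.range K, N.real (L l ∩ S)) / K -
      (∑ l ∈ Finset.range K, N.real (P l ∩ S)) / K| ≤ ε / 2 := by
    rw [← sub_div, ← Finset.sum_sub_distrib, abs_div, abs_of_pos hK0, div_le_iff₀ hK0]
    refine (Finset.abs_sum_le_sum_abs _ _).trans ?_
    calc _ ≤ ∑ l ∈ Finset.range K, ε / 2 := Finset.sum_le_sum fun l _ => ?_
      _ = _ := by rw [Finset.sum_const, Finset.card_range, nsmul_eq_mul]; ring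
    refine le_trans ?_ (hP l)
    have a1 : N.real (L l ∩ S) ≤ N.real (P l ∩ S) + N.real (symmDiff (P l) (L l)) := by
      refine (measureReal_mono ?_).trans (measureReal_union_le _ _)
      intro x ⟨hx, hxS⟩
      by_cases h : x ∈ P l
      · exact Or.inl ⟨h, hxS⟩
      · exact Or.inr (Or.inr ⟨hx, h⟩)
    have a2 : N.real (P l ∩ S) ≤ N.real (L l ∩ S) + N.real (symmDiff (P l) (L l)) := by
      refine (measureReal_mono ?_).trans (measureReal_union_le _ _)
      intro x ⟨hx, hxS⟩
      by_cases h : x ∈ L l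
      · exact Or.inl ⟨h, hxS⟩
      · exact Or.inr (Or.inl ⟨hx, h⟩)
    exact abs_le.2 ⟨by linarith, by linarith⟩
  have h4 : 1 / (K : ℝ) ≤ ε / 2 := by
    rw [div_le_iff₀ hK0]
    rw [div_lt_iff₀ hε] at hK
    linarith
  calc _ ≤ _ := abs_sub_le _ ((∑ l ∈ Finset.range K, N.real (L l ∩ S)) / K) _
    _ ≤ ε / 2 + ε / 2 := add_le_add (h2.trans h4) h3
    _ = ε := by ring

/-- Conditional probabilities are determined by their integrals over a generating `π`-system. -/
lemma condProb_eq_of_isPiSystem (hm : m ≤ m0) (h1 : m₁ ≤ m)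
    {A : Set Ω} (hA : MeasurableSet A) {C : Set (Set Ω)} (hC : IsPiSystem C)
    (hgen : m = MeasurableSpace.generateFrom C)
    (h : ∀ B ∈ C, N.real (A ∩ B) = ∫ x in B, condProb m₁ N A x ∂N) :
    condProb m N A =ᵐ[N] condProb m₁ N A := by
  have key : ∀ B, MeasurableSet[m] B → N.real (A ∩ B) = ∫ x in B, condProb m₁ N A x ∂N := by
    intro B hB
    induction B, hB using MeasurableSpace.induction_on_inter hgen hC with
    | empty => simp
    | basic t ht => exact h t ht
    | compl t ht ih =>
      have hu := setIntegral_condProb_self (N := N) (h1.trans hm) hA (B := univ) MeasurableSet.univ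
      rw [inter_univ, Measure.restrict_univ] at hu
      have h2 := integral_add_compl (hm _ ht) (integrable_condProb (m := m₁) (N := N) (E := A))
      have h3 := measureReal_inter_add_sdiff (μ := N) (s := A) (hm _ ht)
      rw [sdiff_eq] at h3
      linarith
    | iUnion f hd hf ih =>
      have h2 := hasSum_integral_iUnion (μ := N) (fun i => hm _ (hf i)) hd
        (integrable_condProb (m := m₁) (N := N) (E := A)).integrableOn
      have h3 : HasSum (fun i => N.real (A ∩ f i)) (N.real (A ∩ ⋃ i, f i)) := by
        rw [inter_iUnion]
        have hd' : Pairwise (Function.onFun Disjoint fun i => A ∩ f i) := fun i j hij =>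
          (hd hij).mono inter_subset_right inter_subset_right
        have h4 := measure_iUnion (μ := N) hd' fun i => hA.inter (hm _ (hf i))
        have h5 : ∑' i, N (A ∩ f i) ≠ ⊤ := h4 ▸ measure_ne_top _ _
        rw [measureReal_def, h4, ENNReal.tsum_toReal_eq fun _ => measure_ne_top _ _]
        exact ENNReal.hasSum_toReal h5
      simp only [ih] at h3
      exact h3.unique h2
  symm
  refine ae_eq_condExp_of_forall_setIntegral_eq hm (integrable_indicator_one hA)
    (fun s _ _ => integrable_condProb.integrableOn) (fun s hs _ => ?_)
    (stronglyMeasurable_condProb.mono h1).aestronglyMeasurable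
  rw [← key s hs, integral_indicator hA]
  simp [Measure.restrict_restrict hA]

end Criterion

section SetSystem
variable {Ω ι : Type*} {𝒜 : Finset ι → Set (Set Ω)}

variable (𝒜) in
/-- Intersections of one set from every family `𝒜 e`, `e ∈ 𝓕`. -/
def boxes (𝓕 : Set (Finset ι)) : Set (Set Ω) :=
  {B | ∃ C : Finset ι → Set Ω, (∀ e, C e ∈ 𝒜 e) ∧ B = ⋂ e ∈ 𝓕, C e}

lemma isPiSystem_boxes (h𝒜 : ∀ e, IsSetAlgebra (𝒜 e)) (𝓕 : Set (Finset ι)) :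
    IsPiSystem (boxes 𝒜 𝓕) := by
  rintro _ ⟨C, hC, rfl⟩ _ ⟨D, hD, rfl⟩ -
  refine ⟨fun e => C e ∩ D e, fun e => (h𝒜 e).inter_mem (hC e) (hD e), ?_⟩
  simp only [iInter_inter_distrib]

lemma sig_eq_generateFrom_boxes [Finite ι] (h𝒜 : ∀ e, IsSetAlgebra (𝒜 e)) (𝓕 : Set (Finset ι)) :
    sig 𝒜 𝓕 = MeasurableSpace.generateFrom (boxes 𝒜 𝓕) := by
  classical
  apply le_antisymm
  · refine MeasurableSpace.generateFrom_le fun t ht => ?_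
    simp only [mem_iUnion] at ht
    obtain ⟨e, he, ht⟩ := ht
    refine MeasurableSpace.measurableSet_generateFrom
      ⟨Function.update (fun _ => univ) e t, fun e' => ?_, ?_⟩
    · rcases eq_or_ne e' e with rfl | h
      · simpa using ht
      · simpa [h] using (h𝒜 e').univ_mem
    · ext x
      simp only [mem_iInter]
      refine ⟨fun hx e' _ => ?_, fun hx => by simpa using hx e he⟩
      rcases eq_or_ne e' e with rfl | h
      · simpa using hx
      · simp [h]
  · refine MeasurableSpace.generateFrom_le ?_
    rintro _ ⟨C, hC, rfl⟩
    exact MeasurableSet.biInter 𝓕.to_countable fun e he => measurableSet_sig he (hC e)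

variable {m0 : MeasurableSpace Ω} [Fintype ι] {N : Measure Ω} [IsProbabilityMeasure N]

/-- A criterion for relative independence that only involves finite averages of sets. -/
lemma relIndep_of_forall_average (h𝒜 : IsSetSystem 𝒜)
    (h : ∀ e : Finset ι, e ≠ Finset.univ → ∀ A ∈ 𝒜 e, ∀ ε > 0, ∃ δ > 0, ∀ K : ℕ, 0 < K →
      ∀ P : ℕ → Set Ω, (∀ l, P l ∈ 𝒜 e) →
      (∀ C, MeasurableSet[sig 𝒜 {e' | e' ⊂ e}] C →
        |N.real (A ∩ C) - (∑ l ∈ Finset.range K, N.real (P l ∩ C)) / K| ≤ δ) →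
      ∀ B ∈ boxes 𝒜 {e' | e' ≠ e ∧ e'.card ≤ e.card},
        |N.real (A ∩ B) - (∑ l ∈ Finset.range K, N.real (P l ∩ B)) / K| ≤ ε) :
    RelIndep N 𝒜 := by
  intro e he A hA
  have hAm := h𝒜.meas e A hA
  have hm1 : sig 𝒜 {e' | e' ⊂ e} ≤ m0 := h𝒜.sig_le
  have hm2 : sig 𝒜 {e' | e' ≠ e ∧ e'.card ≤ e.card} ≤ m0 := h𝒜.sig_le
  have h12 : sig 𝒜 {e' | e' ⊂ e} ≤ sig 𝒜 {e' | e' ≠ e ∧ e'.card ≤ e.card} :=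
    sig_mono fun e' (he' : e' ⊂ e) => ⟨he'.ne, Finset.card_le_card he'.subset⟩
  refine condProb_eq_of_isPiSystem hm2 h12 hAm (isPiSystem_boxes h𝒜.alg _)
    (sig_eq_generateFrom_boxes h𝒜.alg _) fun B hB => ?_
  have hBm : MeasurableSet B := hm2 _ (by
    rw [sig_eq_generateFrom_boxes h𝒜.alg]
    exact MeasurableSpace.measurableSet_generateFrom hB)
  set R : Set (Set Ω) := {S | S ∈ 𝒜 e ∧ MeasurableSet[sig 𝒜 {e' | e' ⊂ e}] S} with hRdef
  have hR : IsSetAlgebra R := by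
    refine ⟨⟨(h𝒜.alg e).empty_mem, MeasurableSpace.measurableSet_empty _⟩, ?_, ?_⟩
    · rintro s ⟨h1, h2⟩
      exact ⟨(h𝒜.alg e).compl_mem h1, h2.compl⟩
    · rintro s t ⟨h1, h2⟩ ⟨h3, h4⟩
      exact ⟨(h𝒜.alg e).union_mem h1 h3, h2.union h4⟩
  have hgen : sig 𝒜 {e' | e' ⊂ e} = MeasurableSpace.generateFrom R := by
    apply le_antisymm
    · refine MeasurableSpace.generateFrom_le fun t ht => ?_
      simp only [mem_iUnion] at ht
      obtain ⟨e', he', ht⟩ := ht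
      exact MeasurableSpace.measurableSet_generateFrom
        ⟨h𝒜.mono (show e' ⊂ e from he').subset ht, measurableSet_sig he' ht⟩
    · exact MeasurableSpace.generateFrom_le fun t ht => ht.2
  refine eq_of_forall_dist_le fun ε hε => ?_
  rw [Real.dist_eq]
  obtain ⟨δ, hδ, H⟩ := h e he A hA (ε / 2) (by positivity)
  obtain ⟨K, hK, P, hPR, hP⟩ := exists_average_approx (N := N) hm1 hR hgen
    (p := condProb (sig 𝒜 {e' | e' ⊂ e}) N A) stronglyMeasurable_condProb integrable_condProb
    (condProb_nonneg A) (condProb_le_one hm1 hAm) (lt_min (half_pos hε) hδ)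
  have h1 := H K hK P (fun l => (hPR l).1) (fun C hC => by
    rw [← setIntegral_condProb_self (N := N) hm1 hAm hC]
    exact (hP C (hm1 _ hC)).trans (min_le_right _ _)) B hB
  have h2 := (hP B hBm).trans (min_le_left _ _)
  rw [abs_sub_comm] at h2
  calc _ ≤ _ := abs_sub_le _ ((∑ l ∈ Finset.range K, N.real (P l ∩ B)) / K) _
    _ ≤ ε / 2 + ε / 2 := add_le_add h1 h2
    _ = ε := by ring

end SetSystem
end RelCorners

namespace RelCorners
open Function Finset Filter Topology MeasureTheory

section FiniteLevel
variable {ι α : Type*} [DecidableEq ι]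

lemma Free.piecewise_eq {β : Type*} {f : (ι → α) → β} {D : Finset ι}
    (h : ∀ k ∈ D, Free ι α k f) (c x : ι → α) : f (D.piecewise c x) = f x := by
  induction D using Finset.induction with
  | empty => simp
  | insert k D hk ih =>
    rw [piecewise_insert, h k (mem_insert_self _ _), ih fun l hl => h l (mem_insert_of_mem hl)]

lemma Free.comp_piecewise {β : Type*} {f : (ι → α) → β} {D : Finset ι} {k : ι} (c : ι → α)
    (h : k ∈ D ∨ Free ι α k f) : Free ι α k (fun x => f (D.piecewise c x)) := by
  intro x a
  by_cases hk : k ∈ D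
  · have e : D.piecewise c (update x k a) = D.piecewise c x := by
      ext j
      by_cases hjD : j ∈ D
      · simp [hjD]
      · simp [hjD, (ne_of_mem_of_not_mem hk hjD).symm]
    simp only [e]
  · have e : D.piecewise c (update x k a) = update (D.piecewise c x) k a := by
      ext j
      rcases eq_or_ne j k with rfl | hj
      · simp [hk]
      · by_cases hjD : j ∈ D <;> simp [hj, hjD]
    simp only [e]
    exact (h.resolve_left hk) _ _

lemma Free.indicator {B : Set (ι → α)} {k : ι} (h : Free ι α k (· ∈ B)) :
    Free ι α k (B.indicator (1 : (ι → α) → ℝ)) := by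
  classical
  intro x a
  have := h x a
  simp only [Set.indicator_apply, this, Pi.one_apply]

lemma prod_indicator_one {β X : Type*} (s : Finset β) (B : β → Set X) (x : X) :
    ∏ b ∈ s, (B b).indicator (1 : X → ℝ) x = (⋂ b ∈ s, B b).indicator 1 x := by
  classical
  simp only [Set.indicator_apply, prod_ite_zero, Set.mem_iInter, Pi.one_apply, prod_const_one]

lemma abs_indicator_one_le {X : Type*} (B : Set X) (x : X) :
    |B.indicator (1 : X → ℝ) x| ≤ 1 := by
  classical
  rw [Set.indicator_apply]; split_ifs <;> simp

lemma abs_prod_le_one {β : Type*} {s : Finset β} {f : β → ℝ} (h : ∀ b ∈ s, |f b| ≤ 1) :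
    |∏ b ∈ s, f b| ≤ 1 := by
  rw [abs_prod]; exact prod_le_one (fun _ _ => abs_nonneg _) h

variable [Fintype ι] [Fintype α] {w : ι → α → ℝ}

lemma IsWeight.exists_sets_abs_ev_le (hw : IsWeight w) (S : Finset ι) (D : ι → Finset ι)
    (g : (ι → α) → ℝ) {h : ι → (ι → α) → ℝ} (hh : ∀ j x, |h j x| ≤ 1)
    (hD : ∀ j ∈ S, ∀ k ∈ D j, Free ι α k (h j)) :
    ∃ C : ι → Set (ι → α), (∀ j, ∀ k ∈ D j, Free ι α k (· ∈ C j)) ∧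
      |ev w fun x => g x * ∏ j ∈ S, h j x| ≤
        2 ^ S.card * |ev w fun x => g x * ∏ j ∈ S, (C j).indicator 1 x| := by
  induction S using Finset.induction generalizing g with
  | empty => exact ⟨fun _ => Set.univ, fun _ _ _ _ _ => rfl, by simp⟩
  | insert j S hj ih =>
    obtain ⟨C, hC, h1⟩ := ih (fun x => g x * h j x) fun l hl => hD l (mem_insert_of_mem hl)
    obtain ⟨B, hB, h2⟩ := hw.exists_set_abs_ev_le (D j)
      (fun x => g x * ∏ j ∈ S, (C j).indicator 1 x) (hh j) (hD j (mem_insert_self _ _))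
    refine ⟨update C j B, fun l k hk => ?_, ?_⟩
    · rcases eq_or_ne l j with rfl | hl
      · simpa using hB k hk
      · simpa [hl] using hC l k hk
    · rw [card_insert_of_notMem hj, pow_succ, mul_assoc]
      have e1 : (ev w fun x => g x * ∏ j ∈ insert j S, h j x) =
          ev w fun x => g x * h j x * ∏ j ∈ S, h j x :=
        congrArg _ (funext fun x => by rw [prod_insert hj, mul_assoc])
      have e2 : (ev w fun x => g x * ∏ l ∈ insert j S, (update C j B l).indicator 1 x) =
          ev w fun x => g x * (∏ j ∈ S, (C j).indicator 1 x) * B.indicator 1 x :=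
        congrArg _ (funext fun x => by
          rw [prod_insert hj, update_self, prod_congr rfl fun l hl => by
            rw [update_of_ne (ne_of_mem_of_not_mem hl hj)]]
          ring)
      rw [e1, e2]
      refine h1.trans (mul_le_mul_of_nonneg_left (le_trans (le_of_eq ?_) h2) (by positivity))
      exact congrArg _ (congrArg _ (funext fun x => by ring))

end FiniteLevel

section Sequences
variable {ι : Type*} {α : ℕ → Type*}

variable (ι α) in
/-- The internal sets that depend only on the coordinates in `e`. -/
def cylinders [DecidableEq ι] (e : Finset ι) : Set (Set (∀ n, ι → α n)) :=
  {S | ∃ A : ∀ n, Set (ι → α n), S = intl A ∧ ∀ n, ∀ j ∉ e, Free ι (α n) j (· ∈ A n)}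

lemma isSetSystem_cylinders [DecidableEq ι] :
    @IsSetSystem _ ι (loebSpace fun n => ι → α n) (cylinders ι α) := by
  let _ := loebSpace fun n => ι → α n
  refine ⟨fun e => ⟨⟨fun _ => ∅, intl_empty.symm, fun _ _ _ _ _ => rfl⟩, ?_, ?_⟩, ?_, ?_⟩
  · rintro _ ⟨A, rfl, hA⟩
    exact ⟨_, (intl_compl A).symm, fun n j hj => (hA n j hj).comp Not⟩
  · rintro _ _ ⟨A, rfl, hA⟩ ⟨B, rfl, hB⟩
    refine ⟨_, (intl_union A B).symm, fun n j hj x a => ?_⟩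
    exact congrArg₂ Or (hA n j hj x a) (hB n j hj x a)
  · rintro e e' he _ ⟨A, rfl, hA⟩
    exact ⟨A, rfl, fun n j hj => hA n j fun h => hj (he h)⟩
  · rintro e _ ⟨A, rfl, -⟩
    exact MeasurableSpace.measurableSet_generateFrom ⟨A, rfl⟩

lemma intl_biInter {β : Type*} {X : ℕ → Type*} (s : Finset β) (B : β → ∀ n, Set (X n)) :
    intl (fun n => ⋂ b ∈ s, B b n) = ⋂ b ∈ s, intl (B b) := by
  ext ω
  simp only [Set.mem_iInter, mem_intl, eventually_all_finset]

/-- Difference of the indicator function of `A` and an average of indicator functions. -/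
noncomputable def avgDiff {X : Type*} (A : Set X) (K : ℕ) (P : ℕ → Set X) (x : X) : ℝ :=
  A.indicator 1 x - (∑ l ∈ range K, (P l).indicator 1 x) / K

lemma abs_avgDiff_le {X : Type*} (A : Set X) {K : ℕ} (hK : 0 < K) (P : ℕ → Set X) (x : X) :
    |avgDiff A K P x| ≤ 1 := by
  have hK' : (0 : ℝ) < K := by exact_mod_cast hK
  have h0 : ∀ B : Set X, 0 ≤ B.indicator (1 : X → ℝ) x := fun B =>
    Set.indicator_nonneg (fun _ _ => zero_le_one) x
  have h1 : ∀ B : Set X, B.indicator (1 : X → ℝ) x ≤ 1 := fun B =>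
    (le_abs_self _).trans (abs_indicator_one_le B x)
  have h2 : 0 ≤ (∑ l ∈ range K, (P l).indicator (1 : X → ℝ) x) / K :=
    div_nonneg (sum_nonneg fun l _ => h0 _) hK'.le
  have h3 : (∑ l ∈ range K, (P l).indicator (1 : X → ℝ) x) / K ≤ 1 := by
    rw [div_le_one hK']
    calc _ ≤ ∑ l ∈ range K, (1 : ℝ) := sum_le_sum fun l _ => h1 _
      _ = K := by simp
  have h4 := h0 A
  have h5 := h1 A
  rw [avgDiff]
  exact abs_le.2 ⟨by linarith, by linarith⟩

lemma free_avgDiff [DecidableEq ι] {β : Type*} {A : Set (ι → β)} {P : ℕ → Set (ι → β)} {j : ι}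
    (hA : Free ι β j (· ∈ A)) (hP : ∀ l, Free ι β j (· ∈ P l)) (K : ℕ) :
    Free ι β j (avgDiff A K P) := fun x a => by
  simp only [avgDiff, hA.indicator x a, (hP _).indicator x a]

variable [Fintype ι] [DecidableEq ι] [∀ n, Fintype (α n)] {l : Filter ℕ}
  {w : ∀ n, ι → α n → ℝ} {ν : ∀ n, ι → (ι → α n) → ℝ}

/-- For products of functions of at most `card ι - 2` variables the weights are negligible. -/
lemma IsPseudorandom.tendsto_prod_mul_sub_of_card (hν : IsPseudorandom l w ν)
    (E : Finset (Finset ι)) (hE : ∀ e ∈ E, e.card + 2 ≤ Fintype.card ι)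
    (φ : ∀ n, Finset ι → (ι → α n) → ℝ) (hφ : ∀ n e x, |φ n e x| ≤ 1)
    (hφf : ∀ n, ∀ e ∈ E, ∀ j ∉ e, Free ι (α n) j (φ n e)) :
    Tendsto (fun n => ev (w n) (fun x => (∏ e ∈ E, φ n e x) * ∏ j, ν n j x) -
      ev (w n) (fun x => ∏ e ∈ E, φ n e x)) l (𝓝 0) := by
  refine hν.tendsto_prod_mul_sub (f := fun n x => ∏ e ∈ E, φ n e x) (fun i => ?_) univ
  have hc : ∀ e : Finset ι, ∃ j, e ∈ E → j ∉ e ∧ j ≠ i := by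
    intro e
    by_cases he : e ∈ E
    · have : (insert i e).card < (univ : Finset ι).card := by
        have := hE e he
        have := card_insert_le i e
        rw [card_univ]; omega
      obtain ⟨j, -, hj⟩ := exists_mem_notMem_of_card_lt_card this
      rw [mem_insert, not_or] at hj
      exact ⟨j, fun _ => ⟨hj.2, hj.1⟩⟩
    · exact ⟨i, fun h => (he h).elim⟩
  choose c hc using hc
  refine ⟨fun n j x => ∏ e ∈ E with c e = j, φ n e x, fun n j _ => Free.prod fun e he => ?_,
    fun n j x => abs_prod_le_one fun e _ => hφ n e x, fun n x => ?_⟩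
  · have he' := mem_filter.1 he
    exact hφf n e he'.1 _ (he'.2 ▸ (hc e he'.1).1)
  · exact (prod_fiberwise_of_maps_to (fun e he => mem_erase.2 ⟨(hc e he).2, mem_univ _⟩) _).symm

variable {N : @Measure (∀ n, ι → α n) (loebSpace fun n => ι → α n)}

lemma tendsto_ev_avgDiff
    (hN : ∀ A : ∀ n, Set (ι → α n), Tendsto
      (massOn (fun n x => (∏ k, w n k (x k)) * ∏ j, ν n j x) A)
      (hyperfilter ℕ) (𝓝 (N.real (intl A))))
    (A C : ∀ n, Set (ι → α n)) (K : ℕ) (P : ℕ → ∀ n, Set (ι → α n)) :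
    Tendsto (fun n => ev (w n) fun x => avgDiff (A n) K (fun l => P l n) x *
        (C n).indicator 1 x * ∏ j, ν n j x) (hyperfilter ℕ)
      (𝓝 (N.real (intl A ∩ intl C) - (∑ l ∈ range K, N.real (intl (P l) ∩ intl C)) / K)) := by
  have h1 : ∀ A : ∀ n, Set (ι → α n), Tendsto (fun n => ev (w n) fun x =>
      (A n).indicator 1 x * (C n).indicator 1 x * ∏ j, ν n j x) (hyperfilter ℕ)
      (𝓝 (N.real (intl A ∩ intl C))) := by
    intro A
    have := hN fun n => A n ∩ C n
    rw [intl_inter] at this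
    refine this.congr fun n => ?_
    classical
    simp only [massOn, ev, Set.indicator_apply, Set.mem_inter_iff, Pi.one_apply]
    refine sum_congr rfl fun x _ => ?_
    by_cases h1 : x ∈ A n <;> by_cases h2 : x ∈ C n <;> simp [h1, h2]
  refine ((h1 A).sub ((tendsto_finsetSum (range K) fun l _ => h1 (P l)).div_const (K : ℝ))).congr
    fun n => ?_
  rw [← ev_sum, div_eq_mul_inv, ← ev_mul_const, ← ev_sub]
  refine congrArg _ (funext fun x => ?_)
  simp only [avgDiff, ← sum_mul]
  ring

/-- Relative independence for the Loeb measure, for families of small rank. -/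
lemma IsPseudorandom.abs_sub_average_le_of_card (hν : IsPseudorandom (hyperfilter ℕ) w ν)
    (hN : ∀ A : ∀ n, Set (ι → α n), Tendsto
      (massOn (fun n x => (∏ k, w n k (x k)) * ∏ j, ν n j x) A)
      (hyperfilter ℕ) (𝓝 (N.real (intl A))))
    {e : Finset ι} (he : e.card + 2 ≤ Fintype.card ι) {A : Set (∀ n, ι → α n)}
    (hA : A ∈ cylinders ι α e) {ε : ℝ} {K : ℕ} (hK : 0 < K) {P : ℕ → Set (∀ n, ι → α n)}
    (hP : ∀ l, P l ∈ cylinders ι α e)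
    (h : ∀ C, MeasurableSet[sig (cylinders ι α) {e' | e' ⊂ e}] C →
        |N.real (A ∩ C) - (∑ l ∈ range K, N.real (P l ∩ C)) / K| ≤ ε)
    {B : Set (∀ n, ι → α n)} (hB : B ∈ boxes (cylinders ι α) {e' | e' ≠ e ∧ e'.card ≤ e.card}) :
    |N.real (A ∩ B) - (∑ l ∈ range K, N.real (P l ∩ B)) / K| ≤ ε := by
  classical
  obtain ⟨A, rfl, hA⟩ := hA
  choose P' hP' hPf using hP
  obtain rfl : P = fun l => intl (P' l) := funext hP'
  obtain ⟨C, hC, rfl⟩ := hB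
  choose B hB hBf using hC
  obtain rfl : C = fun e => intl (B e) := funext hB
  have hι : Nonempty ι := Fintype.card_pos_iff.1 (by omega)
  set 𝓔 : Finset (Finset ι) := univ.filter fun e' => e' ≠ e ∧ e'.card ≤ e.card with h𝓔
  have hinter : ∀ B : Finset ι → ∀ n, Set (ι → α n),
      ⋂ e' ∈ {e' : Finset ι | e' ≠ e ∧ e'.card ≤ e.card}, intl (B e') =
        intl fun n => ⋂ e' ∈ 𝓔, B e' n := by
    intro B
    rw [intl_biInter]
    simp only [h𝓔, mem_filter, mem_univ, true_and, Set.mem_ofPred_eq]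
  set f : ∀ n, (ι → α n) → ℝ := fun n => avgDiff (A n) K fun l => P' l n with hf
  have hff : ∀ n, ∀ j ∉ e, Free ι (α n) j (f n) := fun n j hj =>
    free_avgDiff (hA n j hj) (fun l => hPf l n j hj) K
  have key : ∀ B : Finset ι → ∀ n, Set (ι → α n),
      (∀ e' n, ∀ j ∉ e', Free ι (α n) j (· ∈ B e' n)) →
      Tendsto (fun n => ev (w n) fun x => f n x * ∏ e' ∈ 𝓔, (B e' n).indicator 1 x) (hyperfilter ℕ)
        (𝓝 (N.real (intl A ∩ intl fun n => ⋂ e' ∈ 𝓔, B e' n) -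
          (∑ l ∈ range K, N.real (intl (P' l) ∩ intl fun n => ⋂ e' ∈ 𝓔, B e' n)) / K)) := by
    intro B hBf
    have hne : e ∉ 𝓔 := by simp [h𝓔]
    have h1 := tendsto_ev_avgDiff hN A (fun n => ⋂ e' ∈ 𝓔, B e' n) K P'
    have h2 := hν.tendsto_prod_mul_sub_of_card (insert e 𝓔)
      (fun e' he' => by
        rcases mem_insert.1 he' with rfl | he'
        · exact he
        · have := (mem_filter.1 he').2.2; omega)
      (fun n e' => if e' = e then f n else (B e' n).indicator 1)
      (fun n e' x => by
        split_ifs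
        · exact abs_avgDiff_le _ hK _ _
        · exact abs_indicator_one_le _ _)
      (fun n e' _ j hj => by
        split_ifs with h
        · exact hff n j (h ▸ hj)
        · exact (hBf e' n j hj).indicator)
    have h3 : ∀ n x, ∏ e' ∈ insert e 𝓔, (if e' = e then f n else (B e' n).indicator 1) x =
        f n x * ∏ e' ∈ 𝓔, (B e' n).indicator 1 x := fun n x => by
      rw [prod_insert hne, if_pos rfl]
      congr 1
      exact prod_congr rfl fun e' he' => by rw [if_neg (ne_of_mem_of_not_mem he' hne)]
    simp only [h3] at h2
    have h4 := h1.sub h2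
    rw [sub_zero] at h4
    refine h4.congr fun n => ?_
    simp only [prod_indicator_one]
    exact sub_sub_cancel _ _
  have hc : ∀ n, ∃ c : ι → α n, |ev (w n) fun x => f n x * ∏ e' ∈ 𝓔, (B e' n).indicator 1 x| ≤
      |ev (w n) fun x => f n x * ∏ e' ∈ 𝓔,
        {x | eᶜ.piecewise c x ∈ B e' n}.indicator 1 x| := fun n => by
    have := (hν.weight n).nonempty hι.some
    obtain ⟨c, hc⟩ := (hν.weight n).exists_abs_ev_le
      (fun x => f n x * ∏ e' ∈ 𝓔, (B e' n).indicator 1 x) eᶜ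
    refine ⟨c, hc.trans (le_of_eq ?_)⟩
    refine congrArg _ (congrArg _ (funext fun x => ?_))
    rw [Free.piecewise_eq fun k hk => hff n k (mem_compl.1 hk)]
    rfl
  choose c hc using hc
  have hcf : ∀ e' n j, j ∉ e' ∨ j ∉ e →
      Free ι (α n) j (· ∈ {x | eᶜ.piecewise (c n) x ∈ B e' n}) := fun e' n j hj =>
    Free.comp_piecewise (f := (· ∈ B e' n)) (c n) (hj.symm.imp mem_compl.2 (hBf e' n j))
  rw [hinter]
  refine le_trans ?_ (h (intl fun n => ⋂ e' ∈ 𝓔, {x | eᶜ.piecewise (c n) x ∈ B e' n}) ?_)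
  · exact le_of_tendsto_of_tendsto' (key B hBf).abs
      (key _ fun e' n j hj => hcf e' n j (.inl hj)).abs
      hc
  · rw [← hinter fun e' n => {x | eᶜ.piecewise (c n) x ∈ B e' n}]
    refine MeasurableSet.biInter (Set.to_countable _) fun e' he' => ?_
    refine measurableSet_sig (e := e' ∩ e) ?_
      ⟨_, rfl, fun n j hj => hcf e' n j (by rwa [mem_inter, not_and_or] at hj)⟩
    refine ssubset_of_subset_of_ne inter_subset_right fun h => he'.1 ?_
    exact (eq_of_subset_of_card_le (inter_eq_right.1 h) he'.2).symm

/-- Relative independence for the Loeb measure, for families of maximal rank. -/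
lemma IsPseudorandom.exists_abs_sub_average_le (hν : IsPseudorandom (hyperfilter ℕ) w ν)
    (hN : ∀ A : ∀ n, Set (ι → α n), Tendsto
      (massOn (fun n x => (∏ k, w n k (x k)) * ∏ j, ν n j x) A)
      (hyperfilter ℕ) (𝓝 (N.real (intl A))))
    (i₀ : ι) {ε : ℝ} (hε : 0 < ε) :
    ∃ δ > 0, ∀ A ∈ cylinders ι α (univ.erase i₀), ∀ K : ℕ, 0 < K →
      ∀ P : ℕ → Set (∀ n, ι → α n), (∀ l, P l ∈ cylinders ι α (univ.erase i₀)) →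
      (∀ C, MeasurableSet[sig (cylinders ι α) {e' | e' ⊂ univ.erase i₀}] C →
        |N.real (A ∩ C) - (∑ l ∈ range K, N.real (P l ∩ C)) / K| ≤ δ) →
      ∀ B ∈ boxes (cylinders ι α) {e' | e' ≠ univ.erase i₀ ∧ e'.card ≤ (univ.erase i₀).card},
        |N.real (A ∩ B) - (∑ l ∈ range K, N.real (P l ∩ B)) / K| ≤ ε := by
  classical
  obtain ⟨η, hη, H⟩ := hν.densification i₀ (univ.erase i₀) (notMem_erase _ _) hε
  set S := univ.erase i₀ with hS
  refine ⟨η / (2 * 2 ^ S.card), by positivity, fun A hA K hK P hP h B hB => ?_⟩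
  obtain ⟨A, rfl, hA⟩ := hA
  choose P' hP' hPf using hP
  obtain rfl : P = fun l => intl (P' l) := funext hP'
  obtain ⟨C, hC, rfl⟩ := hB
  choose B hB hBf using hC
  obtain rfl : C = fun e => intl (B e) := funext hB
  have hi₀ : i₀ ∉ S := notMem_erase _ _
  set f : ∀ n, (ι → α n) → ℝ := fun n => avgDiff (A n) K fun l => P' l n with hf
  have hff : ∀ n, Free ι (α n) i₀ (f n) := fun n =>
    free_avgDiff (hA n i₀ hi₀) (fun l => hPf l n i₀ hi₀) K
  have hf1 : ∀ n x, |f n x| ≤ 1 := fun n x => abs_avgDiff_le _ hK _ _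
  set 𝓔 : Finset (Finset ι) := univ.filter fun e' => e' ≠ S ∧ e'.card ≤ S.card with h𝓔
  have hinter : ⋂ e' ∈ {e' : Finset ι | e' ≠ S ∧ e'.card ≤ S.card}, intl (B e') =
        intl fun n => ⋂ e' ∈ 𝓔, B e' n := by
    rw [intl_biInter]
    simp only [h𝓔, mem_filter, mem_univ, true_and, Set.mem_ofPred_eq]
  have hc : ∀ e' : Finset ι, ∃ j, e' ∈ 𝓔 → j ∉ e' ∧ j ∈ S := by
    intro e'
    by_cases he' : e' ∈ 𝓔
    · have h1 := (mem_filter.1 he').2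
      have h2 : ¬ S ⊆ e' := fun hs => h1.1 (eq_of_subset_of_card_le hs h1.2).symm
      obtain ⟨j, hj, hj'⟩ := not_subset.1 h2
      exact ⟨j, fun _ => ⟨hj', hj⟩⟩
    · exact ⟨i₀, fun h => (he' h).elim⟩
  choose c hc using hc
  have hfin := H f hff hf1 (fun h' hfree hfree' hh1 => ?_)
    (fun n j x => ∏ e' ∈ 𝓔 with c e' = j, (B e' n).indicator 1 x)
    (fun n j _ => Free.prod fun e' he' => by
      have he := mem_filter.1 he'
      exact (hBf e' n j (he.2 ▸ (hc e' he.1).1)).indicator)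
    (fun n j x => abs_prod_le_one fun e' _ => abs_indicator_one_le _ _)
  · have h1 := tendsto_ev_avgDiff hN A (fun n => ⋂ e' ∈ 𝓔, B e' n) K P'
    rw [hinter]
    refine le_of_tendsto h1.abs ?_
    filter_upwards [hfin] with n hn
    refine le_trans (le_of_eq (congrArg _ (congrArg _ (funext fun x => ?_)))) hn
    rw [prod_fiberwise_of_maps_to (fun e he => (hc e he).2), prod_indicator_one,
      ← mul_prod_erase univ (fun j => ν n j x) (mem_univ i₀)]
    ring
  · have hC : ∀ n, ∃ C : ι → Set (ι → α n),
        (∀ j, ∀ k ∈ ({j, i₀} : Finset ι), Free ι (α n) k (· ∈ C j)) ∧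
        |ev (w n) fun x => f n x * ν n i₀ x * ∏ j ∈ S, h' n j x| ≤
          2 ^ S.card * |ev (w n) fun x => f n x * ν n i₀ x * ∏ j ∈ S, (C j).indicator 1 x| :=
      fun n => (hν.weight n).exists_sets_abs_ev_le S (fun j => {j, i₀})
        (fun x => f n x * ν n i₀ x) (hh1 n) fun j hj k hk => by
          have hj' : j ≠ i₀ := ne_of_mem_of_not_mem hj hi₀
          rcases mem_insert.1 hk with rfl | hk
          · exact hfree n _ hj'
          · rw [mem_singleton.1 hk]; exact hfree' n j hj'
    choose C hCf hC using hC
    have h1 := tendsto_ev_avgDiff hN A (fun n => ⋂ j ∈ S, C n j) K P'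
    have h2 := hν.tendsto_mul_prod_sub_one i₀
      (g := fun n x => f n x * ∏ j ∈ S, (C n j).indicator 1 x)
      (fun n => (hff n).mul (Free.prod fun j _ => (hCf n j i₀ (by simp)).indicator))
      (fun n x => by
        rw [abs_mul]
        exact mul_le_one₀ (hf1 n x) (abs_nonneg _)
          (abs_prod_le_one fun j _ => abs_indicator_one_le _ _))
    have h3 := (h1.sub h2).abs
    rw [sub_zero] at h3
    have hCi : (intl fun n => ⋂ j ∈ S, C n j) = ⋂ j ∈ S, intl fun n => C n j := intl_biInter _ _
    have h4 := h (intl fun n => ⋂ j ∈ S, C n j) (by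
      rw [hCi]
      refine Finset.measurableSet_biInter _ fun j hj => ?_
      refine measurableSet_sig (e := S.erase j) (erase_ssubset hj)
        ⟨_, rfl, fun n k hk => hCf n j k ?_⟩
      by_contra hk'
      rw [mem_insert, mem_singleton, not_or] at hk'
      exact hk (mem_erase.2 ⟨hk'.1, mem_erase.2 ⟨hk'.2, mem_univ _⟩⟩))
    have h5 := h3.eventually_lt_const (h4.trans_lt
      (show η / (2 * 2 ^ S.card) < η / 2 ^ S.card by
        rw [div_lt_div_iff_of_pos_left hη (by positivity) (by positivity)]
        linarith [show (0 : ℝ) < 2 ^ S.card by positivity]))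
    filter_upwards [h5] with n hn
    refine (hC n).trans ?_
    rw [lt_div_iff₀ (by positivity)] at hn
    rw [mul_comm]
    refine le_trans (le_of_eq ?_) hn.le
    rw [← ev_sub]
    refine congrArg (· * (2 : ℝ) ^ S.card) (congrArg _ (congrArg _ (funext fun x => ?_)))
    simp only [prod_indicator_one]
    ring

lemma IsPseudorandom.relIndep (hν : IsPseudorandom (hyperfilter ℕ) w ν)
    (hN1 : IsProbabilityMeasure N)
    (hN : ∀ A : ∀ n, Set (ι → α n), Tendsto
      (massOn (fun n x => (∏ k, w n k (x k)) * ∏ j, ν n j x) A)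
      (hyperfilter ℕ) (𝓝 (N.real (intl A)))) :
    @RelIndep _ ι (loebSpace fun n => ι → α n) _ N (cylinders ι α) := by
  refine relIndep_of_forall_average isSetSystem_cylinders fun e he A hA ε hε => ?_
  have hcard : e.card < Fintype.card ι := by
    rw [← card_univ]; exact card_lt_card (ssubset_univ_iff.2 he)
  by_cases h : e.card + 2 ≤ Fintype.card ι
  · exact ⟨ε, hε, fun K hK P hP hC B hB => hν.abs_sub_average_le_of_card hN h hA hK hP hC hB⟩
  · obtain ⟨i₀, -, hi₀⟩ := exists_mem_notMem_of_card_lt_card (card_univ (α := ι) ▸ hcard)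
    obtain rfl : e = univ.erase i₀ := by
      refine eq_of_subset_of_card_le (fun j hj => mem_erase.2
        ⟨ne_of_mem_of_not_mem hj hi₀, mem_univ _⟩) ?_
      rw [card_erase_of_mem (mem_univ _), card_univ]; omega
    obtain ⟨δ, hδ, H⟩ := hν.exists_abs_sub_average_le hN i₀ hε
    exact ⟨δ, hδ, fun K hK P hP hC B hB => H A hA K hK P hP hC B hB⟩

/-- The relative removal lemma. -/
theorem IsPseudorandom.exists_removal [Nonempty ι] (hν : IsPseudorandom (hyperfilter ℕ) w ν)
    {A : ι → ∀ n, Set (ι → α n)} (hA : ∀ i n, Free ι (α n) i (· ∈ A i n))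
    (h0 : Tendsto (fun n => ev (w n) fun x => (⋂ i, A i n).indicator 1 x * ∏ j, ν n j x)
      (hyperfilter ℕ) (𝓝 0)) {ε : ℝ} (hε : 0 < ε) :
    ∃ F : ι → ∀ n, Set (ι → α n), (∀ i n, Free ι (α n) i (· ∈ F i n)) ∧
      (∀ᶠ n in hyperfilter ℕ, ⋂ i, F i n = ∅) ∧
      ∀ᶠ n in hyperfilter ℕ, ∀ i,
        (ev (w n) fun x => (A i n \ F i n).indicator 1 x * ν n i x) ≤ ε := by
  have hne : ∀ n, Nonempty (α n) := fun n => (hν.weight n).nonempty (Classical.arbitrary ι)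
  obtain ⟨N, hN1, hN⟩ := exists_loebMeasure (X := fun n => ι → α n)
    (fun n x => (∏ k, w n k (x k)) * ∏ j, ν n j x)
    (fun n x => mul_nonneg ((hν.weight n).prod_nonneg x) (prod_nonneg fun j _ => hν.nonneg n j x))
    (hν.tendsto_ev_prod univ)
  have hmass : ∀ A : ∀ n, Set (ι → α n), Tendsto (fun n => ev (w n) fun x =>
      (A n).indicator 1 x * ∏ j, ν n j x) (hyperfilter ℕ) (𝓝 (N.real (intl A))) := by
    intro A
    refine (hN A).congr fun n => sum_congr rfl fun x _ => ?_
    classical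
    simp only [Set.indicator_apply, Pi.one_apply]
    split_ifs <;> simp
  have hmem : ∀ {A : ∀ n, Set (ι → α n)} {i : ι}, (∀ n, Free ι (α n) i (· ∈ A n)) →
      intl A ∈ cylinders ι α (univ.erase i) := fun {A i} h =>
    ⟨A, rfl, fun n j hj => by
      obtain rfl : j = i := by simpa using hj
      exact h n⟩
  obtain ⟨F, hF, hF0, hFε⟩ := (hν.relIndep hN1 hN).exists_removal isSetSystem_cylinders
    (A := fun i => intl (A i)) (fun i => hmem (hA i))
    (by rw [← intl_iInter]; exact tendsto_nhds_unique (hmass _) h0) (half_pos hε)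
  choose F' hF' hFf using hF
  obtain rfl : F = fun i => intl (F' i) := funext hF'
  have hFf' : ∀ i n, Free ι (α n) i (· ∈ F' i n) := fun i n => hFf i n i (notMem_erase _ _)
  refine ⟨F', hFf', ?_, eventually_all.2 fun i => ?_⟩
  · rwa [← intl_iInter, intl_eq_empty_iff] at hF0
  · have hd : ∀ n, Free ι (α n) i (· ∈ A i n \ F' i n) := fun n x a =>
      congrArg₂ (fun p q => p ∧ ¬ q) (hA i n x a) (hFf' i n x a)
    have h1 := hmass fun n => A i n \ F' i n
    have h2 := hν.tendsto_mul_prod_sub_one i (fun n => (hd n).indicator)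
      (fun n x => abs_indicator_one_le _ _)
    have h3 := h1.sub h2
    rw [sub_zero, intl_sdiff] at h3
    filter_upwards [h3.eventually_lt_const ((hFε i).trans_lt (half_lt_self hε))] with n hn
    rw [ev_sub, sub_sub_cancel] at hn
    exact hn.le

end Sequences
end RelCorners

namespace RelCorners
open Finset

lemma sum_le_sum_of_injOn {β γ : Type*} {s : Finset β} {t : Finset γ} {f : β → ℝ} {g : γ → ℝ}
    (e : β → γ) (he : ∀ i ∈ s, e i ∈ t) (hinj : Set.InjOn e s) (hg : ∀ j ∈ t, 0 ≤ g j)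
    (hfg : ∀ i ∈ s, f i ≤ g (e i)) : ∑ i ∈ s, f i ≤ ∑ j ∈ t, g j := by
  classical
  calc ∑ i ∈ s, f i ≤ ∑ i ∈ s, g (e i) := sum_le_sum hfg
    _ = ∑ j ∈ s.image e, g j := (sum_image hinj).symm
    _ ≤ _ := sum_le_sum_of_subset_of_nonneg (image_subset_iff.2 he) fun j hj _ => hg j hj

section Sieve

/-- A function of mean zero modulo the prime `r`. -/
noncomputable def localFactor (r : ℕ) (n : ℤ) : ℝ := if (r : ℤ) ∣ n then -1 else 1 / (r - 1)

lemma localFactor_sq {r : ℕ} (hr : 2 ≤ r) (n : ℤ) :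
    localFactor r n ^ 2 = -((r - 2) / (r - 1)) * localFactor r n + 1 / (r - 1 : ℝ) := by
  have h : (2 : ℝ) ≤ r := by exact_mod_cast hr
  have h1 : (r : ℝ) - 1 ≠ 0 := by linarith
  unfold localFactor
  split_ifs <;> field_simp <;> ring

lemma abs_localFactor_le {r : ℕ} (hr : 2 ≤ r) (n : ℤ) : |localFactor r n| ≤ 1 := by
  have h : (2 : ℝ) ≤ r := by exact_mod_cast hr
  unfold localFactor
  split_ifs
  · simp
  · rw [abs_of_nonneg (by apply div_nonneg <;> linarith), div_le_one (by linarith)]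
    linarith

variable (𝓟 : Finset ℕ) (R : ℕ)

/-- The sets of primes of `𝓟` whose product is at most `R`. -/
def sieveSupport : Finset (Finset ℕ) := 𝓟.powerset.filter fun s => ∏ r ∈ s, r ≤ R

/-- The value of the sieve sum at integers free of prime factors in `𝓟`. -/
noncomputable def sieveMass : ℝ := ∑ s ∈ sieveSupport 𝓟 R, ∏ r ∈ s, 1 / ((r : ℝ) - 1)

/-- The truncated divisor sum of the Selberg sieve. -/
noncomputable def sieveSum (n : ℤ) : ℝ := ∑ s ∈ sieveSupport 𝓟 R, ∏ r ∈ s, localFactor r n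

/-- The normalised Selberg sieve weight. -/
noncomputable def sieveWeight (n : ℤ) : ℝ := sieveSum 𝓟 R n ^ 2 / sieveMass 𝓟 R

variable {𝓟 R}

lemma mem_sieveSupport {s : Finset ℕ} :
    s ∈ sieveSupport 𝓟 R ↔ s ⊆ 𝓟 ∧ ∏ r ∈ s, r ≤ R := by
  simp [sieveSupport]

lemma prod_injOn_powerset (h𝓟 : ∀ r ∈ 𝓟, r.Prime) :
    Set.InjOn (fun s : Finset ℕ => ∏ r ∈ s, r) {s | s ⊆ 𝓟} := fun s hs t ht h => by
  rw [← Nat.primeFactors_prod fun p hp => h𝓟 p (hs hp),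
    ← Nat.primeFactors_prod fun p hp => h𝓟 p (ht hp)]
  exact congrArg _ h

lemma card_sieveSupport_le (h𝓟 : ∀ r ∈ 𝓟, r.Prime) : (sieveSupport 𝓟 R).card ≤ R := by
  have h : (sieveSupport 𝓟 R).card ≤ (Icc 1 R).card := by
    refine card_le_card_of_injOn (fun s => ∏ r ∈ s, r) (fun s hs => ?_)
      ((prod_injOn_powerset h𝓟).mono fun s hs => (mem_sieveSupport.1 hs).1)
    obtain ⟨h1, h2⟩ := mem_sieveSupport.1 hs
    exact mem_coe.2 (mem_Icc.2 ⟨Finset.prod_pos fun r hr => (h𝓟 r (h1 hr)).pos, h2⟩)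
  simpa using h

lemma sieveSupport_mono_left (h𝓟 : ∀ r ∈ 𝓟, r.Prime) {s t : Finset ℕ} (h : t ⊆ s)
    (hs : s ∈ sieveSupport 𝓟 R) : t ∈ sieveSupport 𝓟 R := by
  obtain ⟨h1, h2⟩ := mem_sieveSupport.1 hs
  exact mem_sieveSupport.2 ⟨h.trans h1,
    (prod_le_prod_of_subset_of_one_le' h fun r hr _ => (h𝓟 r (h1 hr)).one_le).trans h2⟩

lemma prod_inv_nonneg (h𝓟 : ∀ r ∈ 𝓟, r.Prime) {s : Finset ℕ} (hs : s ⊆ 𝓟) :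
    0 ≤ ∏ r ∈ s, 1 / ((r : ℝ) - 1) := prod_nonneg fun r hr => by
  have : (1 : ℝ) ≤ r := by exact_mod_cast (h𝓟 r (hs hr)).one_le
  apply div_nonneg <;> linarith

lemma one_le_sieveMass (h𝓟 : ∀ r ∈ 𝓟, r.Prime) (hR : 1 ≤ R) : 1 ≤ sieveMass 𝓟 R := by
  have h := single_le_sum (f := fun s : Finset ℕ => ∏ r ∈ s, 1 / ((r : ℝ) - 1))
    (s := sieveSupport 𝓟 R)
    (fun s hs => prod_inv_nonneg h𝓟 (mem_sieveSupport.1 hs).1)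
    (mem_sieveSupport.2 ⟨empty_subset _, by simpa using hR⟩)
  simpa [sieveMass] using h

lemma sieveWeight_nonneg (h𝓟 : ∀ r ∈ 𝓟, r.Prime) (hR : 1 ≤ R) (n : ℤ) : 0 ≤ sieveWeight 𝓟 R n :=
  div_nonneg (sq_nonneg _) (zero_le_one.trans (one_le_sieveMass h𝓟 hR))

lemma sieveWeight_le (h𝓟 : ∀ r ∈ 𝓟, r.Prime) (hR : 1 ≤ R) (n : ℤ) :
    sieveWeight 𝓟 R n ≤ R ^ 2 := by
  have h1 : |sieveSum 𝓟 R n| ≤ R := by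
    calc _ ≤ ∑ s ∈ sieveSupport 𝓟 R, |∏ r ∈ s, localFactor r n| := abs_sum_le_sum_abs _ _
      _ ≤ ∑ s ∈ sieveSupport 𝓟 R, 1 := sum_le_sum fun s hs => abs_prod_le_one fun r hr =>
          abs_localFactor_le (h𝓟 r ((mem_sieveSupport.1 hs).1 hr)).two_le n
      _ ≤ R := by simpa using card_sieveSupport_le h𝓟
  have h2 : sieveSum 𝓟 R n ^ 2 ≤ R ^ 2 := by
    rw [← sq_abs]; exact pow_le_pow_left₀ (abs_nonneg _) h1 2
  exact (div_le_self (sq_nonneg _) (one_le_sieveMass h𝓟 hR)).trans h2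

lemma sieveWeight_of_not_dvd {n : ℤ} (hn : ∀ r ∈ 𝓟, ¬ (r : ℤ) ∣ n) :
    sieveWeight 𝓟 R n = sieveMass 𝓟 R := by
  have h : sieveSum 𝓟 R n = sieveMass 𝓟 R := sum_congr rfl fun s hs =>
    prod_congr rfl fun r hr => if_neg (hn r ((mem_sieveSupport.1 hs).1 hr))
  rw [sieveWeight, h, sq, mul_self_div_self]

lemma prod_localFactor_mul (h𝓟 : ∀ r ∈ 𝓟, r.Prime) {s s' : Finset ℕ} (hs : s ⊆ 𝓟) (n : ℤ) :
    (∏ r ∈ s, localFactor r n) * ∏ r ∈ s', localFactor r n =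
      ∑ v ∈ (s ∩ s').powerset, ((∏ r ∈ v, -(((r : ℝ) - 2) / (r - 1))) *
        ∏ r ∈ (s ∩ s') \ v, 1 / ((r : ℝ) - 1)) *
          ∏ r ∈ (s ∪ s') \ ((s ∩ s') \ v), localFactor r n := by
  have h1 : (∏ r ∈ s, localFactor r n) * ∏ r ∈ s', localFactor r n =
      (∏ r ∈ s ∩ s', localFactor r n ^ 2) * ∏ r ∈ (s ∪ s') \ (s ∩ s'), localFactor r n := by
    rw [← prod_union_inter, ← prod_sdiff (inter_subset_union : s ∩ s' ⊆ s ∪ s'), mul_assoc,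
      ← sq, ← prod_pow, mul_comm]
  rw [h1, prod_congr rfl fun r hr =>
    localFactor_sq (h𝓟 r (hs (mem_of_mem_inter_left hr))).two_le n, prod_add, sum_mul]
  refine sum_congr rfl fun v hv => ?_
  rw [mem_powerset] at hv
  have h2 : (s ∪ s') \ ((s ∩ s') \ v) = v ∪ (s ∪ s') \ (s ∩ s') := by
    ext r
    have h3 : r ∈ v → r ∈ s ∧ r ∈ s' := fun h => mem_inter.1 (hv h)
    simp only [mem_sdiff, mem_union, mem_inter]
    tauto
  rw [h2, prod_union (disjoint_sdiff.mono_left hv), prod_mul_distrib]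
  ring

/-- The expansion of the sieve weight in products of functions of mean zero. -/
lemma exists_sieveWeight_expansion (h𝓟 : ∀ r ∈ 𝓟, r.Prime) (hR : 1 ≤ R) :
    ∃ Γ : Finset ℕ → ℝ, Γ ∅ = 1 ∧ (∀ u, |Γ u| ≤ 4 ^ u.card) ∧ ∀ n, sieveWeight 𝓟 R n =
      ∑ u ∈ sieveSupport 𝓟 (R ^ 2), Γ u * ∏ r ∈ u, localFactor r n := by
  have hG : 0 < sieveMass 𝓟 R := zero_lt_one.trans_le (one_le_sieveMass h𝓟 hR)
  obtain ⟨T, hT⟩ : ∃ T : Finset (Σ _ : Finset ℕ × Finset ℕ, Finset ℕ), T =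
    (sieveSupport 𝓟 R ×ˢ sieveSupport 𝓟 R).sigma fun q => (q.1 ∩ q.2).powerset := ⟨_, rfl⟩
  obtain ⟨t, ht⟩ : ∃ t : (Σ _ : Finset ℕ × Finset ℕ, Finset ℕ) → Finset ℕ,
    ∀ τ, t τ = (τ.1.1 ∩ τ.1.2) \ τ.2 := ⟨_, fun _ => rfl⟩
  obtain ⟨U, hU⟩ : ∃ U : (Σ _ : Finset ℕ × Finset ℕ, Finset ℕ) → Finset ℕ,
    ∀ τ, U τ = (τ.1.1 ∪ τ.1.2) \ t τ := ⟨_, fun _ => rfl⟩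
  obtain ⟨γ, hγ⟩ : ∃ γ : (Σ _ : Finset ℕ × Finset ℕ, Finset ℕ) → ℝ,
    ∀ τ, γ τ = (∏ r ∈ τ.2, -(((r : ℝ) - 2) / (r - 1))) * ∏ r ∈ t τ, 1 / ((r : ℝ) - 1) :=
      ⟨_, fun _ => rfl⟩
  have hTm : ∀ τ ∈ T, τ.1.1 ∈ sieveSupport 𝓟 R ∧ τ.1.2 ∈ sieveSupport 𝓟 R ∧
      τ.2 ⊆ τ.1.1 ∩ τ.1.2 := fun τ hτ => by
    rw [hT] at hτ
    simpa only [mem_sigma, mem_product, mem_powerset, and_assoc] using hτ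
  have htm : ∀ τ ∈ T, t τ ∈ sieveSupport 𝓟 R := fun τ hτ => by
    rw [ht]
    exact sieveSupport_mono_left h𝓟 (sdiff_subset.trans inter_subset_left) (hTm τ hτ).1
  have hfst : ∀ τ ∈ T, τ.1.1 = (τ.1.1 \ τ.1.2) ∪ (t τ ∪ τ.2) := fun τ hτ => by
    rw [ht, sdiff_union_of_subset (hTm τ hτ).2.2, sdiff_union_inter]
  have hsnd : ∀ τ, τ.1.2 = (U τ ∪ t τ) \ (τ.1.1 \ τ.1.2) := fun τ => by
    have h1 : t τ ⊆ τ.1.1 ∪ τ.1.2 := by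
      rw [ht]
      exact sdiff_subset.trans inter_subset_union
    have h2 : U τ ∪ t τ = τ.1.1 ∪ τ.1.2 := by
      rw [hU]
      exact sdiff_union_of_subset h1
    rw [h2]
    ext r
    simp only [mem_sdiff, mem_union]
    tauto
  have hUm : ∀ τ ∈ T, U τ ∈ sieveSupport 𝓟 (R ^ 2) := fun τ hτ => by
    obtain ⟨h1, h2, -⟩ := hTm τ hτ
    rw [hU]
    rw [mem_sieveSupport] at h1 h2
    refine sieveSupport_mono_left h𝓟 sdiff_subset (mem_sieveSupport.2
      ⟨union_subset h1.1 h2.1, ?_⟩)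
    have h3 : 0 < ∏ r ∈ τ.1.1 ∩ τ.1.2, r :=
      Finset.prod_pos fun r hr => (h𝓟 r (h1.1 (mem_of_mem_inter_left hr))).pos
    calc _ ≤ (∏ r ∈ τ.1.1 ∪ τ.1.2, r) * ∏ r ∈ τ.1.1 ∩ τ.1.2, r := Nat.le_mul_of_pos_right _ h3
      _ = (∏ r ∈ τ.1.1, r) * ∏ r ∈ τ.1.2, r := prod_union_inter
      _ ≤ R * R := Nat.mul_le_mul h1.2 h2.2
      _ = R ^ 2 := (sq R).symm
  refine ⟨fun u => (∑ τ ∈ T with U τ = u, γ τ) / sieveMass 𝓟 R, ?_, fun u => ?_, fun n => ?_⟩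
  · rw [div_eq_one_iff_eq hG.ne', sieveMass]
    have hmem : ∀ τ ∈ T.filter fun τ => U τ = ∅, τ.1.2 = τ.1.1 ∧ τ.2 = ∅ := by
      intro τ hτ
      rw [mem_filter, hU, ht] at hτ
      obtain ⟨h1, h2⟩ := hτ
      have h3 := (hTm τ h1).2.2
      rw [sdiff_eq_empty_iff_subset] at h2
      refine ⟨?_, ?_⟩
      · ext r
        have h4 := @h2 r
        simp only [mem_union, mem_sdiff, mem_inter] at h4
        tauto
      · refine eq_empty_of_forall_notMem fun r hr => ?_
        have h4 := @h2 r
        have h5 := @h3 r hr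
        simp only [mem_union, mem_sdiff, mem_inter] at h4 h5
        tauto
    refine sum_nbij' (fun τ => τ.1.1) (fun s => ⟨(s, s), ∅⟩)
      (fun τ hτ => (hTm τ (mem_filter.1 hτ).1).1) (fun s hs => ?_) (fun τ hτ => ?_)
      (fun s _ => rfl) (fun τ hτ => ?_)
    · simp [hT, hU, ht, hs]
    · obtain ⟨⟨s, s'⟩, v⟩ := τ
      obtain ⟨h1, h2⟩ := hmem _ hτ
      simp only at h1 h2
      subst h1 h2
      rfl
    · obtain ⟨h1, h2⟩ := hmem τ hτ
      simp [hγ, ht, h1, h2]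
  · rw [abs_div, abs_of_pos hG, div_le_iff₀ hG]
    have h1 : ∀ τ ∈ T, |γ τ| ≤ ∏ r ∈ t τ, 1 / ((r : ℝ) - 1) := fun τ hτ => by
      have hsub := (mem_sieveSupport.1 (hTm τ hτ).1).1
      have h0 := prod_inv_nonneg h𝓟 (mem_sieveSupport.1 (htm τ hτ)).1
      rw [hγ, abs_mul, abs_of_nonneg h0]
      refine mul_le_of_le_one_left h0 (abs_prod_le_one fun r hr => ?_)
      have h2 : (2 : ℝ) ≤ r := by
        exact_mod_cast (h𝓟 r (hsub (mem_of_mem_inter_left ((hTm τ hτ).2.2 hr)))).two_le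
      rw [abs_neg, abs_of_nonneg (by apply div_nonneg <;> linarith), div_le_one (by linarith)]
      linarith
    calc _ ≤ ∑ τ ∈ T with U τ = u, |γ τ| := abs_sum_le_sum_abs _ _
      _ ≤ ∑ q ∈ sieveSupport 𝓟 R ×ˢ u.powerset ×ˢ u.powerset, ∏ r ∈ q.1, 1 / ((r : ℝ) - 1) := by
        refine sum_le_sum_of_injOn (fun τ => (t τ, τ.1.1 \ τ.1.2, τ.2)) (fun τ hτ => ?_) ?_
          (fun q hq => ?_) fun τ hτ => h1 τ (mem_filter.1 hτ).1
        · obtain ⟨hτ, hu⟩ := mem_filter.1 hτ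
          rw [← hu]
          have h3 := (hTm τ hτ).2.2
          simp only [mem_product, mem_powerset]
          refine ⟨htm τ hτ, fun r hr => ?_, fun r hr => ?_⟩
          · simp only [hU, ht, mem_sdiff, mem_union, mem_inter] at hr ⊢
            tauto
          · have := h3 hr
            simp only [hU, ht, mem_sdiff, mem_union, mem_inter] at this ⊢
            tauto
        · intro τ₁ hτ₁ τ₂ hτ₂ h
          obtain ⟨hτ₁, hu₁⟩ := mem_filter.1 (mem_coe.1 hτ₁)
          obtain ⟨hτ₂, hu₂⟩ := mem_filter.1 (mem_coe.1 hτ₂)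
          simp only [Prod.mk.injEq] at h
          obtain ⟨ha, hb, hc⟩ := h
          have e1 : τ₁.1.1 = τ₂.1.1 := by
            rw [hfst τ₁ hτ₁, hfst τ₂ hτ₂, ha, hb, hc]
          have e2 : τ₁.1.2 = τ₂.1.2 := by
            rw [hsnd τ₁, hsnd τ₂, ha, hb, hu₁, hu₂]
          exact Sigma.ext (Prod.ext e1 e2) (heq_of_eq hc)
        · exact prod_inv_nonneg h𝓟 (mem_sieveSupport.1 (mem_product.1 hq).1).1
      _ = 4 ^ u.card * sieveMass 𝓟 R := by
        rw [sum_product, sieveMass, mul_sum]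
        refine sum_congr rfl fun s _ => ?_
        dsimp only
        rw [sum_const, card_product, card_powerset, nsmul_eq_mul, ← mul_pow]
        norm_num
  · have h1 : sieveSum 𝓟 R n ^ 2 = ∑ τ ∈ T, γ τ * ∏ r ∈ U τ, localFactor r n := by
      rw [hT, sum_sigma, sq, sieveSum, sum_mul_sum, ← sum_product']
      refine sum_congr rfl fun q hq => ?_
      simp only [hγ, hU, ht]
      exact prod_localFactor_mul h𝓟 (mem_sieveSupport.1 (mem_product.1 hq).1).1 n
    rw [sieveWeight, h1, ← sum_fiberwise_of_maps_to hUm, sum_div]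
    refine sum_congr rfl fun u _ => ?_
    rw [div_mul_eq_mul_div, sum_mul]
    congr 1
    exact sum_congr rfl fun τ hτ => by rw [(mem_filter.1 hτ).2]

end Sieve
end RelCorners

namespace RelCorners
open Finset Function

section Comparison
variable {κ α β : Type*} [Fintype κ] [DecidableEq κ] [Fintype α] [Fintype β]

lemma abs_ev_update_sub_le {w : κ → α → ℝ} (hw : IsWeight w) (k : κ) (v : α → ℝ)
    {f : (κ → α) → ℝ} (hf : ∀ x, |f x| ≤ 1) :
    |ev (update w k v) f - ev w f| ≤ ∑ a, |w k a - v a| := by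
  have key : ∀ (g : κ → α → ℝ) (h : α → ℝ) (x : κ → α),
      ∏ l, update g k h l (x l) = h (x k) * ∏ l ∈ univ.erase k, g l (x l) := fun g h x => by
    rw [← mul_prod_erase univ _ (mem_univ k), update_self]
    exact congrArg _ (prod_congr rfl fun l hl => by rw [update_of_ne (ne_of_mem_erase hl)])
  have h1 : ∀ x : κ → α, ∏ l, w l (x l) = w k (x k) * ∏ l ∈ univ.erase k, w l (x l) :=
    fun x => (mul_prod_erase univ _ (mem_univ k)).symm
  calc |ev (update w k v) f - ev w f|
      = |∑ x : κ → α, ((v (x k) - w k (x k)) * ∏ l ∈ univ.erase k, w l (x l)) * f x| := by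
        rw [ev, ev, ← sum_sub_distrib]
        exact congrArg _ (sum_congr rfl fun x _ => by rw [key, h1]; ring)
    _ ≤ ∑ x : κ → α, ∏ l, update w k (fun a => |w k a - v a|) l (x l) := by
        refine (abs_sum_le_sum_abs _ _).trans (sum_le_sum fun x _ => ?_)
        have h0 : 0 ≤ ∏ l ∈ univ.erase k, w l (x l) :=
          Finset.prod_nonneg fun l _ => hw.nonneg l _
        rw [key, abs_mul, abs_mul, abs_of_nonneg h0, abs_sub_comm]
        exact mul_le_of_le_one_right (by positivity) (hf x)
    _ = ∑ a, |w k a - v a| := by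
        rw [← Fintype.prod_sum, ← mul_prod_erase univ _ (mem_univ k), update_self]
        rw [prod_eq_one, mul_one]
        intro l hl
        rw [update_of_ne (ne_of_mem_erase hl), hw.sum_eq_one]

lemma abs_ev_sub_ev_le {w w' : κ → α → ℝ} (hw : IsWeight w) (hw' : IsWeight w')
    {f : (κ → α) → ℝ} (hf : ∀ x, |f x| ≤ 1) :
    |ev w' f - ev w f| ≤ ∑ k, ∑ a, |w k a - w' k a| := by
  suffices h : ∀ T : Finset κ, |ev (T.piecewise w' w) f - ev w f| ≤
      ∑ k ∈ T, ∑ a, |w k a - w' k a| by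
    simpa using h univ
  intro T
  induction T using Finset.induction_on with
  | empty => simp
  | insert k T hk ih =>
    have h1 : IsWeight (T.piecewise w' w) :=
      ⟨fun l a => by by_cases h : l ∈ T <;> simp [h, hw.nonneg, hw'.nonneg],
        fun l => by by_cases h : l ∈ T <;> simp [h, hw.sum_eq_one, hw'.sum_eq_one]⟩
    have h2 := abs_ev_update_sub_le h1 k (w' k) hf
    rw [piecewise_eq_of_notMem _ _ _ hk] at h2
    rw [piecewise_insert, sum_insert hk]
    exact (abs_sub_le _ _ _).trans (add_le_add h2 ih)

lemma ev_comp [DecidableEq β] (w : κ → α → ℝ) (π : α → β) (f : (κ → β) → ℝ) :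
    ev w (fun x => f fun k => π (x k)) = ev (fun k b => ∑ a with π a = b, w k a) f := by
  have h1 : ∀ y : κ → β, ∏ k, ∑ a with π a = y k, w k a =
      ∑ x : κ → α with (fun k => π (x k)) = y, ∏ k, w k (x k) := fun y => by
    rw [prod_univ_sum]
    refine sum_congr (ext fun x => ?_) fun _ _ => rfl
    simp [funext_iff]
  simp only [ev, h1]
  rw [← sum_fiberwise univ fun (x : κ → α) k => π (x k)]
  refine sum_congr rfl fun y _ => ?_
  rw [sum_mul]
  exact sum_congr rfl fun x hx => by rw [(mem_filter.1 hx).2]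

omit [Fintype κ] [DecidableEq κ] in
lemma IsWeight.pushforward [DecidableEq β] {w : κ → α → ℝ} (hw : IsWeight w) (π : α → β) :
    IsWeight fun k b => ∑ a with π a = b, w k a :=
  ⟨fun k b => sum_nonneg fun a _ => hw.nonneg k a, fun k => by
    rw [sum_fiberwise]; exact hw.sum_eq_one k⟩

variable (κ α) in
/-- The uniform weights on `α`. -/
noncomputable def unif (_ : κ) (_ : α) : ℝ := 1 / Fintype.card α

omit [Fintype κ] [DecidableEq κ] in
lemma isWeight_unif [Nonempty α] : IsWeight (unif κ α) :=
  ⟨fun _ _ => by unfold unif; positivity, fun _ => by simp [unif]⟩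

lemma ev_unif_pi {P : Type*} [Fintype P] [DecidableEq P] {β : P → Type*} [∀ r, Fintype (β r)]
    (G : ∀ r, (κ → β r) → ℝ) :
    ev (unif κ (∀ r, β r)) (fun y => ∏ r, G r fun k => y k r) =
      ∏ r, ev (unif κ (β r)) (G r) := by
  simp only [ev, unif]
  rw [Fintype.prod_sum]
  refine Fintype.sum_equiv (Equiv.piComm fun (_ : κ) (r : P) => β r) _ _ fun y => ?_
  rw [prod_mul_distrib]
  congr 1
  simp [Fintype.card_pi, prod_pow]

end Comparison

section Residues

lemma abs_card_residue_sub_le {P : Type*} [Fintype P] [DecidableEq P] (q : P → ℕ)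
    (hq : ∀ r, 0 < q r) (hcop : Pairwise (Nat.Coprime on q)) (M : ℕ) (a : ∀ r, ZMod (q r)) :
    |(#{m : Fin M | (fun r => ((m : ℕ) : ZMod (q r))) = a} : ℝ) - M / (∏ r, q r : ℕ)| ≤ 1 := by
  classical
  have hQ : 0 < ∏ r, q r := Finset.prod_pos fun r _ => hq r
  have : NeZero (∏ r, q r) := ⟨hQ.ne'⟩
  let e := ZMod.prodEquivPi q hcop
  have h1 : (#{m : Fin M | (fun r => ((m : ℕ) : ZMod (q r))) = a}) =
      M.count (· ≡ (e.symm a).val [MOD ∏ r, q r]) := by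
    rw [Nat.count_eq_card_filter_range]
    refine card_bij (fun m _ => (m : ℕ)) (fun m hm => ?_) (fun _ _ _ _ h => Fin.ext h)
      fun m hm => ?_
    · rw [mem_filter] at hm ⊢
      refine ⟨mem_range.2 m.2, ?_⟩
      rw [← ZMod.natCast_eq_natCast_iff, ZMod.natCast_zmod_val,
        RingEquiv.eq_symm_apply, map_natCast,
        ← hm.2]
      rfl
    · rw [mem_filter, mem_range] at hm
      refine ⟨⟨m, hm.1⟩, ?_, rfl⟩
      rw [mem_filter]
      refine ⟨mem_univ _, ?_⟩
      have := hm.2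
      rw [← ZMod.natCast_eq_natCast_iff, ZMod.natCast_zmod_val, RingEquiv.eq_symm_apply,
        map_natCast] at this
      exact this
  rw [h1, Nat.count_modEq_card _ hQ]
  set Q := ∏ r, q r
  have hQ' : (0 : ℝ) < Q := by exact_mod_cast hQ
  have h2 : (M : ℝ) / Q = (M / Q : ℕ) + (M % Q : ℕ) / Q := by
    field_simp
    exact_mod_cast (Nat.div_add_mod M Q).symm
  have h3 : ((M % Q : ℕ) : ℝ) / Q ≤ 1 := by
    rw [div_le_one hQ']; exact_mod_cast (Nat.mod_lt M hQ).le
  have h4 : 0 ≤ ((M % Q : ℕ) : ℝ) / Q := by positivity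
  rw [h2, abs_le]
  split_ifs <;> push_cast <;> constructor <;> linarith

variable {κ : Type*} [Fintype κ] [DecidableEq κ]

lemma abs_ev_fin_sub_ev_zmod_le {P : Type*} [Fintype P] [DecidableEq P] (q : P → ℕ)
    [∀ r, NeZero (q r)] (hcop : Pairwise (Nat.Coprime on q)) {M : ℕ} [NeZero M]
    {f : (κ → ∀ r, ZMod (q r)) → ℝ} (hf : ∀ y, |f y| ≤ 1) :
    |ev (unif κ (Fin M)) (fun x => f fun k r => ((x k : ℕ) : ZMod (q r))) -
      ev (unif κ (∀ r, ZMod (q r))) f| ≤ Fintype.card κ * (∏ r, q r : ℕ) / M := by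
  classical
  have hM : (0 : ℝ) < M := by exact_mod_cast Nat.pos_of_ne_zero (NeZero.ne M)
  obtain ⟨π, hπ⟩ : ∃ π : Fin M → ∀ r, ZMod (q r), π = fun (m : Fin M) r => ((m : ℕ) : ZMod (q r)) :=
    ⟨_, rfl⟩
  have hcomp := ev_comp (unif κ (Fin M)) π f
  have hw := (isWeight_unif (κ := κ) (α := Fin M)).pushforward π
  rw [hπ] at hcomp
  rw [hcomp, ← hπ]
  refine (abs_ev_sub_ev_le isWeight_unif hw hf).trans ?_
  have hcard : (Fintype.card (∀ r, ZMod (q r)) : ℝ) = (∏ r, q r : ℕ) := by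
    simp [Fintype.card_pi, ZMod.card]
  have h1 : ∀ (k : κ) (b : ∀ r, ZMod (q r)), |unif κ (∀ r, ZMod (q r)) k b -
      ∑ m with π m = b, unif κ (Fin M) k m| ≤ 1 / M := by
    intro k b
    have h2 : |(#{m | π m = b} : ℝ) - M / (∏ r, q r : ℕ)| ≤ 1 :=
      hπ ▸ abs_card_residue_sub_le q
        (fun r => Nat.pos_of_ne_zero (NeZero.ne _)) hcop M b
    have h3 : ((∏ r, q r : ℕ) : ℝ) ≠ 0 := by
      exact_mod_cast (Finset.prod_pos fun r _ => Nat.pos_of_ne_zero (NeZero.ne (q r))).ne'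
    have h4 : unif κ (∀ r, ZMod (q r)) k b -
        ∑ m with π m = b, unif κ (Fin M) k m =
        -(((#{m | π m = b} : ℝ) -
          M / (∏ r, q r : ℕ)) / M) := by
      simp only [unif, hcard, sum_const, nsmul_eq_mul, Fintype.card_fin]
      field_simp
      ring
    rw [h4, abs_neg, abs_div, abs_of_pos hM]
    gcongr
  calc _ ≤ ∑ k : κ, ∑ b : ∀ r, ZMod (q r), (1 / M : ℝ) :=
        sum_le_sum fun k _ => sum_le_sum fun b _ => h1 k b
    _ = _ := by
      simp only [sum_const, card_univ, nsmul_eq_mul, hcard]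
      ring

end Residues

section LocalFactors
variable {κ P : Type*} [Fintype κ] [DecidableEq κ] [DecidableEq P] {r : ℕ} [hr : Fact r.Prime]

/-- The function on residue classes inducing `localFactor r`. -/
noncomputable def zmodFactor (r : ℕ) (z : ZMod r) : ℝ := if z = 0 then -1 else 1 / (r - 1)

lemma zmodFactor_intCast (n : ℤ) : zmodFactor r n = localFactor r n := by
  have h : ((n : ZMod r) = 0) = ((r : ℤ) ∣ n) := propext (ZMod.intCast_zmod_eq_zero_iff_dvd n r)
  unfold zmodFactor localFactor
  split_ifs <;> simp_all

lemma abs_zmodFactor_le (z : ZMod r) : |zmodFactor r z| ≤ 1 := by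
  rw [← ZMod.intCast_zmod_cast z, zmodFactor_intCast]
  exact abs_localFactor_le hr.1.two_le _

lemma sum_zmodFactor : ∑ z : ZMod r, zmodFactor r z = 0 := by
  have h : (2 : ℝ) ≤ r := by exact_mod_cast hr.1.two_le
  have h1 : (r : ℝ) - 1 ≠ 0 := by linarith
  have h2 : ∀ z ∈ univ.erase (0 : ZMod r), zmodFactor r z = 1 / (r - 1) := fun z hz =>
    if_neg (ne_of_mem_erase hz)
  rw [← add_sum_erase univ _ (mem_univ (0 : ZMod r)), sum_congr rfl h2, sum_const,
    card_erase_of_mem (mem_univ _), card_univ, ZMod.card,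
    nsmul_eq_mul, Nat.cast_sub hr.1.one_le]
  simp only [zmodFactor, if_true]
  push_cast
  field_simp
  ring

lemma sum_abs_zmodFactor : ∑ z : ZMod r, |zmodFactor r z| = 2 := by
  have h : (2 : ℝ) ≤ r := by exact_mod_cast hr.1.two_le
  have h1 : (r : ℝ) - 1 ≠ 0 := by linarith
  have h2 : ∀ z ∈ univ.erase (0 : ZMod r), |zmodFactor r z| = 1 / (r - 1) := fun z hz => by
    rw [zmodFactor, if_neg (ne_of_mem_erase hz), abs_of_nonneg]
    apply div_nonneg <;> linarith
  rw [← add_sum_erase univ _ (mem_univ (0 : ZMod r)), sum_congr rfl h2, sum_const,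
    card_erase_of_mem (mem_univ _), card_univ, ZMod.card, nsmul_eq_mul, Nat.cast_sub hr.1.one_le]
  simp only [zmodFactor, if_true, abs_neg, abs_one]
  push_cast
  field_simp
  ring

variable {W : ℤ} {c : P → κ → ℤ} {b : P → ℤ}

/-- The value of an affine-linear form modulo `r`. -/
def zmodForm (W : ℤ) (c : P → κ → ℤ) (b : P → ℤ) (p : P) (z : κ → ZMod r) : ZMod r :=
  W * ∑ k, (c p k : ZMod r) * z k + b p

omit [DecidableEq P] in
lemma avg_zmodForm (hW : ¬ (r : ℤ) ∣ W) {p : P} {k : κ} (hk : |c p k| = 1) (h : ZMod r → ℝ)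
    (z : κ → ZMod r) :
    avg (unif κ (ZMod r)) k (fun z => h (zmodForm W c b p z)) z = (∑ a, h a) / r := by
  have hu : (W : ZMod r) * c p k ≠ 0 := by
    refine mul_ne_zero ?_ ?_
    · rwa [Ne, ZMod.intCast_zmod_eq_zero_iff_dvd]
    · rcases (abs_eq zero_le_one).1 hk with h | h <;> simp [h]
  have h1 : ∀ a, zmodForm W c b p (update z k a) =
      (W * c p k) * a + zmodForm W c b p (update z k 0) := fun a => by
    simp only [zmodForm, ← add_sum_erase univ _ (mem_univ k), update_self]
    have : ∀ a', ∑ l ∈ univ.erase k, (c p l : ZMod r) * update z k a' l =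
        ∑ l ∈ univ.erase k, (c p l : ZMod r) * z l := fun a' =>
      sum_congr rfl fun l hl => by rw [update_of_ne (ne_of_mem_erase hl)]
    rw [this, this]
    ring
  have h2 : ∑ a, h ((W * c p k) * a + zmodForm W c b p (update z k 0)) = ∑ a, h a :=
    Fintype.sum_equiv ((Equiv.mulLeft₀ _ hu).trans (Equiv.addRight _)) _ _ fun a => rfl
  simp only [avg, unif]
  rw [← mul_sum, ZMod.card, sum_congr rfl fun a _ => congrArg h (h1 a), h2]
  ring

omit [DecidableEq P] in
lemma free_zmodForm {p : P} {k : κ} (hk : c p k = 0) :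
    Free κ (ZMod r) k (zmodForm W c b p) := fun z a => by
  simp only [zmodForm]
  congr 2
  refine sum_congr rfl fun l _ => ?_
  by_cases h : l = k
  · subst h; simp [hk]
  · rw [update_of_ne h]

omit [DecidableEq P] in
lemma ev_zmodForm (hW : ¬ (r : ℤ) ∣ W) {p : P} {k : κ} (hk : |c p k| = 1) (h : ZMod r → ℝ) :
    ev (unif κ (ZMod r)) (fun z => h (zmodForm W c b p z)) = (∑ a, h a) / r := by
  rw [← isWeight_unif.ev_avg k]
  rw [funext (avg_zmodForm hW hk h)]
  exact isWeight_unif.ev_const _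

lemma abs_ev_prod_zmodFactor_le (hW : ¬ (r : ℤ) ∣ W) (hc : ∀ p k, |c p k| ≤ 1)
    (hc0 : ∀ p, ∃ k, c p k ≠ 0) (hc1 : ∀ p p', p ≠ p' → ∃ k, ¬ (c p k = 0 ↔ c p' k = 0))
    {S : Finset P} (hS : S.Nonempty) :
    |ev (unif κ (ZMod r)) fun z => ∏ p ∈ S, zmodFactor r (zmodForm W c b p z)| ≤ 4 / r ^ 2 := by
  have hone : ∀ {p k}, c p k ≠ 0 → |c p k| = 1 := fun {p k} h =>
    le_antisymm (hc p k) (Int.one_le_abs h)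
  obtain ⟨p, hp⟩ := hS
  by_cases hS1 : S = {p}
  · obtain ⟨k, hk⟩ := hc0 p
    simp only [hS1, prod_singleton, ev_zmodForm hW (hone hk), sum_zmodFactor]
    simp only [zero_div, abs_zero]
    positivity
  have hpair : ∃ p ∈ S, ∃ p' ∈ S, p ≠ p' ∧ ∃ k, c p k ≠ 0 ∧ c p' k = 0 := by
    obtain ⟨p', hp', hne⟩ : ∃ p' ∈ S, p' ≠ p := by
      by_contra! h
      exact hS1 (eq_singleton_iff_unique_mem.2 ⟨hp, h⟩)
    obtain ⟨k, hk⟩ := hc1 p p' hne.symm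
    by_cases h : c p k = 0
    · exact ⟨p', hp', p, hp, hne, k, fun h' => hk ⟨fun _ => h', fun _ => h⟩, h⟩
    · exact ⟨p, hp, p', hp', hne.symm, k, h, by tauto⟩
  obtain ⟨p, hp, p', hp', hne, k, hk, hk'⟩ := hpair
  have hb : ∀ z : κ → ZMod r, |∏ p ∈ S, zmodFactor r (zmodForm W c b p z)| ≤
      |zmodFactor r (zmodForm W c b p' z)| * |zmodFactor r (zmodForm W c b p z)| := fun z => by
    rw [abs_prod, ← mul_prod_erase S _ hp', ← mul_prod_erase _ _ (mem_erase.2 ⟨hne, hp⟩),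
      ← mul_assoc]
    exact mul_le_of_le_one_right (by positivity)
      (prod_le_one (fun _ _ => abs_nonneg _) fun _ _ => abs_zmodFactor_le _)
  refine (isWeight_unif.abs_ev_le_of_le hb).trans ?_
  obtain ⟨k', hk0⟩ := hc0 p'
  have hfree : Free κ (ZMod r) k fun z => |zmodFactor r (zmodForm W c b p' z)| :=
    (free_zmodForm hk').comp fun a => |zmodFactor r a|
  rw [← isWeight_unif.ev_mul_avg hfree]
  simp only [avg_zmodForm hW (hone hk) fun a => |zmodFactor r a|]
  rw [ev_mul_const, ev_zmodForm hW (hone hk0) fun a => |zmodFactor r a|, sum_abs_zmodFactor]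
  exact le_of_eq (by ring)

end LocalFactors
end RelCorners

namespace RelCorners
open Finset Function

section LinearForms
variable {κ P : Type*} [Fintype κ] [DecidableEq κ] [Fintype P] [DecidableEq P]

lemma sum_prod_biUnion_le {𝓟 : Finset ℕ} {f : ℕ → ℝ} (hf : ∀ r ∈ 𝓟, 0 ≤ f r) :
    ∑ u ∈ Fintype.piFinset fun _ : P => 𝓟.powerset, ∏ r ∈ univ.biUnion u, f r ≤
      ∏ r ∈ 𝓟, (1 + 2 ^ Fintype.card P * f r) := by
  have hmaps : ∀ u ∈ Fintype.piFinset fun _ : P => 𝓟.powerset, univ.biUnion u ∈ 𝓟.powerset :=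
    fun u hu => mem_powerset.2 (biUnion_subset.2 fun p _ =>
      mem_powerset.1 (Fintype.mem_piFinset.1 hu p))
  rw [prod_one_add, ← sum_fiberwise_of_maps_to hmaps]
  refine sum_le_sum fun V hV => ?_
  rw [mem_powerset] at hV
  have hV0 : 0 ≤ ∏ r ∈ V, f r := prod_nonneg fun r hr => hf r (hV hr)
  rw [sum_congr rfl fun u hu => by rw [(mem_filter.1 hu).2], sum_const, nsmul_eq_mul,
    prod_mul_distrib, prod_const]
  refine mul_le_mul_of_nonneg_right ?_ hV0
  have h1 : (Fintype.piFinset fun _ : P => 𝓟.powerset).filter (fun u => univ.biUnion u = V) ⊆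
      Fintype.piFinset fun _ : P => V.powerset := fun u hu => by
    rw [mem_filter] at hu
    refine Fintype.mem_piFinset.2 fun p => mem_powerset.2 ?_
    rw [← hu.2]
    exact subset_biUnion_of_mem u (mem_univ p)
  have h2 := card_le_card h1
  rw [Fintype.card_piFinset, prod_const, card_powerset, card_univ, ← pow_mul, mul_comm,
    pow_mul] at h2
  exact_mod_cast h2

variable {W : ℤ} {c : P → κ → ℤ} (b : P → ℤ)

lemma abs_ev_prod_localFactor_le (hc : ∀ p k, |c p k| ≤ 1)
    (hc0 : ∀ p, ∃ k, c p k ≠ 0) (hc1 : ∀ p p', p ≠ p' → ∃ k, ¬ (c p k = 0 ↔ c p' k = 0))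
    {M : ℕ} [NeZero M] {u : P → Finset ℕ} (hu : ∀ r ∈ univ.biUnion u, r.Prime)
    (hW : ∀ r ∈ univ.biUnion u, ¬ (r : ℤ) ∣ W) :
    |ev (unif κ (Fin M)) fun x => ∏ p, ∏ r ∈ u p,
        localFactor r (W * ∑ k, c p k * ((x k : ℕ) : ℤ) + b p)| ≤
      ∏ r ∈ univ.biUnion u, (4 / r ^ 2 : ℝ) +
        Fintype.card κ * (∏ r ∈ univ.biUnion u, r : ℕ) / M := by
  set V := univ.biUnion u with hV
  have hprime : ∀ r : V, Fact (r : ℕ).Prime := fun r => ⟨hu r r.2⟩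
  have hne : ∀ r : V, NeZero (r : ℕ) := fun r => ⟨(hu r r.2).ne_zero⟩
  have hcop : Pairwise (Nat.Coprime on fun r : V => (r : ℕ)) := fun r r' h =>
    (Nat.coprime_primes (hu r r.2) (hu r' r'.2)).2 (Subtype.coe_injective.ne h)
  let G : ∀ r : V, (κ → ZMod r) → ℝ := fun r z =>
    ∏ p with (r : ℕ) ∈ u p, zmodFactor r (zmodForm W c b p z)
  have h1 : ∀ x : κ → Fin M, ∏ p, ∏ r ∈ u p,
      localFactor r (W * ∑ k, c p k * ((x k : ℕ) : ℤ) + b p) =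
      ∏ r : V, G r fun k => ((x k : ℕ) : ZMod r) := fun x => by
    have h2 : ∀ r : V, G r (fun k => ((x k : ℕ) : ZMod r)) = ∏ p with (r : ℕ) ∈ u p,
        localFactor r (W * ∑ k, c p k * ((x k : ℕ) : ℤ) + b p) := fun r =>
      prod_congr rfl fun p _ => by
        rw [← zmodFactor_intCast, zmodForm]
        push_cast
        rfl
    rw [Fintype.prod_congr _ _ h2, prod_coe_sort V fun r => ∏ p with r ∈ u p,
        localFactor r (W * ∑ k, c p k * ((x k : ℕ) : ℤ) + b p)]
    refine prod_comm' fun p r => ?_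
    simp only [mem_univ, true_and, mem_filter, hV, mem_biUnion]
    exact ⟨fun h => ⟨h, p, h⟩, fun h => h.1⟩
  have hG : ∀ r z, |G r z| ≤ 1 := fun r z => abs_prod_le_one fun p _ => abs_zmodFactor_le _
  have h3 := abs_ev_fin_sub_ev_zmod_le (κ := κ) (M := M) (fun r : V => (r : ℕ)) hcop
    (f := fun y => ∏ r, G r fun k => y k r) fun y => abs_prod_le_one fun r _ => hG r _
  rw [ev_unif_pi, prod_coe_sort V fun r => r] at h3
  have h4 : |∏ r : V, ev (unif κ (ZMod r)) (G r)| ≤ ∏ r ∈ V, (4 / r ^ 2 : ℝ) := by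
    rw [abs_prod, ← prod_coe_sort V fun r => (4 / r ^ 2 : ℝ)]
    refine prod_le_prod (fun _ _ => abs_nonneg _) fun r _ => ?_
    obtain ⟨p, -, hp⟩ := mem_biUnion.1 r.2
    exact abs_ev_prod_zmodFactor_le (hW r r.2) hc hc0 hc1 ⟨p, by simpa using hp⟩
  simp only [h1]
  have h5 := abs_sub_abs_le_abs_sub (ev (unif κ (Fin M)) fun x =>
    ∏ r : V, G r fun k => ((x k : ℕ) : ZMod r)) (∏ r : V, ev (unif κ (ZMod r)) (G r))
  linarith

/-- The linear forms condition for the sieve weight. -/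
theorem abs_ev_prod_sieveWeight_sub_one_le {𝓟 : Finset ℕ} {R : ℕ} (h𝓟 : ∀ r ∈ 𝓟, r.Prime)
    (hR : 1 ≤ R) (hW : ∀ r ∈ 𝓟, ¬ (r : ℤ) ∣ W) (hc : ∀ p k, |c p k| ≤ 1)
    (hc0 : ∀ p, ∃ k, c p k ≠ 0) (hc1 : ∀ p p', p ≠ p' → ∃ k, ¬ (c p k = 0 ↔ c p' k = 0))
    {M : ℕ} [NeZero M] :
    |(ev (unif κ (Fin M)) fun x => ∏ p,
        sieveWeight 𝓟 R (W * ∑ k, c p k * ((x k : ℕ) : ℤ) + b p)) - 1| ≤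
      (∏ r ∈ 𝓟, (1 + 2 ^ Fintype.card P * (4 ^ Fintype.card P * (4 / r ^ 2 : ℝ))) - 1) +
        Fintype.card κ * R ^ (8 * Fintype.card P) / M := by
  obtain ⟨Γ, hΓ0, hΓ, hexp⟩ := exists_sieveWeight_expansion h𝓟 hR
  set K := Fintype.card P with hK
  set D := sieveSupport 𝓟 (R ^ 2) with hD
  set F : (P → Finset ℕ) → ℝ := fun u => ev (unif κ (Fin M)) fun x => ∏ p, ∏ r ∈ u p,
        localFactor r (W * ∑ k, c p k * ((x k : ℕ) : ℤ) + b p) with hF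
  set I := Fintype.piFinset fun _ : P => D with hI
  have hM : (0 : ℝ) < M := by exact_mod_cast Nat.pos_of_ne_zero (NeZero.ne M)
  have hR' : (1 : ℝ) ≤ R := by exact_mod_cast hR
  have h1 : (ev (unif κ (Fin M)) fun x => ∏ p,
      sieveWeight 𝓟 R (W * ∑ k, c p k * ((x k : ℕ) : ℤ) + b p)) =
      ∑ u ∈ I, (∏ p, Γ (u p)) * F u := by
    simp only [hexp, prod_univ_sum, prod_mul_distrib]
    rw [ev_sum]
    exact sum_congr rfl fun u _ => ev_const_mul _ _
  have hIsub : ∀ u ∈ I, ∀ p, u p ∈ D := fun u hu => Fintype.mem_piFinset.1 hu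
  have hu𝓟 : ∀ u ∈ I, univ.biUnion u ⊆ 𝓟 := fun u hu => biUnion_subset.2 fun p _ =>
    (mem_sieveSupport.1 (hIsub u hu p)).1
  have h0 : (fun _ => ∅ : P → Finset ℕ) ∈ I := Fintype.mem_piFinset.2 fun p =>
    mem_sieveSupport.2 ⟨empty_subset _, by simpa using Nat.one_le_pow _ _ hR⟩
  have hF0 : F (fun _ => ∅) = 1 := by
    simp only [hF, prod_empty, prod_const_one]
    exact isWeight_unif.ev_const _
  have hFu : ∀ u ∈ I, |F u| ≤ ∏ r ∈ univ.biUnion u, (4 / r ^ 2 : ℝ) +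
      Fintype.card κ * R ^ (2 * K) / M := fun u hu => by
    refine (abs_ev_prod_localFactor_le b hc hc0 hc1 (fun r hr => h𝓟 r (hu𝓟 u hu hr))
      fun r hr => hW r (hu𝓟 u hu hr)).trans ?_
    have h2 : ∏ r ∈ univ.biUnion u, r ≤ R ^ (2 * K) := by
      calc ∏ r ∈ univ.biUnion u, r ≤ ∏ p, ∏ r ∈ u p, r := by
            have : ∀ T : Finset P, ∏ r ∈ T.biUnion u, r ≤ ∏ p ∈ T, ∏ r ∈ u p, r := by
              intro T
              induction T using Finset.induction_on with
              | empty => simp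
              | insert p T hp ih =>
                rw [biUnion_insert, prod_insert hp]
                refine le_trans ?_ (Nat.mul_le_mul_left _ ih)
                rw [← prod_union_inter]
                refine Nat.le_mul_of_pos_right _ (Finset.prod_pos fun r hr => ?_)
                exact (h𝓟 r ((mem_sieveSupport.1 (hIsub u hu p)).1
                  (mem_of_mem_inter_left hr))).pos
            exact this univ
        _ ≤ ∏ _p : P, R ^ 2 := prod_le_prod' fun p _ => (mem_sieveSupport.1 (hIsub u hu p)).2
        _ = _ := by rw [prod_const, card_univ, ← pow_mul]
    have h3 : ((∏ r ∈ univ.biUnion u, r : ℕ) : ℝ) ≤ R ^ (2 * K) := by exact_mod_cast h2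
    gcongr
  have hΓ1 : ∀ u ∈ I, |∏ p, Γ (u p)| ≤ ∏ _r ∈ univ.biUnion u, (4 : ℝ) ^ K := fun u hu => by
    rw [abs_prod, prod_const, ← pow_mul, mul_comm, pow_mul]
    calc ∏ p, |Γ (u p)| ≤ ∏ _p : P, (4 : ℝ) ^ #(univ.biUnion u) := by
          refine prod_le_prod (fun _ _ => abs_nonneg _) fun p _ => (hΓ _).trans ?_
          exact pow_le_pow_right₀ (by norm_num)
            (card_le_card (subset_biUnion_of_mem u (mem_univ p)))
      _ = _ := by rw [prod_const, card_univ]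
  have hΓ2 : ∀ u ∈ I, |∏ p, Γ (u p)| ≤ R ^ (4 * K) := fun u hu => by
    rw [abs_prod, pow_mul]
    calc ∏ p, |Γ (u p)| ≤ ∏ _p : P, (R : ℝ) ^ 4 := by
          refine prod_le_prod (fun _ _ => abs_nonneg _) fun p _ => (hΓ _).trans ?_
          obtain ⟨h2, h3⟩ := mem_sieveSupport.1 (hIsub u hu p)
          have h4 : 2 ^ #(u p) ≤ ∏ r ∈ u p, r :=
            pow_card_le_prod _ _ _ fun r hr => (h𝓟 r (h2 hr)).two_le
          have h5 : 4 ^ #(u p) ≤ R ^ 4 := by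
            calc 4 ^ #(u p) = (2 ^ #(u p)) ^ 2 := by rw [← pow_mul, mul_comm, pow_mul]; norm_num
              _ ≤ (R ^ 2) ^ 2 := Nat.pow_le_pow_left (h4.trans h3) 2
              _ = R ^ 4 := by rw [← pow_mul]
          exact_mod_cast h5
      _ = _ := by rw [prod_const, card_univ]
  have hcard : (#I : ℝ) ≤ R ^ (2 * K) := by
    have h2 : #I ≤ (R ^ 2) ^ K := by
      rw [hI, Fintype.card_piFinset, prod_const, card_univ]
      exact Nat.pow_le_pow_left (card_sieveSupport_le h𝓟) _
    rw [pow_mul]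
    exact_mod_cast h2
  have hterm : ∀ u ∈ I, |(∏ p, Γ (u p)) * F u| ≤
      ∏ r ∈ univ.biUnion u, (4 ^ K * (4 / r ^ 2 : ℝ)) +
        R ^ (4 * K) * (Fintype.card κ * R ^ (2 * K) / M) := fun u hu => by
    have h4 : 0 ≤ ∏ r ∈ univ.biUnion u, (4 / r ^ 2 : ℝ) := prod_nonneg fun _ _ => by positivity
    rw [abs_mul, prod_mul_distrib]
    calc _ ≤ |∏ p, Γ (u p)| * (∏ r ∈ univ.biUnion u, (4 / r ^ 2 : ℝ) +
          Fintype.card κ * R ^ (2 * K) / M) := mul_le_mul_of_nonneg_left (hFu u hu) (abs_nonneg _)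
      _ ≤ _ := by
        rw [mul_add]
        exact add_le_add (mul_le_mul_of_nonneg_right (hΓ1 u hu) h4)
          (mul_le_mul_of_nonneg_right (hΓ2 u hu) (by positivity))
  rw [h1, ← add_sum_erase I _ h0, hF0]
  simp only [hΓ0, prod_const_one, one_mul, add_sub_cancel_left]
  have h6 : ∑ u ∈ I.erase fun _ => ∅, ∏ r ∈ univ.biUnion u, (4 ^ K * (4 / r ^ 2 : ℝ)) ≤
      ∏ r ∈ 𝓟, (1 + 2 ^ K * (4 ^ K * (4 / r ^ 2 : ℝ))) - 1 := by
    have h7 : ∑ u ∈ I, ∏ r ∈ univ.biUnion u, (4 ^ K * (4 / r ^ 2 : ℝ)) ≤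
        ∏ r ∈ 𝓟, (1 + 2 ^ K * (4 ^ K * (4 / r ^ 2 : ℝ))) := by
      refine (sum_le_sum_of_subset_of_nonneg ?_ fun u _ _ => prod_nonneg fun _ _ => ?_).trans
        (sum_prod_biUnion_le fun r _ => ?_)
      · exact Fintype.piFinset_subset _ _ fun p => filter_subset _ _
      · positivity
      · positivity
    rw [← add_sum_erase I _ h0] at h7
    have h8 : (univ : Finset P).biUnion (fun _ => (∅ : Finset ℕ)) = ∅ := by
      ext; simp
    rw [h8, prod_empty] at h7
    linarith
  calc _ ≤ ∑ u ∈ I.erase fun _ => ∅, (∏ r ∈ univ.biUnion u, (4 ^ K * (4 / r ^ 2 : ℝ)) +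
        R ^ (4 * K) * (Fintype.card κ * R ^ (2 * K) / M)) :=
      (abs_sum_le_sum_abs _ _).trans (sum_le_sum fun u hu => hterm u (mem_of_mem_erase hu))
    _ ≤ _ := by
      rw [sum_add_distrib, sum_const, nsmul_eq_mul]
      refine add_le_add h6 ?_
      have h9 : (#(I.erase fun _ => ∅) : ℝ) ≤ R ^ (2 * K) :=
        le_trans (by exact_mod_cast card_le_card (erase_subset _ _)) hcard
      calc _ ≤ (R : ℝ) ^ (2 * K) * (R ^ (4 * K) * (Fintype.card κ * R ^ (2 * K) / M)) := by gcongr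
        _ = _ := by
          rw [show 8 * K = 2 * K + 4 * K + 2 * K by ring, pow_add, pow_add]
          ring

end LinearForms
end RelCorners

namespace RelCorners
open Finset Function

section SieveMass

/-- The primes up to `R` not dividing `W`. -/
def sievePrimes (W R : ℕ) : Finset ℕ := (range (R + 1)).filter fun r => r.Prime ∧ ¬ r ∣ W

variable {W R : ℕ}

lemma prime_of_mem_sievePrimes {r : ℕ} (hr : r ∈ sievePrimes W R) : r.Prime :=
  (mem_filter.1 hr).2.1

lemma not_dvd_of_mem_sievePrimes {r : ℕ} (hr : r ∈ sievePrimes W R) : ¬ r ∣ W :=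
  (mem_filter.1 hr).2.2

lemma le_of_mem_sievePrimes {r : ℕ} (hr : r ∈ sievePrimes W R) : r ≤ R :=
  Nat.lt_succ_iff.1 (mem_range.1 (mem_filter.1 hr).1)

lemma sum_geometric_Icc_le {r : ℕ} (hr : 2 ≤ r) (R : ℕ) :
    ∑ i ∈ Icc 1 R, (1 / (r : ℝ)) ^ i ≤ 1 / (r - 1) := by
  have h : (2 : ℝ) ≤ r := by exact_mod_cast hr
  have h1 : (0 : ℝ) < r - 1 := by linarith
  have h2 : ∑ i ∈ Icc 1 R, (1 / (r : ℝ)) ^ i = (1 - (1 / (r : ℝ)) ^ R) / (r - 1) := by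
    induction R with
    | zero => simp
    | succ R ih =>
      rw [sum_Icc_succ_top (by omega), ih, pow_succ]
      field_simp
      ring
  rw [h2]
  gcongr
  have : 0 ≤ (1 / (r : ℝ)) ^ R := by positivity
  linarith

lemma sum_inv_primeFactors_eq_le (u : Finset ℕ) (hu : ∀ r ∈ u, r.Prime) (R : ℕ) :
    ∑ n ∈ Icc 1 R with n.primeFactors = u, (1 / n : ℝ) ≤ ∏ r ∈ u, 1 / ((r : ℝ) - 1) := by
  have h1 : ∑ n ∈ Icc 1 R with n.primeFactors = u, (1 / n : ℝ) ≤
      ∑ f ∈ Fintype.piFinset fun _ : u => Icc 1 R, ∏ r : u, (1 / ((r : ℕ) : ℝ)) ^ f r := by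
    have hprod : ∀ n ∈ (Icc 1 R).filter fun n => n.primeFactors = u,
        ∏ r ∈ u, r ^ n.factorization r = n := fun n hn => by
      obtain ⟨hn, hnu⟩ := mem_filter.1 hn
      rw [← hnu]
      exact Nat.prod_factorization_pow_eq_self (by have := (mem_Icc.1 hn).1; omega)
    refine sum_le_sum_of_injOn (fun n r => n.factorization r) (fun n hn => ?_)
      (fun n hn m hm h => ?_) (fun f _ => prod_nonneg fun _ _ => by positivity) fun n hn => ?_
    · refine Fintype.mem_piFinset.2 fun r => mem_Icc.2 ?_
      obtain ⟨hn, hnu⟩ := mem_filter.1 hn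
      have hr : (r : ℕ) ∈ n.primeFactors := hnu ▸ r.2
      obtain ⟨hr1, hr2, hr3⟩ := Nat.mem_primeFactors.1 hr
      exact ⟨hr1.factorization_pos_of_dvd hr3 hr2,
        (Nat.factorization_lt _ hr3).le.trans (mem_Icc.1 hn).2⟩
    · rw [← hprod n hn, ← hprod m hm]
      exact prod_congr rfl fun r hr => congrArg _ (congrFun h ⟨r, hr⟩)
    · rw [prod_coe_sort u fun r => (1 / (r : ℝ)) ^ n.factorization r]
      conv_lhs => rw [← hprod n hn]
      push_cast
      rw [one_div, ← prod_inv_distrib]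
      exact le_of_eq (prod_congr rfl fun r _ => by rw [one_div, inv_pow])
  refine h1.trans ?_
  rw [← prod_univ_sum, prod_coe_sort u fun r => ∑ i ∈ Icc 1 R, (1 / (r : ℝ)) ^ i]
  exact prod_le_prod (fun _ _ => sum_nonneg fun _ _ => by positivity)
    fun r hr => sum_geometric_Icc_le (hu r hr).two_le R

lemma prod_one_add_inv_primeFactors (hW : W ≠ 0) :
    ∏ p ∈ W.primeFactors, (1 + 1 / ((p : ℝ) - 1)) = W / W.totient := by
  have h1 : (W.totient : ℝ) = W * ∏ p ∈ W.primeFactors, (1 - (p : ℝ)⁻¹) := by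
    have := congrArg (fun q : ℚ => (q : ℝ)) (Nat.totient_eq_mul_prod_factors W)
    push_cast at this
    exact this
  have h2 : (W.totient : ℝ) ≠ 0 := by
    exact_mod_cast (Nat.totient_pos.2 (Nat.pos_of_ne_zero hW)).ne'
  rw [eq_div_iff h2, h1, mul_left_comm, ← prod_mul_distrib, prod_eq_one, mul_one]
  intro p hp
  have h : (2 : ℝ) ≤ p := by exact_mod_cast (Nat.prime_of_mem_primeFactors hp).two_le
  have h3 : (p : ℝ) - 1 ≠ 0 := by linarith
  field_simp
  ring

lemma totient_div_mul_log_le_sieveMass (hW : W ≠ 0) :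
    W.totient / W * Real.log R ≤ sieveMass (sievePrimes W R) R := by
  have hW' : (0 : ℝ) < W := by exact_mod_cast Nat.pos_of_ne_zero hW
  have hφ : (0 : ℝ) < W.totient := by exact_mod_cast Nat.totient_pos.2 (Nat.pos_of_ne_zero hW)
  have h0 : ∀ s : Finset ℕ, (∀ r ∈ s, r.Prime) → 0 ≤ ∏ r ∈ s, 1 / ((r : ℝ) - 1) :=
    fun s hs => prod_inv_nonneg hs subset_rfl
  have h1 : ∑ n ∈ Icc 1 R, (1 / n : ℝ) ≤ sieveMass (sievePrimes W R) R * (W / W.totient) := by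
    rw [← sum_fiberwise_of_maps_to (t := (Icc 1 R).image Nat.primeFactors)
      fun n hn => mem_image_of_mem _ hn]
    calc _ ≤ ∑ u ∈ (Icc 1 R).image Nat.primeFactors, ∏ r ∈ u, 1 / ((r : ℝ) - 1) := by
          refine sum_le_sum fun u hu => sum_inv_primeFactors_eq_le u ?_ R
          obtain ⟨n, -, rfl⟩ := mem_image.1 hu
          exact fun r hr => Nat.prime_of_mem_primeFactors hr
      _ ≤ ∑ q ∈ sieveSupport (sievePrimes W R) R ×ˢ W.primeFactors.powerset,
          (∏ r ∈ q.1, 1 / ((r : ℝ) - 1)) * ∏ r ∈ q.2, 1 / ((r : ℝ) - 1) := by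
        refine sum_le_sum_of_injOn (fun u => (u \ W.primeFactors, u ∩ W.primeFactors))
          (fun u hu => ?_) (fun u _ v _ h => ?_) (fun q hq => ?_) fun u _ => ?_
        · obtain ⟨n, hn, rfl⟩ := mem_image.1 hu
          obtain ⟨hn1, hn2⟩ := mem_Icc.1 hn
          refine mem_product.2 ⟨mem_sieveSupport.2 ⟨fun r hr => ?_, ?_⟩,
            mem_powerset.2 inter_subset_right⟩
          · obtain ⟨hr1, hr2⟩ := mem_sdiff.1 hr
            have hp := Nat.prime_of_mem_primeFactors hr1
            have hle := Nat.le_of_dvd hn1 (Nat.dvd_of_mem_primeFactors hr1)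
            exact mem_filter.2 ⟨mem_range.2 (by omega), hp, fun h =>
              hr2 (Nat.mem_primeFactors.2 ⟨hp, h, hW⟩)⟩
          · calc _ ≤ ∏ r ∈ n.primeFactors, r := prod_le_prod_of_subset_of_one_le' sdiff_subset
                  fun r hr _ => (Nat.prime_of_mem_primeFactors hr).one_le
              _ ≤ n := Nat.le_of_dvd hn1 (Nat.prod_primeFactors_dvd n)
              _ ≤ R := hn2
        · simp only [Prod.mk.injEq] at h
          rw [← sdiff_union_inter u W.primeFactors, h.1, h.2, sdiff_union_inter]
        · obtain ⟨hq1, hq2⟩ := mem_product.1 hq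
          exact mul_nonneg
            (h0 _ fun r hr => prime_of_mem_sievePrimes ((mem_sieveSupport.1 hq1).1 hr))
            (h0 _ fun r hr => Nat.prime_of_mem_primeFactors (mem_powerset.1 hq2 hr))
        · rw [mul_comm, prod_inter_mul_prod_sdiff]
      _ = _ := by
        rw [sum_product]
        dsimp only
        rw [← sum_mul_sum, ← prod_one_add, prod_one_add_inv_primeFactors hW]
        rfl
  have h2 : Real.log R ≤ ∑ n ∈ Icc 1 R, (1 / n : ℝ) := by
    have h3 := log_add_one_le_harmonic R
    rw [harmonic_eq_sum_Icc] at h3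
    push_cast at h3
    simp only [one_div]
    refine le_trans ?_ h3
    rcases R.eq_zero_or_pos with rfl | hR
    · simp
    · exact Real.log_le_log (by exact_mod_cast hR) (by linarith)
  calc _ ≤ W.totient / W * (sieveMass (sievePrimes W R) R * (W / W.totient)) := by
        gcongr; exact h2.trans h1
    _ = _ := by field_simp

end SieveMass
end RelCorners

namespace RelCorners
open Finset Function Filter Topology

lemma prod_sievePrimes_le_exp {W n : ℕ} (hW : ∀ p, p.Prime → p ≤ n → p ∣ W) (R : ℕ) {C : ℝ}
    (hC : 0 ≤ C) :
    ∏ r ∈ sievePrimes W R, (1 + C * (1 / (r : ℝ) ^ 2)) ≤ Real.exp (C * (2 / ((n : ℝ) + 1))) := by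
  have h1 : ∑ r ∈ sievePrimes W R, (1 / (r : ℝ) ^ 2) ≤ 2 / ((n : ℝ) + 1) := by
    refine le_trans ?_ (sum_Ioo_inv_sq_le (α := ℝ) n (R + 1))
    simp only [one_div]
    refine sum_le_sum_of_subset_of_nonneg (fun r hr => ?_) fun _ _ _ => by positivity
    have h2 := le_of_mem_sievePrimes hr
    have h3 : n < r := by
      by_contra! h
      exact not_dvd_of_mem_sievePrimes hr (hW r (prime_of_mem_sievePrimes hr) h)
    exact mem_Ioo.2 ⟨h3, by omega⟩
  calc _ ≤ ∏ r ∈ sievePrimes W R, Real.exp (C * (1 / (r : ℝ) ^ 2)) :=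
        prod_le_prod (fun _ _ => by positivity) fun r _ => by
          rw [add_comm]; exact Real.add_one_le_exp _
    _ = Real.exp (C * ∑ r ∈ sievePrimes W R, (1 / (r : ℝ) ^ 2)) := by
        rw [← Real.exp_sum, mul_sum]
    _ ≤ _ := Real.exp_le_exp.2 (mul_le_mul_of_nonneg_left h1 hC)

/-- The parameters of the `W`-trick: the modulus `W`, the level `R` of the sieve, the length `M`
of the interval and the residues `b`. -/
structure SieveData (d : ℕ) where
  W : ℕ
  R : ℕ
  M : ℕ
  b : Fin d → ℤ
  one_le_R : 1 ≤ R
  M_neZero : NeZero M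

/-- A bound for the number of linear forms. -/
def formCount (d : ℕ) : ℕ :=
  Fintype.card ((Fin d × Bool) ⊕ (Fin d × Finset (Option (Fin d))))

namespace SieveData
variable {d : ℕ} (D : SieveData d)

instance : NeZero D.M := D.M_neZero

/-- The sieve weight along the progression of difference `W` and residue `b j`. -/
noncomputable def weight (j : Fin d) (y : ℤ) : ℝ :=
  sieveWeight (sievePrimes D.W D.R) D.R (D.W * y + D.b j)

/-- The total mass of `weight j`. -/
noncomputable def total (j : Fin d) : ℝ := ∑ m : Fin D.M, D.weight j ((m : ℕ) : ℤ)

/-- The weights on the coordinates: uniform on the sum coordinate `none`, and the normalised sieve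
weights on the other coordinates. -/
noncomputable def measure : Option (Fin d) → Fin D.M → ℝ
  | none, _ => 1 / D.M
  | some j, m => D.weight j ((m : ℕ) : ℤ) / D.total j

/-- The `j`-th coordinate recovered from the sum coordinate and the other coordinates. -/
def missing (j : Fin d) (x : Option (Fin d) → Fin D.M) : ℤ :=
  ((x none : ℕ) : ℤ) - ∑ l ∈ univ.erase j, ((x (some l) : ℕ) : ℤ)

/-- The majorants. -/
noncomputable def majorant : Option (Fin d) → (Option (Fin d) → Fin D.M) → ℝ
  | none, _ => 1
  | some j, x => D.weight j (D.missing j x)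

lemma weight_nonneg (j : Fin d) (y : ℤ) : 0 ≤ D.weight j y :=
  sieveWeight_nonneg (fun _ => prime_of_mem_sievePrimes) D.one_le_R _

lemma weight_le (j : Fin d) (y : ℤ) : D.weight j y ≤ D.R ^ 2 :=
  sieveWeight_le (fun _ => prime_of_mem_sievePrimes) D.one_le_R _

lemma M_pos : (0 : ℝ) < D.M := by exact_mod_cast Nat.pos_of_ne_zero (NeZero.ne D.M)

lemma isWeight_measure (h : ∀ j, 0 < D.total j) : IsWeight D.measure where
  nonneg k a := by
    cases k with
    | none => exact div_nonneg zero_le_one D.M_pos.le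
    | some j => exact div_nonneg (D.weight_nonneg _ _) (h j).le
  sum_eq_one k := by
    cases k with
    | none => simp [measure, D.M_pos.ne']
    | some j => simp only [measure]; rw [← sum_div]; exact div_self (h j).ne'

lemma majorant_nonneg (i : Option (Fin d)) (x : Option (Fin d) → Fin D.M) :
    0 ≤ D.majorant i x := by
  cases i with
  | none => exact zero_le_one
  | some j => exact D.weight_nonneg _ _

lemma free_missing (j : Fin d) : Free _ _ (some j) (D.missing j) := fun x a => by
  simp only [missing]
  congr 1
  exact sum_congr rfl fun l hl => by
    rw [update_of_ne fun h => ne_of_mem_erase hl (Option.some_injective _ h)]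

lemma free_majorant (i : Option (Fin d)) : Free _ _ i (D.majorant i) := fun x a => by
  cases i with
  | none => rfl
  | some j => simp only [majorant, D.free_missing j x a]

variable {D : ℕ → SieveData d}

lemma tendsto_ev_forms (hW : ∀ n p, p.Prime → p ≤ n → p ∣ (D n).W)
    (hR : Tendsto (fun n => ((D n).R : ℝ) ^ (8 * formCount d) / (D n).M) atTop (𝓝 0))
    {κ P : Type*} [Fintype κ] [DecidableEq κ] [Fintype P] [DecidableEq P]
    (hP : Fintype.card P ≤ formCount d) {c : P → κ → ℤ} (hc : ∀ p k, |c p k| ≤ 1)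
    (hc0 : ∀ p, ∃ k, c p k ≠ 0) (hc1 : ∀ p p', p ≠ p' → ∃ k, ¬ (c p k = 0 ↔ c p' k = 0))
    (e : P → Fin d) :
    Tendsto (fun n => ev (unif κ (Fin (D n).M)) fun x =>
      ∏ p, (D n).weight (e p) (∑ k, c p k * ((x k : ℕ) : ℤ))) atTop (𝓝 1) := by
  rw [tendsto_iff_dist_tendsto_zero]
  set K := Fintype.card P
  set C : ℝ := 2 ^ K * (4 ^ K * 4) with hC
  have h1 : Tendsto (fun n : ℕ => (Real.exp (C * (2 / (n + 1))) - 1) +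
      Fintype.card κ * (((D n).R : ℝ) ^ (8 * formCount d) / (D n).M)) atTop (𝓝 0) := by
    have h2 : Tendsto (fun n : ℕ => C * (2 / ((n : ℝ) + 1))) atTop (𝓝 0) := by
      have := (tendsto_one_div_add_atTop_nhds_zero_nat (𝕜 := ℝ)).const_mul (C * 2)
      rw [mul_zero] at this
      exact this.congr fun n => by ring
    have h3 := (Real.continuous_exp.tendsto 0).comp h2
    rw [Real.exp_zero] at h3
    have h4 := (h3.sub_const 1).add (hR.const_mul (Fintype.card κ : ℝ))
    simpa using h4
  refine squeeze_zero (fun _ => dist_nonneg) (fun n => ?_) h1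
  rw [Real.dist_eq]
  refine (abs_ev_prod_sieveWeight_sub_one_le (W := (D n).W) (fun p => (D n).b (e p))
    (fun _ => prime_of_mem_sievePrimes) (D n).one_le_R
    (fun r hr h => not_dvd_of_mem_sievePrimes hr (Int.natCast_dvd_natCast.1 h)) hc hc0 hc1).trans ?_
  refine add_le_add (sub_le_sub_right ?_ 1) ?_
  · refine le_trans (le_of_eq (prod_congr rfl fun r _ => ?_))
      (prod_sievePrimes_le_exp (hW n) (D n).R (C := C) (by positivity))
    rw [hC]; ring
  · have hR1 : (1 : ℝ) ≤ (D n).R := by exact_mod_cast (D n).one_le_R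
    have hM := (D n).M_pos
    rw [mul_div_assoc]
    gcongr

lemma tendsto_total_div (hW : ∀ n p, p.Prime → p ≤ n → p ∣ (D n).W)
    (hR : Tendsto (fun n => ((D n).R : ℝ) ^ (8 * formCount d) / (D n).M) atTop (𝓝 0))
    (j : Fin d) : Tendsto (fun n => (D n).total j / (D n).M) atTop (𝓝 1) := by
  have hcard : Fintype.card Unit ≤ formCount d := by
    rw [formCount, Fintype.card_unit]
    exact Fintype.card_pos_iff.2 ⟨Sum.inl (j, true)⟩
  have h := tendsto_ev_forms hW hR (κ := Unit) (P := Unit) hcard (c := fun _ _ => 1) (by simp)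
    (by simp) (by simp) fun _ => j
  refine h.congr fun n => ?_
  simp only [ev, unif, univ_unique, prod_singleton, sum_singleton, one_mul, Fintype.card_fin,
    total]
  rw [sum_div]
  exact Fintype.sum_equiv (Equiv.funUnique Unit (Fin (D n).M)) _ _ fun x => by
    simp [Equiv.funUnique, div_eq_inv_mul]

end SieveData
end RelCorners

namespace RelCorners
open Finset Function Filter Topology

section Forms
variable {d : ℕ}

/-- The coefficients of the linear form giving the `j`-th coordinate from the sum and the other
coordinates. -/
def missingCoeff (j : Fin d) : Option (Fin d) → ℤ
  | none => 1
  | some l => if l = j then 0 else -1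

/-- The coefficients of the linear forms in two copies of the coordinates: the coordinates
themselves, and the missing coordinates for the mixed points. -/
def formCoeff : (Fin d × Bool) ⊕ (Fin d × Finset (Option (Fin d))) →
    Option (Fin d) ⊕ Option (Fin d) → ℤ
  | .inl (j, true), .inl i => if i = some j then 1 else 0
  | .inl (_, true), .inr _ => 0
  | .inl (_, false), .inl _ => 0
  | .inl (j, false), .inr i => if i = some j then 1 else 0
  | .inr (j, T), .inl i => if i ∈ T then 0 else missingCoeff j i
  | .inr (j, T), .inr i => if i ∈ T then missingCoeff j i else 0

lemma abs_missingCoeff_le (j : Fin d) (i : Option (Fin d)) : |missingCoeff j i| ≤ 1 := by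
  cases i with
  | none => simp [missingCoeff]
  | some l => simp only [missingCoeff]; split_ifs <;> simp

lemma missingCoeff_eq_zero {j : Fin d} {i : Option (Fin d)} :
    missingCoeff j i = 0 ↔ i = some j := by
  cases i with
  | none => simp [missingCoeff]
  | some l => simp [missingCoeff]

lemma abs_formCoeff_le (q : (Fin d × Bool) ⊕ (Fin d × Finset (Option (Fin d))))
    (k : Option (Fin d) ⊕ Option (Fin d)) : |formCoeff q k| ≤ 1 := by
  rcases q with ⟨j, _ | _⟩ | ⟨j, T⟩ <;> rcases k with i | i <;> simp only [formCoeff] <;>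
    (try split_ifs) <;> simp [abs_missingCoeff_le]

/-- The copy of the coordinate `i` selected by `T`. -/
def selected (T : Finset (Option (Fin d))) (i : Option (Fin d)) :
    Option (Fin d) ⊕ Option (Fin d) := if i ∈ T then .inr i else .inl i

lemma formCoeff_selected (j : Fin d) (T : Finset (Option (Fin d))) (i : Option (Fin d)) :
    formCoeff (.inr (j, T)) (selected T i) = missingCoeff j i := by
  unfold selected
  split_ifs with h <;> simp [formCoeff, h]

lemma formCoeff_inl_selected (j : Fin d) (β : Bool) (T : Finset (Option (Fin d)))
    {i : Option (Fin d)} (h : i ≠ some j) : formCoeff (.inl (j, β)) (selected T i) = 0 := by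
  unfold selected
  cases β <;> split_ifs <;> simp [formCoeff, h]

lemma exists_formCoeff_ne_zero (q : (Fin d × Bool) ⊕ (Fin d × Finset (Option (Fin d)))) :
    ∃ k, formCoeff q k ≠ 0 := by
  rcases q with ⟨j, _ | _⟩ | ⟨j, T⟩
  · exact ⟨.inr (some j), by simp [formCoeff]⟩
  · exact ⟨.inl (some j), by simp [formCoeff]⟩
  · exact ⟨selected T none, by simp [formCoeff_selected, missingCoeff]⟩

lemma formCoeff_inr_eq_zero_iff {j : Fin d} {T T' : Finset (Option (Fin d))}
    {j' : Fin d} {i : Option (Fin d)} (hij : i ≠ some j)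
    (h : ∀ k, formCoeff (.inr (j, T)) k = 0 ↔ formCoeff (.inr (j', T')) k = 0) :
    i ∈ T ↔ i ∈ T' := by
  have h1 := h (.inl i)
  have h2 := h (.inr i)
  have h3 := mt missingCoeff_eq_zero.1 hij
  by_cases hT : i ∈ T <;> by_cases hT' : i ∈ T' <;> simp_all [formCoeff]

lemma formCoeff_support_injective {q q' : (Fin d × Bool) ⊕ (Fin d × Finset (Option (Fin d)))}
    (hq : ∀ j T, q = .inr (j, T) → some j ∉ T) (hq' : ∀ j T, q' = .inr (j, T) → some j ∉ T)
    (h : ∀ k, formCoeff q k = 0 ↔ formCoeff q' k = 0) : q = q' := by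
  rcases q with ⟨j, β⟩ | ⟨j, T⟩ <;> rcases q' with ⟨j', β'⟩ | ⟨j', T'⟩
  · have h1 := h (.inl (some j))
    have h2 := h (.inr (some j))
    have h3 : j = j' ∧ β = β' := by cases β <;> cases β' <;> simp_all [formCoeff]
    rw [h3.1, h3.2]
  · have h1 := h (selected T' none)
    rw [formCoeff_inl_selected _ _ _ (by simp), formCoeff_selected] at h1
    simp [missingCoeff] at h1
  · have h1 := h (selected T none)
    rw [formCoeff_inl_selected _ _ _ (by simp), formCoeff_selected] at h1
    simp [missingCoeff] at h1
  · have hjj : j = j' := by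
      have h1 := h (selected T' (some j))
      rw [formCoeff_selected, missingCoeff_eq_zero] at h1
      have h2 : formCoeff (.inr (j, T)) (selected T' (some j)) = 0 := by
        unfold selected
        split_ifs <;> simp [formCoeff, missingCoeff]
      exact Option.some_injective _ (h1.1 h2)
    subst hjj
    have hTT : T = T' := by
      ext i
      rcases eq_or_ne i (some j) with rfl | hij
      · simp [hq j T rfl, hq' j T' rfl]
      · exact formCoeff_inr_eq_zero_iff hij h
    rw [hTT]

end Forms

namespace SieveData
variable {d : ℕ} (D : SieveData d)

lemma sum_formCoeff_inr (j : Fin d) (T : Finset (Option (Fin d)))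
    (z : Option (Fin d) ⊕ Option (Fin d) → Fin D.M) :
    ∑ k, formCoeff (.inr (j, T)) k * ((z k : ℕ) : ℤ) = D.missing j (mix z T) := by
  have h1 : ∀ i, formCoeff (.inr (j, T)) (.inl i) * ((z (.inl i) : ℕ) : ℤ) +
      formCoeff (.inr (j, T)) (.inr i) * ((z (.inr i) : ℕ) : ℤ) =
      missingCoeff j i * ((mix (α := Fin D.M) z T i : ℕ) : ℤ) := fun i => by
    by_cases hi : i ∈ T <;> simp [formCoeff, mix, hi]
  rw [Fintype.sum_sum_type, ← sum_add_distrib, sum_congr rfl fun i _ => h1 i, Fintype.sum_option,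
    missing, ← add_sum_erase univ _ (mem_univ j), sub_eq_add_neg, ← sum_neg_distrib]
  have h2 : ∀ l ∈ univ.erase j, missingCoeff j (some l) *
    ((mix (α := Fin D.M) z T (some l) : ℕ) : ℤ) =
      -((mix (α := Fin D.M) z T (some l) : ℕ) : ℤ) := fun l hl => by
    simp [missingCoeff, ne_of_mem_erase hl]
  rw [sum_congr rfl h2]
  simp [missingCoeff]

lemma sum_formCoeff_true (j : Fin d) (z : Option (Fin d) ⊕ Option (Fin d) → Fin D.M) :
    ∑ k, formCoeff (.inl (j, true)) k * ((z k : ℕ) : ℤ) = ((z (.inl (some j)) : ℕ) : ℤ) := by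
  simp [Fintype.sum_sum_type, formCoeff]

lemma sum_formCoeff_false (j : Fin d) (z : Option (Fin d) ⊕ Option (Fin d) → Fin D.M) :
    ∑ k, formCoeff (.inl (j, false)) k * ((z k : ℕ) : ℤ) = ((z (.inr (some j)) : ℕ) : ℤ) := by
  simp [Fintype.sum_sum_type, formCoeff]

lemma prod_measure (h : ∀ j, 0 < D.total j) (z : Option (Fin d) ⊕ Option (Fin d) → Fin D.M) :
    ∏ k, Sum.elim D.measure D.measure k (z k) =
      (∏ j, (D.M / D.total j) ^ 2) *
        ((∏ k, unif (Option (Fin d) ⊕ Option (Fin d)) (Fin D.M) k (z k)) *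
        ∏ q : Fin d × Bool, D.weight q.1 (∑ k, formCoeff (.inl q) k * ((z k : ℕ) : ℤ))) := by
  have hM := D.M_pos.ne'
  have h1 : ∀ j (y : ℤ), D.weight j y / D.total j =
      (D.M / D.total j) * ((1 / D.M) * D.weight j y) := fun j y => by
    have := (h j).ne'
    field_simp
  rw [Fintype.prod_sum_type, Fintype.prod_sum_type, Fintype.prod_option, Fintype.prod_option,
    Fintype.prod_option, Fintype.prod_option, Fintype.prod_prod_type]
  simp only [Sum.elim_inl, Sum.elim_inr, measure, unif, Fintype.prod_bool, sum_formCoeff_true,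
    sum_formCoeff_false, h1, prod_mul_distrib, Fintype.card_fin, prod_pow]
  ring

lemma prod_majorant (𝒮 : Finset (Option (Fin d) × Finset (Option (Fin d))))
    (z : Option (Fin d) ⊕ Option (Fin d) → Fin D.M) :
    ∏ p ∈ 𝒮, D.majorant p.1 (mix z p.2) =
      ∏ q : Fin d × Finset (Option (Fin d)) with (some q.1, q.2) ∈ 𝒮,
        D.weight q.1 (D.missing q.1 (mix z q.2)) := by
  rw [prod_filter, ← prod_ite_mem_eq 𝒮, Fintype.prod_prod_type, Fintype.prod_option,
    Fintype.prod_prod_type]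
  simp [majorant]

variable {D : ℕ → SieveData d}

theorem isPseudorandom (hW : ∀ n p, p.Prime → p ≤ n → p ∣ (D n).W)
    (hR : Tendsto (fun n => ((D n).R : ℝ) ^ (8 * formCount d) / (D n).M) atTop (𝓝 0))
    (htot : ∀ n j, 0 < (D n).total j) :
    IsPseudorandom atTop (fun n => (D n).measure) fun n => (D n).majorant where
  weight n := (D n).isWeight_measure (htot n)
  nonneg n i x := (D n).majorant_nonneg i x
  free n i := (D n).free_majorant i
  tendsto 𝒮 h𝒮 := by
    classical
    let Q : Finset ((Fin d × Bool) ⊕ (Fin d × Finset (Option (Fin d)))) :=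
      univ.disjSum ({q | (some q.1, q.2) ∈ 𝒮} : Finset (Fin d × Finset (Option (Fin d))))
    have hQ : ∀ q ∈ Q, ∀ j T, q = .inr (j, T) → some j ∉ T := by
      rintro q hq j T rfl
      have h1 : (some j, T) ∈ 𝒮 := by simpa [Q] using hq
      exact h𝒮 _ h1
    have h1 := tendsto_ev_forms hW hR (κ := Option (Fin d) ⊕ Option (Fin d)) (P := Q)
      (Fintype.card_subtype_le _) (c := fun p => formCoeff p.1) (fun p => abs_formCoeff_le _)
      (fun p => exists_formCoeff_ne_zero _)
      (fun p p' hpp => by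
        by_contra! h
        exact hpp (Subtype.ext (formCoeff_support_injective (hQ _ p.2) (hQ _ p'.2) h)))
      fun p => Sum.elim Prod.fst Prod.fst p.1
    have h2 : Tendsto (fun n => ∏ j, ((D n).M / (D n).total j) ^ 2) atTop (𝓝 1) := by
      rw [← prod_const_one (s := (univ : Finset (Fin d)))]
      refine tendsto_finsetProd _ fun j _ => ?_
      have := ((tendsto_total_div hW hR j).inv₀ one_ne_zero).pow 2
      simpa using this
    have h3 := h2.mul h1
    rw [one_mul] at h3
    refine h3.congr fun n => ?_
    rw [ev₂, ev, ev, mul_sum]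
    refine sum_congr rfl fun z _ => ?_
    rw [prod_measure _ (htot n), prod_majorant,
      prod_coe_sort Q fun q => (D n).weight (Sum.elim Prod.fst Prod.fst q)
        (∑ k, formCoeff q k * ((z k : ℕ) : ℤ)), prod_disjSum]
    simp only [Sum.elim_inl, Sum.elim_inr, sum_formCoeff_inr]
    ring

end SieveData
end RelCorners

namespace RelCorners
open Finset Function Filter Topology

lemma quarter_le_primeCount_mul_log {N : ℕ} (hN : 10 ≤ N) :
    (N : ℝ) / 4 ≤ primeCount N * Real.log N := by
  have hN' : (10 : ℝ) ≤ N := by exact_mod_cast hN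
  have h1 : primeCount N = Nat.primeCounting N := by
    rw [Nat.primeCounting, Nat.primeCounting', Nat.count_eq_card_filter_range, primeCount]
    congr 1
    ext p
    simp only [mem_filter, mem_Icc, Finset.mem_range]
    exact ⟨fun h => ⟨by omega, h.2⟩, fun h => ⟨⟨h.2.one_le, by omega⟩, h.2⟩⟩
  have h2 := Chebyshev.pi_ge N
  rw [div_le_iff₀ (Real.log_pos (by linarith)), ← h1] at h2
  have h3 : Real.log ((N + 1) / 2 ^ 3) ≤ (N + 1) / 2 ^ 3 - 1 :=
    Real.log_le_sub_one_of_pos (by positivity)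
  rw [Real.log_div (by positivity) (by positivity), Real.log_pow] at h3
  have h4 := Real.log_two_gt_d9
  have h5 := Real.log_two_lt_d9
  push_cast at h3
  nlinarith

lemma exists_level {K : ℕ} (hK : 1 ≤ K) (R₀ : ℕ) :
    ∀ᶠ N : ℕ in atTop, ∃ R : ℕ, R₀ ≤ R ∧ R ^ K ≤ N ∧ Real.log N ≤ 2 * K * Real.log R := by
  filter_upwards [eventually_ge_atTop ((R₀ + 2) ^ K)] with N hN
  have h0 : R₀ + 2 ≤ N := (Nat.le_self_pow (by omega) _).trans hN
  obtain ⟨R, hR⟩ : ∃ R, R = Nat.findGreatest (fun r => r ^ K ≤ N) N := ⟨_, rfl⟩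
  have h1 : R₀ + 2 ≤ R := hR ▸ Nat.le_findGreatest h0 hN
  have h2 : R ^ K ≤ N := by
    rw [hR]; exact Nat.findGreatest_spec (P := fun r => r ^ K ≤ N) h0 hN
  have h3 : N < (R + 1) ^ K := by
    by_contra! h
    have := Nat.le_findGreatest (P := fun r => r ^ K ≤ N)
      ((Nat.le_self_pow (by omega) _).trans h) h
    omega
  refine ⟨R, by omega, h2, ?_⟩
  have h4 : N ≤ R ^ (2 * K) := by
    rw [pow_mul]
    exact h3.le.trans (Nat.pow_le_pow_left (by nlinarith) K)
  have h5 : Real.log N ≤ Real.log ((R : ℝ) ^ (2 * K)) :=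
    Real.log_le_log (by exact_mod_cast (by omega : 0 < N)) (by exact_mod_cast h4)
  rw [Real.log_pow] at h5
  push_cast at h5
  exact h5

section Counting
variable {d : ℕ} {A : Set (Fin d → ℤ)}

/-- The points of `A` in the box `[1,N]^d` all of whose coordinates exceed `R`. -/
noncomputable def largePoints (A : Set (Fin d → ℤ)) (R N : ℕ) : Finset (Fin d → ℕ) :=
  open Classical in
  (Fintype.piFinset fun _ => (Icc 1 N).filter Nat.Prime).filter fun x =>
    (fun i => ((x i : ℕ) : ℤ)) ∈ A ∧ ∀ i, R < x i

lemma ncard_le_card_largePoints_add (hA : ∀ x ∈ A, ∀ i, 0 < x i ∧ Prime (x i)) (R N : ℕ) :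
    (A ∩ {x | ∀ i, 1 ≤ x i ∧ x i ≤ (N : ℤ)}).ncard ≤
      #(largePoints A R N) + d * (R * primeCount N ^ (d - 1)) := by
  classical
  let 𝓠 := (Icc 1 N).filter Nat.Prime
  let small : Fin d → Finset (Fin d → ℕ) := fun i =>
    Fintype.piFinset (update (fun _ => 𝓠) i (Icc 1 R))
  have hsub : A ∩ {x | ∀ i, 1 ≤ x i ∧ x i ≤ (N : ℤ)} ⊆
      ((largePoints A R N ∪ univ.biUnion small).image fun x i => ((x i : ℕ) : ℤ) :
        Finset (Fin d → ℤ)) := by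
    rintro x ⟨hxA, hx⟩
    have hcast : (fun i => (((x i).toNat : ℕ) : ℤ)) = x :=
      funext fun i => Int.toNat_of_nonneg (hA x hxA i).1.le
    rw [mem_coe, mem_image]
    refine ⟨fun i => (x i).toNat, ?_, hcast⟩
    have hmem : ∀ i, (x i).toNat ∈ 𝓠 := fun i => by
      have h1 := hx i
      have h2 : ((x i).toNat : ℤ) = x i := congrFun hcast i
      refine mem_filter.2 ⟨mem_Icc.2 ⟨by omega, by omega⟩, ?_⟩
      rw [Nat.prime_iff_prime_int, h2]
      exact (hA x hxA i).2
    rw [mem_union]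
    by_cases hR : ∀ i, R < (x i).toNat
    · exact Or.inl (mem_filter.2 ⟨Fintype.mem_piFinset.2 hmem, by rw [hcast]; exact hxA, hR⟩)
    · push Not at hR
      obtain ⟨i, hi⟩ := hR
      refine Or.inr (mem_biUnion.2 ⟨i, mem_univ _, Fintype.mem_piFinset.2 fun l => ?_⟩)
      rcases eq_or_ne l i with rfl | hl
      · rw [update_self]
        exact mem_Icc.2 ⟨(mem_Icc.1 (mem_filter.1 (hmem l)).1).1, hi⟩
      · rw [update_of_ne hl]
        exact hmem l
  have hsmall : ∀ i, #(small i) = R * primeCount N ^ (d - 1) := fun i => by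
    rw [Fintype.card_piFinset, ← mul_prod_erase univ _ (mem_univ i), update_self, Nat.card_Icc,
      prod_congr rfl fun l hl => by rw [update_of_ne (ne_of_mem_erase hl)], prod_const,
      card_erase_of_mem (mem_univ i), card_univ, Fintype.card_fin]
    rfl
  calc _ ≤ _ := Set.ncard_le_ncard hsub (Finset.finite_toSet _)
    _ ≤ _ := by
      rw [Set.ncard_coe_finset]
      refine card_image_le.trans ((card_union_le _ _).trans (Nat.add_le_add_left ?_ _))
      refine card_biUnion_le.trans (le_of_eq ?_)
      rw [sum_congr rfl fun i _ => hsmall i, sum_const, card_univ, Fintype.card_fin, smul_eq_mul]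

lemma exists_residue_class {R N W : ℕ} (hW : 0 < W) (hWR : W ≤ R) :
    ∃ b : Fin d → ℕ, ∃ X : Finset (Fin d → ℕ), (∀ m ∈ X, ∀ i, m i ≤ N / W) ∧
      (∀ m ∈ X, (fun i => ((W * m i + b i : ℕ) : ℤ)) ∈ A) ∧
      (∀ m ∈ X, ∀ i, (W * m i + b i).Prime ∧ R < W * m i + b i) ∧
      (#(largePoints A R N) : ℝ) ≤ W.totient ^ d * #X := by
  classical
  let C : Finset (Fin d → ℕ) := Fintype.piFinset fun _ => (range W).filter W.Coprime
  have hL : ∀ x ∈ largePoints A R N, (∀ i, x i ≤ N ∧ (x i).Prime ∧ R < x i) ∧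
      (fun i => ((x i : ℕ) : ℤ)) ∈ A := fun x hx => by
    have h := mem_filter.1 hx
    refine ⟨fun i => ?_, h.2.1⟩
    have h1 := mem_filter.1 (Fintype.mem_piFinset.1 h.1 i)
    exact ⟨(mem_Icc.1 h1.1).2, h1.2, h.2.2 i⟩
  have hmaps : ∀ x ∈ largePoints A R N, (fun i => x i % W) ∈ C := fun x hx => by
    refine Fintype.mem_piFinset.2 fun i => mem_filter.2 ⟨mem_range.2 (Nat.mod_lt _ hW), ?_⟩
    obtain ⟨_, h2, h3⟩ := (hL x hx).1 i
    have h4 : (x i).Coprime W := by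
      rw [h2.coprime_iff_not_dvd]
      exact fun h => absurd (Nat.le_of_dvd hW h) (by omega)
    rw [Nat.Coprime, Nat.gcd_comm, ← Nat.gcd_rec, Nat.gcd_comm]
    exact h4
  have hC : #C = W.totient ^ d := by
    rw [Fintype.card_piFinset, prod_const, card_univ, Fintype.card_fin]
    rfl
  have hφ : (0 : ℝ) < (W.totient : ℝ) ^ d := by
    have := Nat.totient_pos.2 hW
    positivity
  have hCne : C.Nonempty := by
    rw [← card_pos, hC]
    exact pow_pos (Nat.totient_pos.2 hW) d
  obtain ⟨b, -, hb⟩ := exists_le_card_fiber_of_nsmul_le_card_of_maps_to (M := ℝ)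
    (b := #(largePoints A R N) / (W.totient : ℝ) ^ d) hmaps hCne (by
      rw [hC, nsmul_eq_mul]
      push_cast
      rw [mul_div_cancel₀ _ hφ.ne'])
  have hinj : Set.InjOn (fun (x : Fin d → ℕ) i => x i / W)
      ({x ∈ largePoints A R N | (fun i => x i % W) = b} : Finset _) := fun x hx y hy hxy => by
    have h1 := (mem_filter.1 (mem_coe.1 hx)).2
    have h2 := (mem_filter.1 (mem_coe.1 hy)).2
    funext i
    have h3 : x i / W = y i / W := congrFun hxy i
    rw [← Nat.div_add_mod (x i) W, ← Nat.div_add_mod (y i) W, h3, congrFun h1 i, congrFun h2 i]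
  let X := ({x ∈ largePoints A R N | (fun i => x i % W) = b} : Finset _).image
    fun (x : Fin d → ℕ) i => x i / W
  have hform : ∀ m ∈ X, ∃ x ∈ largePoints A R N, (fun i => x i / W) = m ∧
        (fun i => W * m i + b i) = x := fun m hm => by
    obtain ⟨x, hx, rfl⟩ := mem_image.1 hm
    obtain ⟨h1, h2⟩ := mem_filter.1 hx
    refine ⟨x, h1, rfl, funext fun i => ?_⟩
    rw [← congrFun h2 i, Nat.div_add_mod]
  refine ⟨b, X, fun m hm i => ?_, fun m hm => ?_, fun m hm i => ?_, ?_⟩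
  rotate_left 3
  · rw [card_image_of_injOn hinj, mul_comm]
    exact (div_le_iff₀ hφ).1 hb
  all_goals obtain ⟨x, hx, h1, h2⟩ := hform m hm
  · rw [← h1]
    exact Nat.div_le_div_right ((hL x hx).1 i).1
  · simp only [congrFun h2]
    exact (hL x hx).2
  · rw [congrFun h2 i]
    exact ((hL x hx).1 i).2

end Counting
end RelCorners

namespace RelCorners
open Finset Function Filter Topology

variable {d : ℕ} {A : Set (Fin d → ℤ)}

namespace SieveData

/-- The mass of the sieve of level `R` over the primes not dividing `W`. -/
noncomputable def mass (D : SieveData d) : ℝ := sieveMass (sievePrimes D.W D.R) D.R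

/-- The points `m` of `X` index, through the progressions of `D`, points of `A` with coordinates
larger than `n` and free of the primes of the sieve. -/
structure Indexes (D : SieveData d) (A : Set (Fin d → ℤ)) (n : ℕ) (X : Finset (Fin d → ℕ)) :
    Prop where
  dvd_W : ∀ p, p.Prime → p ≤ n → p ∣ D.W
  W_pos : 0 < D.W
  level : (D.R : ℝ) ^ (8 * formCount d) / D.M ≤ 1 / ((n : ℝ) + 1)
  bound : ∀ m ∈ X, ∀ i, (d + 1) * (m i + 1) ≤ D.M
  mem : ∀ m ∈ X, (fun i => (D.W : ℤ) * m i + D.b i) ∈ A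
  not_dvd : ∀ m ∈ X, ∀ i, ∀ r ∈ sievePrimes D.W D.R, ¬ (r : ℤ) ∣ D.W * m i + D.b i
  lt : ∀ m ∈ X, ∀ i, (n : ℤ) < D.W * m i + D.b i

end SieveData

lemma frequently_mul_primeCount_pow_lt (hdens : 0 < relUpperDensity d A) :
    ∃ δ > 0, ∃ᶠ N : ℕ in atTop, 10 ≤ N ∧ δ * (primeCount N : ℝ) ^ d <
      (A ∩ {x | ∀ i, 1 ≤ x i ∧ x i ≤ (N : ℤ)}).ncard := by
  refine ⟨relUpperDensity d A / 2, half_pos hdens, ?_⟩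
  have h1 : ∃ᶠ N : ℕ in atTop, relUpperDensity d A / 2 <
      ((A ∩ {x | ∀ i, 1 ≤ x i ∧ x i ≤ (N : ℤ)}).ncard : ℝ) / (primeCount N : ℝ) ^ d :=
    frequently_lt_of_lt_limsup (isCoboundedUnder_le_of_le (x := 0) _ fun N => by positivity)
      (half_lt_self hdens)
  refine (h1.and_eventually (eventually_ge_atTop 10)).mono fun N h => ⟨h.2, ?_⟩
  have h2 : (0 : ℝ) < primeCount N := by
    have h3 : (0 : ℕ) < primeCount N :=
      card_pos.2 ⟨2, mem_filter.2 ⟨mem_Icc.2 ⟨by norm_num, by omega⟩, Nat.prime_two⟩⟩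
    exact_mod_cast h3
  exact (lt_div_iff₀ (pow_pos h2 d)).1 h.1

lemma one_le_formCount (hd : 1 ≤ d) : 1 ≤ formCount d :=
  Fintype.card_pos_iff.2 ⟨Sum.inl (⟨0, hd⟩, true)⟩

lemma exists_indexes (hd : 1 ≤ d) (hA : ∀ x ∈ A, ∀ i, 0 < x i ∧ Prime (x i))
    (hdens : 0 < relUpperDensity d A) :
    ∃ η > 0, ∀ n, ∃ (D : SieveData d) (X : Finset (Fin d → ℕ)), D.Indexes A n X ∧
      η ≤ #X * (D.mass / D.M) ^ d := by
  obtain ⟨δ, hδ, hfreq⟩ := frequently_mul_primeCount_pow_lt hdens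
  obtain ⟨E, hE⟩ : ∃ E, E = 8 * formCount d := ⟨_, rfl⟩
  have hE8 : 8 ≤ E := by have := one_le_formCount hd; omega
  obtain ⟨K, hK⟩ : ∃ K, K = 2 * E := ⟨_, rfl⟩
  have hK0 : (0 : ℝ) < K := by exact_mod_cast (by omega : 0 < K)
  have hd0 : (0 : ℝ) < d := by exact_mod_cast hd
  refine ⟨δ / 2 * (1 / (16 * K * (d + 1))) ^ d, by positivity, fun n => ?_⟩
  obtain ⟨W, hWdef⟩ : ∃ W, W = primorial n := ⟨_, rfl⟩
  have hW : 0 < W := hWdef ▸ primorial_pos n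
  obtain ⟨B, hB⟩ := exists_nat_ge (16 * K * d / δ)
  obtain ⟨N, ⟨hN10, hN⟩, R, hR₀, hRN, hlog⟩ :=
    (hfreq.and_eventually (exists_level (K := K) (by omega) (10 + W * (n + 1) + B))).exists
  have hWn : W * (n + 1) ≤ R := by omega
  have hWR : W ≤ R := (Nat.le_mul_of_pos_right W n.succ_pos).trans hWn
  have hnR : n ≤ R := by nlinarith
  obtain ⟨b, X, hX1, hX2, hX3, hX4⟩ := exists_residue_class (A := A) (N := N) hW hWR
  have hR0 : (0 : ℝ) < R := by exact_mod_cast (by omega : 0 < R)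
  have hR1 : (1 : ℝ) ≤ R := by exact_mod_cast (by omega : 1 ≤ R)
  have hN0 : (0 : ℝ) < N := by exact_mod_cast (by omega : 0 < N)
  have hRN' : (R : ℝ) ^ K ≤ N := by exact_mod_cast hRN
  have hBR : 16 * K * d / δ ≤ R := hB.trans (by exact_mod_cast (by omega : B ≤ R))
  have hW0 : (0 : ℝ) < W := by exact_mod_cast hW
  have hφ : (0 : ℝ) < W.totient := by exact_mod_cast Nat.totient_pos.2 hW
  have hlogR : 0 < Real.log R := Real.log_pos (by exact_mod_cast (by omega : 1 < R))
  obtain ⟨p, hp⟩ : ∃ p : ℝ, p = primeCount N := ⟨_, rfl⟩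
  have hp0 : 0 ≤ p := hp ▸ Nat.cast_nonneg _
  have hpR : (N : ℝ) ≤ 8 * K * (p * Real.log R) := by
    have h1 := quarter_le_primeCount_mul_log hN10
    rw [← hp] at h1
    have h2 := mul_le_mul_of_nonneg_left hlog hp0
    linarith
  have hsmall : d * R ≤ δ / 2 * p := by
    have h1 : (R : ℝ) ^ 3 ≤ N := (pow_le_pow_right₀ hR1 (by omega)).trans hRN'
    have h2 : Real.log R ≤ R := (Real.log_le_sub_one_of_pos hR0).trans (by linarith)
    have h3 : (R : ℝ) ^ 3 ≤ 8 * K * (p * R) :=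
      h1.trans (hpR.trans (by gcongr))
    have h4 : (R : ℝ) ^ 2 ≤ 8 * K * p := by
      refine le_of_mul_le_mul_right ?_ hR0
      linarith
    rw [div_le_iff₀ hδ] at hBR
    have h5 : 16 * K * d * R ≤ δ * (8 * K * p) := by
      calc 16 * K * d * R ≤ R * δ * R := mul_le_mul_of_nonneg_right hBR hR0.le
        _ = δ * (R : ℝ) ^ 2 := by ring
        _ ≤ _ := mul_le_mul_of_nonneg_left h4 hδ.le
    refine le_of_mul_le_mul_left ?_ (by positivity : (0 : ℝ) < 16 * K)
    linarith
  have hcount : δ / 2 * p ^ d ≤ W.totient ^ d * #X := by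
    have h1 : ((A ∩ {x | ∀ i, 1 ≤ x i ∧ x i ≤ (N : ℤ)}).ncard : ℝ) ≤
        #(largePoints A R N) + d * (R * p ^ (d - 1)) := by
      rw [hp]
      exact_mod_cast ncard_le_card_largePoints_add hA R N
    rw [← hp] at hN
    have h2 : d * (R * p ^ (d - 1)) ≤ δ / 2 * p ^ d := by
      rw [← mul_assoc, ← Nat.sub_add_cancel hd, pow_succ', Nat.sub_add_cancel hd, ← mul_assoc]
      exact mul_le_mul_of_nonneg_right hsmall (by positivity)
    linarith
  let D : SieveData d := ⟨W, R, (d + 1) * (N / W + 1), fun i => b i, by omega, ⟨by positivity⟩⟩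
  have hNM : N ≤ W * D.M := by
    have h1 := Nat.lt_mul_div_succ N hW
    have h2 : W * (N / W + 1) ≤ W * ((d + 1) * (N / W + 1)) :=
      Nat.mul_le_mul_left W (Nat.le_mul_of_pos_left _ d.succ_pos)
    exact h1.le.trans h2
  have hMN : (W : ℝ) * D.M ≤ 2 * (d + 1) * N := by
    have h1 : W * (N / W) ≤ N := Nat.mul_div_le N W
    have h2 : W ≤ N := hWR.trans ((Nat.le_self_pow (by omega) R).trans hRN)
    have h3 : W * D.M ≤ 2 * (d + 1) * N := by
      calc W * ((d + 1) * (N / W + 1)) = (d + 1) * (W * (N / W) + W) := by ring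
        _ ≤ (d + 1) * (N + N) := by gcongr
        _ = _ := by ring
    exact_mod_cast h3
  have hM := D.M_pos
  have hmass : W.totient / W * Real.log R ≤ D.mass := totient_div_mul_log_le_sieveMass hW.ne'
  refine ⟨D, X, ⟨fun q hq hqn => ?_, hW, ?_, fun m hm i => ?_, fun m hm => ?_,
    fun m hm i r hr h => ?_, fun m hm i => ?_⟩, ?_⟩
  · change q ∣ W
    rw [hWdef]
    exact hq.dvd_primorial_iff.2 hqn
  · rw [div_le_div_iff₀ hM (by positivity), ← hE, one_mul]
    have h1 : (W : ℝ) * (n + 1) ≤ R := by exact_mod_cast hWn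
    have h2 : (R : ℝ) ≤ R ^ E := le_self_pow₀ hR1 (by omega)
    have h3 : (N : ℝ) ≤ W * D.M := by exact_mod_cast hNM
    have h4 : (R : ℝ) ^ E * R ^ E ≤ N := by rw [← pow_add, ← two_mul, ← hK]; exact hRN'
    refine le_of_mul_le_mul_left ?_ hW0
    calc (W : ℝ) * (R ^ E * (n + 1)) = R ^ E * (W * (n + 1)) := by ring
      _ ≤ R ^ E * R ^ E := by gcongr; exact h1.trans h2
      _ ≤ _ := h4.trans h3
  · exact Nat.mul_le_mul_left _ (Nat.succ_le_succ (hX1 m hm i))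
  · have := hX2 m hm
    push_cast at this
    exact this
  · obtain ⟨h1, h2⟩ := hX3 m hm i
    have h3 : r ∣ W * m i + b i := by
      rw [← Int.natCast_dvd_natCast]
      push_cast
      exact h
    have h4 := (Nat.prime_dvd_prime_iff_eq (prime_of_mem_sievePrimes hr) h1).1 h3
    have h5 : r ≤ R := le_of_mem_sievePrimes hr
    omega
  · have h2 : n < W * m i + b i := hnR.trans_lt (hX3 m hm i).2
    have h3 : (n : ℤ) < (W * m i + b i : ℕ) := by exact_mod_cast h2
    push_cast at h3
    exact h3
  · have h1 : 1 / (16 * K * (d + 1)) ≤ p / W.totient * (D.mass / D.M) := by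
      calc (1 : ℝ) / (16 * K * (d + 1)) ≤ p * Real.log R / (W * D.M) := by
            rw [div_le_div_iff₀ (by positivity) (by positivity), one_mul]
            calc (W : ℝ) * D.M ≤ 2 * (d + 1) * N := hMN
              _ ≤ 2 * (d + 1) * (8 * K * (p * Real.log R)) := by gcongr
              _ = _ := by ring
        _ = p / W.totient * (W.totient / W * Real.log R / D.M) := by field_simp
        _ ≤ _ := by gcongr
    have h2 : δ / 2 * (p / W.totient) ^ d ≤ #X := by
      rw [div_pow, ← mul_div_assoc, div_le_iff₀ (by positivity), mul_comm (#X : ℝ)]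
      exact hcount
    have hm0 : 0 ≤ D.mass / D.M :=
      div_nonneg (le_trans (by positivity) hmass) hM.le
    calc δ / 2 * (1 / (16 * K * (d + 1))) ^ d ≤ δ / 2 * (p / W.totient * (D.mass / D.M)) ^ d := by
          gcongr
      _ = δ / 2 * (p / W.totient) ^ d * (D.mass / D.M) ^ d := by rw [mul_pow]; ring
      _ ≤ _ := mul_le_mul_of_nonneg_right h2 (pow_nonneg hm0 d)

end RelCorners

namespace RelCorners
open Finset Function Filter Topology

lemma IsWeight.sum_prod_erase_mul_le_ev {κ α : Type*} [Fintype κ] [DecidableEq κ] [Fintype α]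
    {w : κ → α → ℝ} (hw : IsWeight w) {k : κ} {f : (κ → α) → ℝ} (hf : Free κ α k f)
    (hf0 : ∀ x, 0 ≤ f x) {Y : Finset (κ → α)}
    (hY : ∀ y ∈ Y, ∀ y' ∈ Y, (∀ l, l ≠ k → y l = y' l) → y = y') :
    ∑ y ∈ Y, (∏ l ∈ univ.erase k, w l (y l)) * f y ≤ ev w f := by
  have h1 : ∀ (y : κ → α) a, (∏ l, w l (update y k a l)) * f (update y k a) =
      w k a * ((∏ l ∈ univ.erase k, w l (y l)) * f y) := fun y a => by
    rw [hf y a, ← mul_prod_erase univ _ (mem_univ k), update_self, mul_assoc,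
      prod_congr rfl fun l hl => by rw [update_of_ne (ne_of_mem_erase hl)]]
  have h2 : ∀ y, (∏ l ∈ univ.erase k, w l (y l)) * f y =
      ∑ a, (∏ l, w l (update y k a l)) * f (update y k a) := fun y => by
    simp only [h1]
    rw [← sum_mul, hw.sum_eq_one, one_mul]
  rw [sum_congr rfl fun y _ => h2 y, ← sum_product']
  refine sum_le_sum_of_injOn (fun p => update p.1 k p.2) (fun _ _ => mem_univ _) ?_
    (fun x _ => mul_nonneg (hw.prod_nonneg x) (hf0 x)) fun _ _ => le_rfl
  rintro ⟨y, a⟩ hy ⟨y', a'⟩ hy' h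
  have h3 : a = a' := by simpa using congrFun h k
  have h4 : y = y' := hY y (mem_product.1 (mem_coe.1 hy)).1 y' (mem_product.1 (mem_coe.1 hy')).1
    fun l hl => by simpa [hl] using congrFun h l
  rw [h3, h4]

namespace SieveData
variable {d : ℕ} (D : SieveData d) (X : Finset (Fin d → ℕ))

/-- The sets of points whose coordinates, with the one of index `i` recovered from the others, lie
in `X`. -/
def pointSet : Option (Fin d) → Set (Option (Fin d) → Fin D.M)
  | none => {x | (fun l => (x (some l) : ℕ)) ∈ X}
  | some j => {x | ∃ m ∈ X, (∀ l, l ≠ j → m l = x (some l)) ∧ (m j : ℤ) = D.missing j x}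

/-- The point with coordinates `m` and their sum. -/
def point (m : Fin d → ℕ) : Option (Fin d) → Fin D.M
  | none => Fin.ofNat D.M (∑ l, m l)
  | some l => Fin.ofNat D.M (m l)

lemma free_pointSet (i : Option (Fin d)) : Free _ _ i (· ∈ D.pointSet X i) := fun x a => by
  cases i with
  | none => simp [pointSet]
  | some j =>
    simp only [pointSet, Set.mem_ofPred_eq, D.free_missing j x a]
    refine propext (exists_congr fun m => and_congr_right fun _ => and_congr_left fun _ =>
      forall₂_congr fun l hl => ?_)
    rw [update_of_ne fun h => hl (Option.some_injective _ h)]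

variable {D X} {A : Set (Fin d → ℤ)} {n : ℕ} (h : D.Indexes A n X)
include h

namespace Indexes

lemma apply_lt {m : Fin d → ℕ} (hm : m ∈ X) (i : Fin d) : m i < D.M :=
  ((Nat.lt_succ_self _).trans_le (Nat.le_mul_of_pos_left _ d.succ_pos)).trans_le (h.bound m hm i)

lemma sum_lt {m : Fin d → ℕ} (hm : m ∈ X) : ∑ i, m i < D.M := by
  have h1 : ∑ i, (d + 1) * m i ≤ ∑ _i : Fin d, D.M :=
    sum_le_sum fun i _ => (Nat.mul_le_mul_left _ (Nat.le_succ _)).trans (h.bound m hm i)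
  rw [← mul_sum, sum_const, card_univ, Fintype.card_fin, smul_eq_mul] at h1
  have h2 : 0 < D.M := Nat.pos_of_ne_zero (NeZero.ne _)
  by_contra! h3
  nlinarith [Nat.mul_le_mul_left (d + 1) h3]

lemma point_none {m : Fin d → ℕ} (hm : m ∈ X) : (D.point m none : ℕ) = ∑ i, m i :=
  Nat.mod_eq_of_lt (h.sum_lt hm)

lemma point_some {m : Fin d → ℕ} (hm : m ∈ X) (i : Fin d) : (D.point m (some i) : ℕ) = m i :=
  Nat.mod_eq_of_lt (h.apply_lt hm i)

lemma missing_point {m : Fin d → ℕ} (hm : m ∈ X) (j : Fin d) : D.missing j (D.point m) = m j := by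
  simp only [missing, h.point_none hm, h.point_some hm]
  rw [← add_sum_erase univ _ (mem_univ j)]
  push_cast
  ring

lemma point_mem {m : Fin d → ℕ} (hm : m ∈ X) (i : Option (Fin d)) :
    D.point m ∈ D.pointSet X i := by
  cases i with
  | none =>
    simp only [pointSet, Set.mem_ofPred_eq, h.point_some hm]
    exact hm
  | some j => exact ⟨m, hm, fun l _ => (h.point_some hm l).symm, (h.missing_point hm j).symm⟩

lemma eq_of_point_eq {m m' : Fin d → ℕ} (hm : m ∈ X) (hm' : m' ∈ X) {i : Option (Fin d)}
    (he : ∀ l, l ≠ i → D.point m l = D.point m' l) : m = m' := by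
  have h1 : ∀ l, some l ≠ i → m l = m' l := fun l hl => by
    rw [← h.point_some hm, ← h.point_some hm', he _ hl]
  cases i with
  | none => exact funext fun l => h1 l (by simp)
  | some j =>
    have h2 : ∑ i, m i = ∑ i, m' i := by
      rw [← h.point_none hm, ← h.point_none hm', he none (by simp)]
    have h3 : ∑ l ∈ univ.erase j, m l = ∑ l ∈ univ.erase j, m' l := sum_congr rfl fun l hl =>
      h1 l fun h3 => ne_of_mem_erase hl (Option.some_injective _ h3)
    rw [← add_sum_erase univ _ (mem_univ j), ← add_sum_erase univ m' (mem_univ j), h3] at h2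
    have h4 : m j = m' j := Nat.add_right_cancel h2
    funext l
    rcases eq_or_ne l j with rfl | hl
    · exact h4
    · exact h1 l fun h3 => hl (Option.some_injective _ h3)

lemma weight_eq {m : Fin d → ℕ} (hm : m ∈ X) (i : Fin d) : D.weight i (m i) = D.mass :=
  sieveWeight_of_not_dvd fun r hr => h.not_dvd m hm i r hr

omit h in
lemma mass_pos (D : SieveData d) : 0 < D.mass :=
  one_pos.trans_le (one_le_sieveMass (fun _ => prime_of_mem_sievePrimes) D.one_le_R)

lemma total_pos (hX : X.Nonempty) (j : Fin d) : 0 < D.total j := by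
  obtain ⟨m, hm⟩ := hX
  have h1 := single_le_sum (f := fun a : Fin D.M => D.weight j ((a : ℕ) : ℤ))
    (fun a _ => D.weight_nonneg j _) (mem_univ ⟨m j, h.apply_lt hm j⟩)
  simp only [h.weight_eq hm j] at h1
  exact (mass_pos D).trans_le h1

/-- A point in all the sets gives a corner. -/
lemma exists_corner {x : Option (Fin d) → Fin D.M} (hx : x ∈ ⋂ i, D.pointSet X i) :
    ∃ y ∈ A, (∀ i, (n : ℤ) < y i) ∧ ∀ i,
      (fun j => y j + if j = i then (D.W : ℤ) * ((x none : ℕ) - ∑ l, ((x (some l) : ℕ) : ℤ)) else 0)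
        ∈ A := by
  have h1 := Set.mem_iInter.1 hx
  have h2 : (fun l => (x (some l) : ℕ)) ∈ X := h1 none
  refine ⟨_, h.mem _ h2, h.lt _ h2, fun i => ?_⟩
  obtain ⟨m, hm, hml, hmi⟩ := h1 (some i)
  convert h.mem m hm using 1
  funext j
  rcases eq_or_ne j i with rfl | hji
  · rw [if_pos rfl, hmi, missing, ← add_sum_erase univ _ (mem_univ j)]
    ring
  · rw [if_neg hji, hml j hji, add_zero]

omit h in
lemma ev_le_of_subset_diagonal (htot : ∀ j, 0 < D.total j)
    {S : Set (Option (Fin d) → Fin D.M)}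
    (hS : ∀ x ∈ S, ((x none : ℕ) : ℤ) = ∑ l, ((x (some l) : ℕ) : ℤ)) :
    (ev D.measure fun x => S.indicator 1 x * ∏ j, D.majorant j x) ≤
      (D.R : ℝ) ^ (2 * d) / D.M := by
  have hw := D.isWeight_measure htot
  have h1 : ∀ x, ∏ j, D.majorant j x ≤ (D.R : ℝ) ^ (2 * d) := fun x => by
    rw [Fintype.prod_option]
    simp only [majorant, one_mul]
    calc ∏ j, D.weight j (D.missing j x) ≤ ∏ _j : Fin d, (D.R : ℝ) ^ 2 :=
          prod_le_prod (fun j _ => D.weight_nonneg _ _) fun j _ => D.weight_le _ _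
      _ = _ := by rw [prod_const, card_univ, Fintype.card_fin, pow_mul]
  have h2 : ∀ x, avg D.measure none (fun x => S.indicator 1 x * ∏ j, D.majorant j x) x ≤
      (D.R : ℝ) ^ (2 * d) / D.M := fun x => by
    classical
    have h3 : ∀ a, update x none a ∈ S → a = Fin.ofNat D.M (∑ l, (x (some l) : ℕ)) := fun a ha => by
      have h4 := hS _ ha
      simp only [update_self] at h4
      have h5 : (a : ℕ) = ∑ l, (x (some l) : ℕ) := by
        zify
        rw [h4]
        simp
      rw [← h5]
      exact Fin.ext (Nat.mod_eq_of_lt a.2).symm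
    rw [avg, sum_eq_single (Fin.ofNat D.M (∑ l, (x (some l) : ℕ)))]
    · have h6 : ∀ y, S.indicator (1 : (Option (Fin d) → Fin D.M) → ℝ) y ≤ 1 :=
        Set.indicator_le_self' fun _ _ => zero_le_one
      simp only [measure]
      rw [one_div, inv_mul_eq_div]
      refine div_le_div_of_nonneg_right ?_ D.M_pos.le
      exact (mul_le_of_le_one_left (prod_nonneg fun j _ => D.majorant_nonneg _ _) (h6 _)).trans
        (h1 _)
    · intro a _ ha
      rw [Set.indicator_of_notMem fun hS' => ha (h3 a hS'), zero_mul, mul_zero]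
    · exact fun h => absurd (mem_univ _) h
  rw [← hw.ev_avg none, ← hw.ev_const ((D.R : ℝ) ^ (2 * d) / D.M)]
  exact hw.ev_mono h2

lemma pow_le_prod_erase_mul_majorant (htot : ∀ j, 0 < D.total j)
    (htot2 : ∀ j, D.total j ≤ 2 * D.M) {m : Fin d → ℕ} (hm : m ∈ X) (i : Option (Fin d)) :
    (D.mass / (2 * D.M)) ^ d ≤
      (∏ l ∈ univ.erase i, D.measure l (D.point m l)) * D.majorant i (D.point m) := by
  have hM := D.M_pos
  have hG := mass_pos D
  have h1 : ∀ l, D.mass / (2 * D.M) ≤ D.measure (some l) (D.point m (some l)) := fun l => by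
    simp only [measure]
    rw [h.point_some hm, h.weight_eq hm]
    exact div_le_div_of_nonneg_left hG.le (htot l) (htot2 l)
  have h0 : 0 ≤ D.mass / (2 * D.M) := by positivity
  cases i with
  | none =>
    have h2 : (univ : Finset (Option (Fin d))).erase none = univ.map Embedding.some := by
      ext i; cases i <;> simp
    rw [h2, prod_map]
    simp only [majorant, mul_one, Embedding.some_apply]
    calc (D.mass / (2 * D.M)) ^ d = ∏ _l : Fin d, D.mass / (2 * D.M) := by
          rw [prod_const, card_univ, Fintype.card_fin]
      _ ≤ _ := prod_le_prod (fun _ _ => h0) fun l _ => h1 l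
  | some j =>
    have h2 : (univ : Finset (Option (Fin d))).erase (some j) =
        insert none ((univ.erase j).map Embedding.some) := by
      ext i; cases i <;> simp
    rw [h2, prod_insert (by simp), prod_map]
    simp only [majorant, Embedding.some_apply]
    rw [h.missing_point hm, h.weight_eq hm, mul_right_comm]
    have h3 : D.mass / (2 * D.M) ≤ D.measure none (D.point m none) * D.mass := by
      simp only [measure]
      rw [one_div, inv_mul_eq_div]
      gcongr
      linarith
    have h4 : (D.mass / (2 * D.M)) ^ (d - 1) ≤
        ∏ l ∈ univ.erase j, D.measure (some l) (D.point m (some l)) := by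
      calc _ = ∏ _l ∈ univ.erase j, D.mass / (2 * D.M) := by
            rw [prod_const, card_erase_of_mem (mem_univ j), card_univ, Fintype.card_fin]
        _ ≤ _ := prod_le_prod (fun _ _ => h0) fun l _ => h1 l
    have hd : d - 1 + 1 = d := Nat.sub_add_cancel (Nat.one_le_of_lt (Fin.pos j))
    calc (D.mass / (2 * D.M)) ^ d = D.mass / (2 * D.M) * (D.mass / (2 * D.M)) ^ (d - 1) := by
          rw [← pow_succ', hd]
      _ ≤ _ := mul_le_mul h3 h4 (by positivity) (h0.trans h3)

lemma card_mul_pow_le (htot : ∀ j, 0 < D.total j) (htot2 : ∀ j, D.total j ≤ 2 * D.M)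
    {F : Option (Fin d) → Set (Option (Fin d) → Fin D.M)} (hF : ∀ i, Free _ _ i (· ∈ F i))
    (hF0 : ⋂ i, F i = ∅) {ε : ℝ}
    (hFε : ∀ i, (ev D.measure fun x => (D.pointSet X i \ F i).indicator 1 x * D.majorant i x) ≤ ε) :
    #X * (D.mass / (2 * D.M)) ^ d ≤ (d + 1) * ε := by
  classical
  have h1 : ∀ i, #{m ∈ X | D.point m ∉ F i} * (D.mass / (2 * D.M)) ^ d ≤ ε := fun i => by
    refine le_trans ?_ (hFε i)
    have hdiff : Free _ _ i (· ∈ D.pointSet X i \ F i) := fun x a =>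
      congrArg₂ (fun p q => p ∧ ¬ q) (D.free_pointSet X i x a) (hF i x a)
    have hfree := hdiff.indicator.mul (D.free_majorant i)
    have h2 := (D.isWeight_measure htot).sum_prod_erase_mul_le_ev
      (Y := ({m ∈ X | D.point m ∉ F i} : Finset _).image D.point) hfree
      (fun x => mul_nonneg (Set.indicator_nonneg (by simp) _) (D.majorant_nonneg i x))
      (fun y hy y' hy' he => by
        obtain ⟨m, hm, rfl⟩ := mem_image.1 hy
        obtain ⟨m', hm', rfl⟩ := mem_image.1 hy'
        rw [h.eq_of_point_eq (mem_filter.1 hm).1 (mem_filter.1 hm').1 he])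
    refine le_trans ?_ h2
    rw [sum_image fun m hm m' hm' he => h.eq_of_point_eq (i := none) (mem_filter.1 hm).1
      (mem_filter.1 hm').1 fun l _ => congrFun he l, ← nsmul_eq_mul]
    refine card_nsmul_le_sum _ _ _ fun m hm => ?_
    obtain ⟨hm, hmF⟩ := mem_filter.1 hm
    have h3 : D.point m ∈ D.pointSet X i \ F i := ⟨h.point_mem hm i, hmF⟩
    rw [Set.indicator_of_mem h3, Pi.one_apply, one_mul]
    exact h.pow_le_prod_erase_mul_majorant htot htot2 hm i
  have h3 : X ⊆ univ.biUnion fun i => {m ∈ X | D.point m ∉ F i} := fun m hm => by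
    have h4 : D.point m ∉ ⋂ i, F i := by rw [hF0]; exact Set.notMem_empty _
    rw [Set.mem_iInter] at h4
    push Not at h4
    obtain ⟨i, hi⟩ := h4
    exact mem_biUnion.2 ⟨i, mem_univ _, mem_filter.2 ⟨hm, hi⟩⟩
  have h5 : (#X : ℝ) ≤ ∑ i, (#{m ∈ X | D.point m ∉ F i} : ℝ) := by
    exact_mod_cast (card_le_card h3).trans card_biUnion_le
  have h6 : 0 ≤ (D.mass / (2 * D.M)) ^ d := by
    have := D.M_pos
    have := mass_pos D
    positivity
  calc _ ≤ (∑ i, (#{m ∈ X | D.point m ∉ F i} : ℝ)) * (D.mass / (2 * D.M)) ^ d :=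
        mul_le_mul_of_nonneg_right h5 h6
    _ ≤ ∑ _i : Option (Fin d), ε := by
        rw [sum_mul]
        exact sum_le_sum fun i _ => h1 i
    _ = _ := by simp

end Indexes
end SieveData
end RelCorners

namespace RelCorners
open Finset Function Filter Topology

lemma SieveData.exists_nondegenerate_corner {d : ℕ} {A : Set (Fin d → ℤ)} {η : ℝ} (hη : 0 < η)
    {D : ℕ → SieveData d} {X : ℕ → Finset (Fin d → ℕ)} {N : ℕ → ℕ} (hN : ∀ n, n ≤ N n)
    (h : ∀ n, (D n).Indexes A (N n) (X n))
    (hX : ∀ n, η ≤ #(X n) * ((D n).mass / (D n).M) ^ d) :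
    ∃ n, ∃ y ∈ A, (∀ i, (N n : ℤ) < y i) ∧ ∃ t ≠ 0, ∀ i,
      (fun j => y j + if j = i then t else 0) ∈ A := by
  by_contra! hcon
  have hne : ∀ n, (X n).Nonempty := fun n => by
    rw [nonempty_iff_ne_empty]
    intro h0
    have := hX n
    rw [h0, card_empty, Nat.cast_zero, zero_mul] at this
    linarith
  have htot : ∀ n j, 0 < (D n).total j := fun n => (h n).total_pos (hne n)
  have hW : ∀ n p, p.Prime → p ≤ n → p ∣ (D n).W := fun n p hp hpn =>
    (h n).dvd_W p hp (hpn.trans (hN n))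
  have hlevel : ∀ n, ((D n).R : ℝ) ^ (8 * formCount d) / (D n).M ≤ 1 / ((n : ℝ) + 1) := fun n =>
    (h n).level.trans (one_div_le_one_div_of_le (by positivity)
      (add_le_add_left (Nat.cast_le.2 (hN n)) 1))
  have hR : Tendsto (fun n => ((D n).R : ℝ) ^ (8 * formCount d) / (D n).M) atTop (𝓝 0) :=
    squeeze_zero (fun n => by positivity) hlevel tendsto_one_div_add_atTop_nhds_zero_nat
  have hpr := SieveData.isPseudorandom hW hR htot
  have hν : IsPseudorandom (hyperfilter ℕ) (fun n => (D n).measure) fun n => (D n).majorant :=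
    ⟨hpr.weight, hpr.nonneg, hpr.free, fun 𝒮 h𝒮 =>
      (hpr.tendsto 𝒮 h𝒮).mono_left Nat.hyperfilter_le_atTop⟩
  have hdiag : ∀ n, ∀ x ∈ ⋂ i, (D n).pointSet (X n) i,
      ((x none : ℕ) : ℤ) = ∑ l, ((x (some l) : ℕ) : ℤ) := fun n x hx => by
    obtain ⟨y, hy, hlt, hc⟩ := (h n).exists_corner hx
    by_contra hxs
    obtain ⟨i, hi⟩ := hcon n y hy hlt _
      (mul_ne_zero (Int.natCast_ne_zero.2 (h n).W_pos.ne') (sub_ne_zero.2 hxs))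
    exact hi (hc i)
  have hforms : 2 * d ≤ 8 * formCount d := by
    simp only [formCount, Fintype.card_sum, Fintype.card_prod, Fintype.card_fin, Fintype.card_bool]
    generalize Fintype.card (Finset (Option (Fin d))) = c
    nlinarith [Nat.zero_le (d * c)]
  have h0 : Tendsto (fun n => ev (D n).measure fun x =>
      (⋂ i, (D n).pointSet (X n) i).indicator 1 x * ∏ j, (D n).majorant j x)
      (hyperfilter ℕ) (𝓝 0) := by
    refine (squeeze_zero (fun n => (hpr.weight n).ev_nonneg fun x => mul_nonneg
      (Set.indicator_nonneg (fun _ _ => zero_le_one) x)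
      (prod_nonneg fun j _ => hpr.nonneg n j x)) (fun n => ?_) hR).mono_left
      Nat.hyperfilter_le_atTop
    refine (SieveData.Indexes.ev_le_of_subset_diagonal (htot n) (hdiag n)).trans ?_
    refine div_le_div_of_nonneg_right ?_ (D n).M_pos.le
    exact pow_le_pow_right₀ (by exact_mod_cast (D n).one_le_R) hforms
  obtain ⟨ε, hε⟩ : ∃ ε, ε = η / (2 ^ (d + 1) * ((d : ℝ) + 1)) := ⟨_, rfl⟩
  have hε0 : 0 < ε := by rw [hε]; positivity
  obtain ⟨F, hF, hF0, hFε⟩ := hν.exists_removal (A := fun i n => (D n).pointSet (X n) i)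
    (fun i n => (D n).free_pointSet (X n) i) h0 hε0
  have htot2 : ∀ᶠ n in hyperfilter ℕ, ∀ j, (D n).total j ≤ 2 * (D n).M := by
    refine Nat.hyperfilter_le_atTop (eventually_all.2 fun j => ?_)
    filter_upwards [(SieveData.tendsto_total_div hW hR j).eventually_le_const one_lt_two] with n hn
    exact (div_le_iff₀ (D n).M_pos).1 hn
  obtain ⟨n, ⟨hn0, hnε⟩, hn2⟩ := ((hF0.and hFε).and htot2).exists
  have h1 := (h n).card_mul_pow_le (htot n) hn2 (fun i => hF i n) hn0 hnε
  have h2 := hX n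
  have h3 : ((d : ℝ) + 1) * ε = η / 2 ^ d / 2 := by
    rw [hε]
    field_simp
    ring
  have h4 : (#(X n) : ℝ) * ((D n).mass / (2 * (D n).M)) ^ d =
      #(X n) * ((D n).mass / (D n).M) ^ d / 2 ^ d := by
    rw [mul_comm (2 : ℝ), ← div_div, div_pow _ (2 : ℝ), mul_div_assoc]
  rw [h3, h4] at h1
  have h5 : η / 2 ^ d ≤ #(X n) * ((D n).mass / (D n).M) ^ d / 2 ^ d :=
    div_le_div_of_nonneg_right h2 (by positivity)
  have h6 : 0 < η / 2 ^ d := by positivity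
  linarith

end RelCorners

/-- A subset of the `d`-tuples of primes of positive relative upper density contains
infinitely many nondegenerate corners. -/
theorem corners_in_dense_subsets_of_primes (d : ℕ) (hd : 1 ≤ d)
    (A : Set (Fin d → ℤ)) (hA : ∀ x ∈ A, ∀ i, 0 < x i ∧ Prime (x i))
    (hdens : 0 < relUpperDensity d A) :
    {p : (Fin d → ℤ) × ℤ | p.2 ≠ 0 ∧ p.1 ∈ A ∧
      ∀ i, (fun j => p.1 j + if j = i then p.2 else 0) ∈ A}.Infinite := by
  intro hfin
  obtain ⟨H, hH⟩ := (hfin.image fun p => p.1 ⟨0, hd⟩).bddAbove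
  obtain ⟨η, hη, hdata⟩ := RelCorners.exists_indexes hd hA hdens
  choose D X hD hX using hdata
  obtain ⟨n, y, hy, hlt, t, ht, hc⟩ := RelCorners.SieveData.exists_nondegenerate_corner hη
    (fun n => Nat.le_add_right n H.toNat) (fun n => hD (n + H.toNat)) fun n => hX (n + H.toNat)
  have h1 : y ⟨0, hd⟩ ≤ H := hH ⟨(y, t), ⟨ht, hy, hc⟩, rfl⟩
  have h2 := hlt ⟨0, hd⟩
  have h3 := Int.self_le_toNat H
  push_cast at h2
  omega
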